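/- arXiv:1001.0094 — 4 statements merged into one kernel-verified Lean document; each statement's English description precedes it below -/
import Mathlib

section
/- Let X and Y be Polish spaces, (Ω,F,P) a probability space, μ a probability kernel from Ω to X, ν a probability kernel from Ω to Y, and c : Ω×X×Y → [0,∞) a function such that for each ω the map (x,y) ↦ c(ω,x,y) is continuous, for each (x,y) the map ω ↦ c(ω,x,y) is F-measurable, and E ∫_{X×Y} c(ω,x,y) μ_ω(dx) ν_ω(dy) < +∞. Then C^stoch(c,μ,ν) = sup E( ∫_Y φ(ω,y) ν_ω(dy) − ∫_X ψ(ω,x) μ_ω(dx) ), where the supremum runs over all pairs (ψ,φ) of bounded jointly measurable functions ψ : Ω×X → ℝ and φ : Ω×Y → ℝ such that for each ω the maps x ↦ ψ(ω,x) and y ↦ φ(ω,y) are Lipschitz continuous, and φ(ω,y) − ψ(ω,x) ≤ c(ω,x,y) for all (ω,x,y). -/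
open MeasureTheory ProbabilityTheory Filter ENNReal NNReal

/-- The stochastic Monge–Kantorovich cost: the infimum, over all probability kernels `π`
from `Ω` to `X × Y` whose marginal kernels are `μ` and `ν`, of
`E ∫ c(ω,x,y) π_ω(dx,dy)`. -/
noncomputable def stochCost {Ω X Y : Type*} [MeasurableSpace Ω] [MeasurableSpace X]
    [MeasurableSpace Y] (P : Measure Ω) (c : Ω → X → Y → ℝ)
    (μ : Kernel Ω X) (ν : Kernel Ω Y) : ℝ≥0∞ :=
  ⨅ π ∈ {π : Kernel Ω (X × Y) | IsMarkovKernel π ∧ π.fst = μ ∧ π.snd = ν},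
    ∫⁻ ω, ∫⁻ q, ENNReal.ofReal (c ω q.1 q.2) ∂(π ω) ∂P


theorem hb_abstract {E : Type*} [NormedAddCommGroup E] [InnerProductSpace ℝ E] [CompleteSpace E]
    (p : Seminorm ℝ E) (B : ℝ) (hpB : ∀ u, p u ≤ B * ‖u‖) (C : Set (E × ℝ))
    (hadd : ∀ a ∈ C, ∀ b ∈ C, a + b ∈ C) (hsmul : ∀ t : ℝ, 0 < t → ∀ a ∈ C, t • a ∈ C)
    (h0 : (0 : E × ℝ) ∈ C) (hpos : ∀ a ∈ C, 0 ≤ a.2) (e : E) (he : e ≠ 0) :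
    ∃ γ : E, (∀ a ∈ C, inner ℝ γ a.1 ≤ a.2) ∧ (∀ u, inner ℝ γ u ≤ p u) ∧
      ∀ ε > 0, ∃ a ∈ C, a.2 + p (e - a.1) ≤ inner ℝ γ e + ε := by
  let g : E → ℝ := fun u => ⨅ k : C, (k.1.2 + p (u - k.1.1))
  have : Nonempty C := ⟨⟨0, h0⟩⟩
  have hnn : ∀ u (k : C), 0 ≤ k.1.2 + p (u - k.1.1) := fun u k =>
    add_nonneg (hpos _ k.2) (apply_nonneg p _)
  have hbdd : ∀ u, BddBelow (Set.range fun k : C => (k.1.2 + p (u - k.1.1))) := fun u =>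
    ⟨0, by rintro _ ⟨k, rfl⟩; exact hnn u k⟩
  have gle : ∀ u, ∀ a ∈ C, g u ≤ a.2 + p (u - a.1) := fun u a ha => ciInf_le (hbdd u) ⟨a, ha⟩
  have gnn : ∀ u, 0 ≤ g u := fun u => le_ciInf (hnn u)
  have gex : ∀ u, ∀ ε > 0, ∃ a ∈ C, a.2 + p (u - a.1) < g u + ε := by
    intro u ε hε
    obtain ⟨k, hk⟩ := exists_lt_of_ciInf_lt (show g u < g u + ε by linarith)
    exact ⟨k.1, k.2, hk⟩
  have ghom1 : ∀ t : ℝ, 0 < t → ∀ u, g (t • u) ≤ t * g u := by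
    intro t ht u
    refine le_of_forall_pos_le_add fun ε hε => ?_
    obtain ⟨a, ha, h⟩ := gex u (ε / t) (by positivity)
    have h1 := gle (t • u) (t • a) (hsmul t ht a ha)
    have h2 : p (t • u - (t • a).1) = t * p (u - a.1) := by
      rw [Prod.smul_fst, ← smul_sub, map_smul_eq_mul, Real.norm_of_nonneg ht.le]
    rw [h2] at h1
    have h3 : t * (a.2 + p (u - a.1)) ≤ t * (g u + ε / t) := by gcongr
    have h4 : t * (g u + ε / t) = t * g u + ε := by field_simp
    simp only [Prod.smul_snd, smul_eq_mul] at h1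
    linarith
  have ghom : ∀ t : ℝ, 0 < t → ∀ u, g (t • u) = t * g u := by
    intro t ht u
    refine le_antisymm (ghom1 t ht u) ?_
    have := ghom1 t⁻¹ (by positivity) (t • u)
    rw [smul_smul, inv_mul_cancel₀ ht.ne', one_smul] at this
    calc t * g u ≤ t * (t⁻¹ * g (t • u)) := by gcongr
      _ = _ := by field_simp
  have gadd : ∀ u v, g (u + v) ≤ g u + g v := by
    intro u v
    refine le_of_forall_pos_le_add fun ε hε => ?_
    obtain ⟨a, ha, h⟩ := gex u (ε / 2) (by positivity)
    obtain ⟨b, hb, h'⟩ := gex v (ε / 2) (by positivity)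
    have h1 := gle (u + v) (a + b) (hadd a ha b hb)
    have h2 : p (u + v - (a + b).1) ≤ p (u - a.1) + p (v - b.1) := by
      rw [Prod.fst_add, add_sub_add_comm]; exact map_add_le_add p _ _
    simp only [Prod.snd_add] at h1
    linarith
  let f : E →ₗ.[ℝ] ℝ := LinearPMap.mkSpanSingleton e (g e) he
  obtain ⟨l, hl1, hl2⟩ := exists_extension_of_le_sublinear f g ghom gadd (by
    rintro ⟨x, hx⟩
    obtain ⟨t, rfl⟩ := Submodule.mem_span_singleton.1 hx
    have : f ⟨t • e, hx⟩ = t • g e := LinearPMap.mkSpanSingleton'_apply _ _ _ _ _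
    rw [this, smul_eq_mul]
    rcases lt_trichotomy t 0 with ht | rfl | ht
    · exact (mul_nonpos_of_nonpos_of_nonneg ht.le (gnn e)).trans (gnn _)
    · simpa using gnn _
    · exact (ghom t ht e).ge)
  have hle : l e = g e := by
    have he' : e ∈ f.domain := Submodule.mem_span_singleton_self e
    have := hl1 ⟨e, he'⟩
    rw [this]
    exact LinearPMap.mkSpanSingleton_apply ℝ ℝ he (g e)
  have hlp : ∀ u, l u ≤ p u := fun u => (hl2 u).trans (by simpa using gle u 0 h0)
  let L : E →L[ℝ] ℝ := l.mkContinuous B (fun u => by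
    rw [Real.norm_eq_abs, abs_le]
    have h1 := (hlp u).trans (hpB u)
    have h2 := (hlp (-u)).trans (hpB (-u))
    rw [map_neg, norm_neg] at h2
    constructor <;> linarith)
  refine ⟨(InnerProductSpace.toDual ℝ E).symm L, ?_, ?_, ?_⟩
  · intro a ha
    rw [InnerProductSpace.toDual_symm_apply]
    exact (hl2 a.1).trans (by simpa using gle a.1 a ha)
  · intro u
    rw [InnerProductSpace.toDual_symm_apply]
    exact hlp u
  · intro ε hε
    rw [InnerProductSpace.toDual_symm_apply]
    obtain ⟨a, ha, h⟩ := gex e ε hε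
    refine ⟨a, ha, ?_⟩
    have : L e = g e := hle
    rw [this]; exact h.le


theorem hb_L2 {S : Type*} [MeasurableSpace S] (σ : Measure S) [IsFiniteMeasure σ] (hσ : σ ≠ 0)
    (N : ℝ) (hN : 0 ≤ N) (C : Set ((S → ℝ) × ℝ))
    (hC : ∀ a ∈ C, Measurable a.1 ∧ ∃ B : ℝ, ∀ s, |a.1 s| ≤ B)
    (hadd : ∀ a ∈ C, ∀ b ∈ C, a + b ∈ C) (hsmul : ∀ t : ℝ, 0 < t → ∀ a ∈ C, t • a ∈ C)
    (h0 : 0 ∈ C) (hpos : ∀ a ∈ C, 0 ≤ a.2) :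
    ∃ γ : S → ℝ, Measurable γ ∧ (∀ s, |γ s| ≤ N) ∧ (∀ a ∈ C, ∫ s, γ s * a.1 s ∂σ ≤ a.2) ∧
      ∀ ε > 0, ∃ a ∈ C, a.2 + N * ∫ s, |1 - a.1 s| ∂σ ≤ ∫ s, γ s ∂σ + ε := by
  let e : Lp ℝ 2 σ := (memLp_const (1 : ℝ)).toLp _
  have hee : ⇑e =ᵐ[σ] fun _ => (1 : ℝ) := MemLp.coeFn_toLp _
  have he : e ≠ 0 := by
    intro h
    rw [h] at hee
    have h1 : ∀ᵐ s ∂σ, False := by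
      filter_upwards [hee, Lp.coeFn_zero ℝ 2 σ] with s h1 h2
      rw [h2] at h1
      simp at h1
    rw [ae_iff] at h1
    simp at h1
    exact hσ h1
  have hint : ∀ u : Lp ℝ 2 σ, Integrable (fun s => u s) σ := fun u =>
    (Lp.memLp u).integrable (by norm_num)
  have inner_eq : ∀ u v : Lp ℝ 2 σ, inner ℝ u v = ∫ s, u s * v s ∂σ := by
    intro u v
    rw [L2.inner_def]
    refine integral_congr_ae (Eventually.of_forall fun s => ?_)
    simp [mul_comm]
  let p : Seminorm ℝ (Lp ℝ 2 σ) := Seminorm.of (fun u => N * ∫ s, |u s| ∂σ)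
    (fun u v => by
      rw [← mul_add, ← integral_add (hint u).abs (hint v).abs]
      gcongr ?_ * ?_
      refine integral_mono_ae (hint _).abs ((hint u).abs.add (hint v).abs) ?_
      filter_upwards [Lp.coeFn_add u v] with s hs
      rw [hs]; exact abs_add_le _ _)
    (fun t u => by
      have : ∫ s, |(t • u) s| ∂σ = ∫ s, |t| * |u s| ∂σ := by
        refine integral_congr_ae ?_
        filter_upwards [Lp.coeFn_smul t u] with s hs
        rw [hs]; simp [abs_mul]
      rw [this, integral_const_mul, Real.norm_eq_abs]; ring)
  have hp : ∀ u, p u = N * ∫ s, |u s| ∂σ := fun u => rfl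
  have hpB : ∀ u, p u ≤ (N * ‖e‖) * ‖u‖ := by
    intro u
    have h1 : ∫ s, |u s| ∂σ = inner ℝ e |u| := by
      rw [inner_eq]
      refine integral_congr_ae ?_
      filter_upwards [hee, Lp.coeFn_abs u] with s h1 h2
      rw [h1, h2, one_mul]
    rw [hp, h1, mul_assoc]
    gcongr
    exact (real_inner_le_norm _ _).trans_eq (by rw [norm_abs_eq_norm])
  let C' : Set (Lp ℝ 2 σ × ℝ) := {b | ∃ a ∈ C, b.1 =ᵐ[σ] a.1 ∧ b.2 = a.2}
  obtain ⟨γ, hγ1, hγ2, hγ3⟩ := hb_abstract p (N * ‖e‖) hpB C'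
    (by
      rintro b ⟨a, ha, h1, h2⟩ b' ⟨a', ha', h1', h2'⟩
      refine ⟨a + a', hadd a ha a' ha', ?_, by simp [h2, h2']⟩
      exact (Lp.coeFn_add _ _).trans (h1.add h1'))
    (by
      rintro t ht b ⟨a, ha, h1, h2⟩
      refine ⟨t • a, hsmul t ht a ha, ?_, by simp [h2]⟩
      exact (Lp.coeFn_smul _ _).trans (h1.const_smul t))
    ⟨0, h0, Lp.coeFn_zero _ _ _, rfl⟩
    (by rintro b ⟨a, ha, h1, h2⟩; rw [h2]; exact hpos a ha) e he
  have hset : ∀ A : Set S, MeasurableSet A → ∀ u : Lp ℝ 2 σ, (∀ v, inner ℝ u v ≤ p v) →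
      ∫ s in A, u s ∂σ ≤ ∫ s in A, N ∂σ := by
    intro A hA u hu
    have h1 := hu (indicatorConstLp 2 hA (measure_ne_top σ A) (1 : ℝ))
    rw [real_inner_comm, L2.inner_indicatorConstLp_one, hp] at h1
    refine h1.trans_eq ?_
    have : ∫ s, |(indicatorConstLp 2 hA (measure_ne_top σ A) (1 : ℝ)) s| ∂σ
        = ∫ s, A.indicator (fun _ => (1 : ℝ)) s ∂σ := by
      refine integral_congr_ae ?_
      filter_upwards [indicatorConstLp_coeFn (p := 2) (hs := hA) (hμs := measure_ne_top σ A)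
        (c := (1 : ℝ))] with s hs
      rw [hs]
      by_cases h : s ∈ A <;> simp [h]
    rw [this, integral_indicator hA]
    simp [mul_comm]
  have hup : ∀ u : Lp ℝ 2 σ, (∀ v, inner ℝ u v ≤ p v) → ∀ᵐ s ∂σ, u s ≤ N := fun u hu =>
    ae_le_of_forall_setIntegral_le (hint u) (integrable_const N) fun A hA _ => hset A hA u hu
  have hle1 := hup γ hγ2
  have hle2 := hup (-γ) (fun v => by
    rw [inner_neg_left, ← inner_neg_right]
    exact (hγ2 (-v)).trans_eq (map_neg_eq_map p v))
  have hγm := (Lp.aestronglyMeasurable γ)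
  let γ' : S → ℝ := fun s => max (-N) (min (hγm.mk γ s) N)
  have hγ' : γ =ᵐ[σ] γ' := by
    filter_upwards [hle1, hle2, hγm.ae_eq_mk, Lp.coeFn_neg γ] with s h1 h2 h3 h4
    rw [h4] at h2
    simp only [Pi.neg_apply] at h2
    simp only [γ', ← h3]
    rw [min_eq_left h1, max_eq_right (by linarith)]
  have key : ∀ (u : Lp ℝ 2 σ) (f : S → ℝ), u =ᵐ[σ] f → inner ℝ γ u = ∫ s, γ' s * f s ∂σ := by
    intro u f hu
    rw [inner_eq]
    refine integral_congr_ae ?_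
    filter_upwards [hγ', hu] with s h1 h2
    rw [h1, h2]
  refine ⟨γ', ?_, ?_, ?_, ?_⟩
  · exact measurable_const.max (hγm.stronglyMeasurable_mk.measurable.min measurable_const)
  · intro s
    rw [abs_le]
    exact ⟨le_max_left _ _, max_le (by linarith) (min_le_right _ _)⟩
  · intro a ha
    obtain ⟨hm, B, hB⟩ := hC a ha
    have hmem : MemLp a.1 2 σ := MemLp.of_bound hm.aestronglyMeasurable B
      (Eventually.of_forall hB)
    have := hγ1 (hmem.toLp _, a.2) ⟨a, ha, hmem.coeFn_toLp, rfl⟩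
    rwa [key _ _ hmem.coeFn_toLp] at this
  · intro ε hε
    obtain ⟨b, ⟨a, ha, h1, h2⟩, hb⟩ := hγ3 ε hε
    refine ⟨a, ha, ?_⟩
    rw [key e _ hee, h2, hp] at hb
    have : ∫ s, |(e - b.1) s| ∂σ = ∫ s, |1 - a.1 s| ∂σ := by
      refine integral_congr_ae ?_
      filter_upwards [hee, h1, Lp.coeFn_sub e b.1] with s h1 h2 h3
      rw [h3, Pi.sub_apply, h1, h2]
    rw [this] at hb
    simpa using hb


theorem regularize {Ω Z : Type*} [MeasurableSpace Ω] [MetricSpace Z] [SecondCountableTopology Z]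
    [MeasurableSpace Z] [BorelSpace Z] [Nonempty Z] (f : Ω → Z → ℝ) (hf0 : ∀ ω z, 0 ≤ f ω z)
    (hfc : ∀ ω, Continuous (f ω)) (hfm : ∀ z, Measurable fun ω => f ω z) (K : Set Z)
    (hK : IsCompact K) (ε : ℝ) (hε : 0 < ε) :
    ∃ f' : Ω → Z → ℝ, Measurable (fun q : Ω × Z => f' q.1 q.2) ∧ (∀ ω z, 0 ≤ f' ω z) ∧
      (∀ ω z, f' ω z ≤ f ω z) ∧ (∀ ω, ∃ L : ℝ≥0, LipschitzWith L (f' ω)) ∧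
      ∀ ω, ∀ z ∈ K, f ω z ≤ f' ω z + ε := by
  classical
  let d : ℕ → Z := TopologicalSpace.denseSeq Z
  have hd : DenseRange d := TopologicalSpace.denseRange_denseSeq Z
  let F : ℕ → Ω → Z → ℝ := fun n ω z => ⨅ k : ℕ, (f ω (d k) + n * dist z (d k))
  have hnn : ∀ (n : ℕ) ω z k, 0 ≤ f ω (d k) + n * dist z (d k) := fun n ω z k =>
    add_nonneg (hf0 _ _) (by positivity)
  have hbdd : ∀ (n : ℕ) ω z, BddBelow (Set.range fun k : ℕ => (f ω (d k) + n * dist z (d k))) :=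
    fun n ω z => ⟨0, by rintro _ ⟨k, rfl⟩; exact hnn n ω z k⟩
  have F0 : ∀ n ω z, 0 ≤ F n ω z := fun n ω z => le_ciInf (hnn n ω z)
  have Fm : ∀ n, Measurable (fun q : Ω × Z => F n q.1 q.2) := by
    intro n
    refine Measurable.iInf fun k => ?_
    exact ((hfm (d k)).comp measurable_fst).add
      (measurable_const.mul (measurable_snd.dist measurable_const))
  have FL : ∀ (n : ℕ) ω, LipschitzWith (n : ℝ≥0) (F n ω) := by
    intro n ω
    refine LipschitzWith.of_le_add_mul _ fun z z' => ?_
    rw [← sub_le_iff_le_add]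
    refine le_ciInf fun k => ?_
    rw [sub_le_iff_le_add]
    refine (ciInf_le (hbdd n ω z) k).trans ?_
    have : dist z (d k) ≤ dist z z' + dist z' (d k) := dist_triangle _ _ _
    have h2 : (n : ℝ) * dist z (d k) ≤ n * (dist z z' + dist z' (d k)) := by gcongr
    push_cast
    linarith
  have Fle : ∀ n ω z, F n ω z ≤ f ω z := by
    intro n ω z
    have hcl : IsClosed {z' | F n ω z ≤ f ω z' + n * dist z z'} :=
      isClosed_le continuous_const ((hfc ω).add (by fun_prop))
    have : ∀ z', F n ω z ≤ f ω z' + n * dist z z' := fun z' =>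
      hd.induction_on (p := fun z' => F n ω z ≤ f ω z' + n * dist z z') z' hcl
        (fun k => ciInf_le (hbdd n ω z) k)
    simpa using this z
  have Fex : ∀ ω, ∃ n : ℕ, ∀ z ∈ K, f ω z ≤ F n ω z + ε := by
    intro ω
    obtain ⟨M, hM⟩ : ∃ M, ∀ z ∈ K, f ω z ≤ M := by
      obtain ⟨M, hM⟩ := (hK.image (hfc ω)).bddAbove
      exact ⟨M, fun z hz => hM ⟨z, hz, rfl⟩⟩
    have hu := hK.uniformContinuousAt_of_continuousAt (f ω) (fun z _ => (hfc ω).continuousAt)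
      (Metric.dist_mem_uniformity hε)
    obtain ⟨δ, hδ, hu⟩ := Metric.mem_uniformity_dist.1 hu
    obtain ⟨n, hn⟩ := exists_nat_ge (M / δ)
    refine ⟨n, fun z hz => ?_⟩
    rw [← sub_le_iff_le_add]
    refine le_ciInf fun k => ?_
    by_cases h : dist z (d k) < δ
    · have h1 := hu h hz
      simp only [Set.mem_ofPred_eq, Real.dist_eq] at h1
      have := (abs_lt.1 h1).2
      have : 0 ≤ n * dist z (d k) := by positivity
      linarith
    · push Not at h
      have h1 : M ≤ n * δ := (div_le_iff₀ hδ).1 hn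
      have h2 : n * δ ≤ n * dist z (d k) := by gcongr
      have := hM z hz
      have := hf0 ω (d k)
      linarith
  obtain ⟨s, hsc, hsd⟩ := TopologicalSpace.exists_countable_dense K
  let p : Ω → ℕ → Prop := fun ω n => ∀ z ∈ s, f ω z ≤ F n ω z + ε
  have hp : ∀ ω, ∃ n, p ω n := fun ω => (Fex ω).imp fun n hn z _ => hn z z.2
  have hpm : ∀ n, MeasurableSet {ω | p ω n} := by
    intro n
    have : {ω | p ω n} = ⋂ z ∈ s, {ω | f ω z ≤ F n ω z + ε} := by ext; simp [p]
    rw [this]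
    refine MeasurableSet.biInter hsc fun z _ => measurableSet_le (hfm z) ?_
    exact ((Fm n).comp (measurable_id.prodMk measurable_const)).add_const _
  have hNm : Measurable fun ω => Nat.find (hp ω) := measurable_find hp hpm
  refine ⟨fun ω z => F (Nat.find (hp ω)) ω z, ?_, fun ω z => F0 _ _ _, fun ω z => Fle _ _ _,
    fun ω => ⟨_, FL _ ω⟩, ?_⟩
  · have : Measurable (fun r : ℕ × (Ω × Z) => F r.1 r.2.1 r.2.2) :=
      measurable_from_prod_countable_right fun n => Fm n
    exact this.comp ((hNm.comp measurable_fst).prodMk measurable_id)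
  · intro ω z hz
    have h1 := Nat.find_spec (hp ω)
    have hcl : IsClosed {z : K | f ω z ≤ F (Nat.find (hp ω)) ω z + ε} :=
      isClosed_le ((hfc ω).comp continuous_subtype_val)
        (((FL _ ω).continuous.comp continuous_subtype_val).add continuous_const)
    have h2 : closure s ⊆ {z : K | f ω z ≤ F (Nat.find (hp ω)) ω z + ε} :=
      closure_minimal (fun z hz => h1 z hz) hcl
    rw [hsd.closure_eq] at h2
    exact h2 (Set.mem_univ ⟨z, hz⟩)


theorem upgrade {Ω X Y : Type*} [MeasurableSpace Ω]
    [MetricSpace X] [SecondCountableTopology X] [MeasurableSpace X] [BorelSpace X] [Nonempty X]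
    [MetricSpace Y] [SecondCountableTopology Y] [MeasurableSpace Y] [BorelSpace Y]
    (P : Measure Ω) (μ : Kernel Ω X) (ν : Kernel Ω Y) [IsMarkovKernel ν]
    (c : Ω → X × Y → ℝ) (hcm : Measurable (fun q : Ω × (X × Y) => c q.1 q.2))
    (hc0 : ∀ ω z, 0 ≤ c ω z) (hcL : ∀ ω, ∃ L : ℝ≥0, LipschitzWith L (c ω))
    (N : ℝ) (hN : 0 ≤ N) (α : Ω × X → ℝ) (β : Ω × Y → ℝ)
    (hβm : Measurable β) (hα : ∀ s, |α s| ≤ N) (hβ : ∀ s, |β s| ≤ N)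
    (hae : ∀ᵐ ω ∂P, ∀ᵐ x ∂(μ ω), ∀ᵐ y ∂(ν ω), α (ω, x) + β (ω, y) ≤ c ω (x, y)) :
    ∃ (ψ : Ω → X → ℝ) (φ : Ω → Y → ℝ), Measurable (fun q : Ω × X => ψ q.1 q.2) ∧
      Measurable (fun q : Ω × Y => φ q.1 q.2) ∧ (∀ ω x, |ψ ω x| ≤ N) ∧ (∀ ω y, |φ ω y| ≤ N) ∧
      (∀ ω, ∃ L : ℝ≥0, LipschitzWith L (ψ ω)) ∧ (∀ ω, ∃ L : ℝ≥0, LipschitzWith L (φ ω)) ∧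
      (∀ ω x y, φ ω y - ψ ω x ≤ c ω (x, y)) ∧
      (∀ᵐ ω ∂P, ∀ᵐ x ∂(μ ω), ψ ω x ≤ - α (ω, x)) ∧
      (∀ ω, ∀ᵐ y ∂(ν ω), β (ω, y) ≤ φ ω y) := by
  classical
  let B : Ω → X → ℚ → Set Y := fun ω x q => {y | (q : ℝ) < β (ω, y) - c ω (x, y)}
  let T : ℚ → Ω → X → ℝ := fun q ω x => if ν ω (B ω x q) = 0 then -N else max (-N) (min q N)
  have T1 : ∀ q ω x, -N ≤ T q ω x := by
    intro q ω x; simp only [T]; split_ifs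
    · exact le_rfl
    · exact le_max_left _ _
  have T2 : ∀ q ω x, T q ω x ≤ N := by
    intro q ω x; simp only [T]; split_ifs
    · linarith
    · exact max_le (by linarith) (min_le_right _ _)
  let ψ : Ω → X → ℝ := fun ω x => ⨆ q : ℚ, T q ω x
  have hbdd : ∀ ω x, BddAbove (Set.range fun q : ℚ => T q ω x) := fun ω x =>
    ⟨N, by rintro _ ⟨q, rfl⟩; exact T2 q ω x⟩
  have Tψ : ∀ q ω x, T q ω x ≤ ψ ω x := fun q ω x => le_ciSup (hbdd ω x) q
  have ψ1 : ∀ ω x, -N ≤ ψ ω x := fun ω x => (T1 0 ω x).trans (Tψ 0 ω x)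
  have ψ2 : ∀ ω x, ψ ω x ≤ N := fun ω x => ciSup_le fun q => T2 q ω x
  have hBm : ∀ q, MeasurableSet {r : (Ω × X) × Y | r.2 ∈ B r.1.1 r.1.2 q} := by
    intro q
    change MeasurableSet {r : (Ω × X) × Y | (q : ℝ) < β (r.1.1, r.2) - c r.1.1 (r.1.2, r.2)}
    refine measurableSet_lt measurable_const ?_
    exact (hβm.comp (by fun_prop : Measurable fun r : (Ω × X) × Y => (r.1.1, r.2))).sub
      (hcm.comp (by fun_prop : Measurable fun r : (Ω × X) × Y => (r.1.1, (r.1.2, r.2))))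
  have ψm : Measurable (fun q : Ω × X => ψ q.1 q.2) := by
    refine Measurable.iSup fun q => ?_
    refine Measurable.ite ?_ measurable_const measurable_const
    have := Kernel.measurable_kernel_prodMk_left
      (κ := ν.comap (Prod.fst : Ω × X → Ω) measurable_fst) (hBm q)
    simp only [Kernel.comap_apply] at this
    exact this (measurableSet_singleton 0)
  -- a.e. domination
  have hA : ∀ ω x, ∀ᵐ y ∂(ν ω), β (ω, y) - c ω (x, y) ≤ ψ ω x := by
    intro ω x
    have h1 : ∀ q : ℚ, ∀ᵐ y ∂(ν ω), ψ ω x < q → β (ω, y) - c ω (x, y) ≤ q := by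
      intro q
      by_cases hq : ψ ω x < q
      · by_cases hqN : N ≤ q
        · refine Eventually.of_forall fun y _ => ?_
          have := (abs_le.1 (hβ (ω, y))).2
          have := hc0 ω (x, y)
          linarith
        · push Not at hqN
          have hnull : ν ω (B ω x q) = 0 := by
            by_contra h
            have h2 := Tψ q ω x
            simp only [T, if_neg h] at h2
            have := (le_max_right _ _).trans h2
            rw [min_eq_left hqN.le] at this
            linarith
          have := measure_eq_zero_iff_ae_notMem.1 hnull
          filter_upwards [this] with y hy _
          exact not_lt.1 hy
      · exact Eventually.of_forall fun y h => absurd h hq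
    filter_upwards [ae_all_iff.2 h1] with y hy
    refine le_of_forall_gt fun b hb => ?_
    obtain ⟨q, hq1, hq2⟩ := exists_rat_btwn hb
    exact (hy q hq1).trans_lt hq2
  have hψL : ∀ ω (L : ℝ≥0), LipschitzWith L (c ω) → LipschitzWith L (ψ ω) := by
    intro ω L hL
    refine LipschitzWith.of_le_add_mul _ fun x x' => ?_
    refine ciSup_le fun q => ?_
    have hD : 0 ≤ (L : ℝ) * dist x x' := by positivity
    have h0 := ψ1 ω x'
    simp only [T]; split_ifs with h
    · linarith
    · refine max_le (by linarith) ((min_le_left _ _).trans ?_)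
      by_contra hcon
      push Not at hcon
      apply h
      rw [measure_eq_zero_iff_ae_notMem]
      filter_upwards [hA ω x'] with y hy hyB
      have hyB' : (q : ℝ) < β (ω, y) - c ω (x, y) := hyB
      have h3 := hL.dist_le_mul (x', y) (x, y)
      rw [Real.dist_eq, Prod.dist_eq, dist_self, max_eq_left dist_nonneg, dist_comm x' x] at h3
      have := (abs_le.1 h3).2
      linarith
  let d : ℕ → X := TopologicalSpace.denseSeq X
  have hd : DenseRange d := TopologicalSpace.denseRange_denseSeq X
  let I : Ω → Y → ℝ := fun ω y => ⨅ k : ℕ, (ψ ω (d k) + c ω (d k, y))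
  have hnn : ∀ ω y k, -N ≤ ψ ω (d k) + c ω (d k, y) := fun ω y k => by
    have := ψ1 ω (d k)
    have := hc0 ω (d k, y)
    linarith
  have hIb : ∀ ω y, BddBelow (Set.range fun k : ℕ => (ψ ω (d k) + c ω (d k, y))) :=
    fun ω y => ⟨-N, by rintro _ ⟨k, rfl⟩; exact hnn ω y k⟩
  have I1 : ∀ ω y, -N ≤ I ω y := fun ω y => le_ciInf (hnn ω y)
  have Im : Measurable (fun q : Ω × Y => I q.1 q.2) := by
    refine Measurable.iInf fun k => ?_
    exact (ψm.comp (by fun_prop : Measurable fun q : Ω × Y => (q.1, d k))).add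
      (hcm.comp (by fun_prop : Measurable fun q : Ω × Y => (q.1, (d k, q.2))))
  have IL : ∀ ω (L : ℝ≥0), LipschitzWith L (c ω) → LipschitzWith L (I ω) := by
    intro ω L hL
    refine LipschitzWith.of_le_add_mul _ fun y y' => ?_
    rw [← sub_le_iff_le_add]
    refine le_ciInf fun k => ?_
    rw [sub_le_iff_le_add]
    refine (ciInf_le (hIb ω y) k).trans ?_
    have h3 := hL.dist_le_mul (d k, y) (d k, y')
    rw [Real.dist_eq, Prod.dist_eq, dist_self, max_eq_right dist_nonneg] at h3
    have := (abs_le.1 h3).2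
    dsimp only at this
    linarith
  have Ile : ∀ ω x y, I ω y ≤ ψ ω x + c ω (x, y) := by
    intro ω x y
    obtain ⟨L, hL⟩ := hcL ω
    have hcl : IsClosed {x | I ω y ≤ ψ ω x + c ω (x, y)} :=
      isClosed_le continuous_const ((hψL ω L hL).continuous.add
        (hL.continuous.comp (by fun_prop)))
    exact hd.induction_on (p := fun x => I ω y ≤ ψ ω x + c ω (x, y)) x hcl
      (fun k => ciInf_le (hIb ω y) k)
  refine ⟨ψ, fun ω y => min N (I ω y), ψm, measurable_const.min Im,
    fun ω x => abs_le.2 ⟨ψ1 ω x, ψ2 ω x⟩,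
    fun ω y => abs_le.2 ⟨le_min (by linarith) (I1 ω y), min_le_left _ _⟩,
    fun ω => (hcL ω).imp fun L hL => hψL ω L hL, fun ω => (hcL ω).imp fun L hL =>
      (IL ω L hL).const_min N, ?_, ?_, ?_⟩
  · intro ω x y
    have := Ile ω x y
    have := min_le_right N (I ω y)
    linarith
  · filter_upwards [hae] with ω hω
    filter_upwards [hω] with x hx
    refine ciSup_le fun q => ?_
    have h0 := (abs_le.1 (hα (ω, x))).2
    simp only [T]; split_ifs with h
    · linarith
    · refine max_le (by linarith) ((min_le_left _ _).trans ?_)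
      by_contra hcon
      push Not at hcon
      apply h
      rw [measure_eq_zero_iff_ae_notMem]
      filter_upwards [hx] with y hy hyB
      have hyB' : (q : ℝ) < β (ω, y) - c ω (x, y) := hyB
      linarith
  · intro ω
    filter_upwards [ae_all_iff.2 fun k => hA ω (d k)] with y hy
    refine le_min (abs_le.1 (hβ (ω, y))).2 (le_ciInf fun k => ?_)
    have := hy k
    linarith


noncomputable def mX {Ω X Y : Type*} [MeasurableSpace Ω] [MeasurableSpace Y] [MeasurableSpace X]
    (ν : Kernel Ω Y) (h : Ω × X × Y → ℝ) (s : Ω × X) : ℝ := ∫ y, h (s.1, s.2, y) ∂(ν s.1)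

noncomputable def mY {Ω X Y : Type*} [MeasurableSpace Ω] [MeasurableSpace Y] [MeasurableSpace X]
    (μ : Kernel Ω X) (h : Ω × X × Y → ℝ) (s : Ω × Y) : ℝ := ∫ x, h (s.1, x, s.2) ∂(μ s.1)

section marg

variable {Ω X Y : Type*} [MeasurableSpace Ω] [MeasurableSpace X] [MeasurableSpace Y]
    (P : Measure Ω) [IsProbabilityMeasure P]
    (μ : Kernel Ω X) [IsMarkovKernel μ] (ν : Kernel Ω Y) [IsMarkovKernel ν]

theorem bdd_integrable {S : Type*} [MeasurableSpace S] (σ : Measure S) [IsFiniteMeasure σ]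
    {f : S → ℝ} (hf : Measurable f) {B : ℝ} (hB : ∀ s, |f s| ≤ B) : Integrable f σ :=
  Integrable.of_bound hf.aestronglyMeasurable B (Eventually.of_forall hB)

theorem abs_integral_le_bdd {S : Type*} [MeasurableSpace S] (σ : Measure S)
    [IsProbabilityMeasure σ] {f : S → ℝ} {B : ℝ} (hB : ∀ s, |f s| ≤ B) : |∫ s, f s ∂σ| ≤ B := by
  have := norm_integral_le_of_norm_le_const (μ := σ) (f := f) (C := B) (Eventually.of_forall hB)
  simpa using this

theorem mX_meas {h : Ω × X × Y → ℝ} (hm : Measurable h) : Measurable (mX ν h) := by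
  have hs : StronglyMeasurable (fun r : (Ω × X) × Y => h (r.1.1, r.1.2, r.2)) :=
    (hm.comp (by fun_prop)).stronglyMeasurable
  have := hs.integral_kernel_prod_right'
    (κ := ν.comap (Prod.fst : Ω × X → Ω) measurable_fst)
  simp only [Kernel.comap_apply] at this
  exact this.measurable

theorem mY_meas {h : Ω × X × Y → ℝ} (hm : Measurable h) : Measurable (mY μ h) := by
  have hs : StronglyMeasurable (fun r : (Ω × Y) × X => h (r.1.1, r.2, r.1.2)) :=
    (hm.comp (by fun_prop)).stronglyMeasurable
  have := hs.integral_kernel_prod_right'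
    (κ := μ.comap (Prod.fst : Ω × Y → Ω) measurable_fst)
  simp only [Kernel.comap_apply] at this
  exact this.measurable

theorem mX_bdd {h : Ω × X × Y → ℝ} {B : ℝ} (hB : ∀ s, |h s| ≤ B) (s : Ω × X) : |mX ν h s| ≤ B :=
  abs_integral_le_bdd _ fun _ => hB _

theorem mY_bdd {h : Ω × X × Y → ℝ} {B : ℝ} (hB : ∀ s, |h s| ≤ B) (s : Ω × Y) : |mY μ h s| ≤ B :=
  abs_integral_le_bdd _ fun _ => hB _

theorem marg_X {h : Ω × X × Y → ℝ} (hm : Measurable h) {B : ℝ} (hB : ∀ s, |h s| ≤ B)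
    {F : Ω × X → ℝ} (hF : Measurable F) {N : ℝ} (hN : ∀ s, |F s| ≤ N) :
    ∫ z, F (z.1, z.2.1) * h z ∂(P ⊗ₘ (μ ×ₖ ν)) =
      ∫ z, F (z.1, z.2.1) * mX ν h (z.1, z.2.1) ∂(P ⊗ₘ (μ ×ₖ ν)) := by
  have hFh : ∀ z : Ω × X × Y, |F (z.1, z.2.1) * h z| ≤ N * B := fun z => by
    rw [abs_mul]; exact mul_le_mul (hN _) (hB _) (abs_nonneg _) ((abs_nonneg _).trans (hN (z.1, z.2.1)))
  have hFhm : Measurable fun z : Ω × X × Y => F (z.1, z.2.1) * h z := (hF.comp (by fun_prop)).mul hm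
  have hFX : ∀ z : Ω × X × Y, |F (z.1, z.2.1) * mX ν h (z.1, z.2.1)| ≤ N * B := fun z => by
    rw [abs_mul]; exact mul_le_mul (hN _) (mX_bdd ν hB _) (abs_nonneg _) ((abs_nonneg _).trans (hN (z.1, z.2.1)))
  have hFXm : Measurable fun z : Ω × X × Y => F (z.1, z.2.1) * mX ν h (z.1, z.2.1) :=
    (hF.comp (by fun_prop)).mul ((mX_meas ν hm).comp (by fun_prop))
  rw [Measure.integral_compProd (bdd_integrable _ hFhm hFh),
    Measure.integral_compProd (bdd_integrable _ hFXm hFX)]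
  refine integral_congr_ae (Eventually.of_forall fun ω => ?_)
  simp only [Kernel.prod_apply]
  have i1 : Integrable (fun b : X × Y => F (ω, b.1) * h (ω, b)) ((μ ω).prod (ν ω)) :=
    bdd_integrable _ (hFhm.comp (by fun_prop : Measurable fun q : X × Y => (ω, q)))
      (fun q => hFh (ω, q))
  have i2 : Integrable (fun b : X × Y => F (ω, b.1) * mX ν h (ω, b.1)) ((μ ω).prod (ν ω)) :=
    bdd_integrable _ (hFXm.comp (by fun_prop : Measurable fun q : X × Y => (ω, q)))
      (fun q => hFX (ω, q))
  rw [integral_prod _ i1, integral_prod _ i2]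
  refine integral_congr_ae (Eventually.of_forall fun x => ?_)
  simp only
  rw [integral_const_mul]
  simp [mX]

theorem marg_Y {h : Ω × X × Y → ℝ} (hm : Measurable h) {B : ℝ} (hB : ∀ s, |h s| ≤ B)
    {F : Ω × Y → ℝ} (hF : Measurable F) {N : ℝ} (hN : ∀ s, |F s| ≤ N) :
    ∫ z, F (z.1, z.2.2) * h z ∂(P ⊗ₘ (μ ×ₖ ν)) =
      ∫ z, F (z.1, z.2.2) * mY μ h (z.1, z.2.2) ∂(P ⊗ₘ (μ ×ₖ ν)) := by
  have hFh : ∀ z : Ω × X × Y, |F (z.1, z.2.2) * h z| ≤ N * B := fun z => by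
    rw [abs_mul]; exact mul_le_mul (hN _) (hB _) (abs_nonneg _) ((abs_nonneg _).trans (hN (z.1, z.2.2)))
  have hFhm : Measurable fun z : Ω × X × Y => F (z.1, z.2.2) * h z := (hF.comp (by fun_prop)).mul hm
  have hFX : ∀ z : Ω × X × Y, |F (z.1, z.2.2) * mY μ h (z.1, z.2.2)| ≤ N * B := fun z => by
    rw [abs_mul]; exact mul_le_mul (hN _) (mY_bdd μ hB _) (abs_nonneg _) ((abs_nonneg _).trans (hN (z.1, z.2.2)))
  have hFXm : Measurable fun z : Ω × X × Y => F (z.1, z.2.2) * mY μ h (z.1, z.2.2) :=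
    (hF.comp (by fun_prop)).mul ((mY_meas μ hm).comp (by fun_prop))
  rw [Measure.integral_compProd (bdd_integrable _ hFhm hFh),
    Measure.integral_compProd (bdd_integrable _ hFXm hFX)]
  refine integral_congr_ae (Eventually.of_forall fun ω => ?_)
  simp only [Kernel.prod_apply]
  have i1 : Integrable (fun b : X × Y => F (ω, b.2) * h (ω, b)) ((μ ω).prod (ν ω)) :=
    bdd_integrable _ (hFhm.comp (by fun_prop : Measurable fun q : X × Y => (ω, q)))
      (fun q => hFh (ω, q))
  have i2 : Integrable (fun b : X × Y => F (ω, b.2) * mY μ h (ω, b.2)) ((μ ω).prod (ν ω)) :=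
    bdd_integrable _ (hFXm.comp (by fun_prop : Measurable fun q : X × Y => (ω, q)))
      (fun q => hFX (ω, q))
  rw [integral_prod_symm _ i1, integral_prod_symm _ i2]
  refine integral_congr_ae (Eventually.of_forall fun y => ?_)
  simp only
  rw [integral_const_mul]
  simp [mY]

end marg


theorem dual_exists {Ω X Y : Type*} [MeasurableSpace Ω] [MeasurableSpace X] [MeasurableSpace Y]
    (P : Measure Ω) [IsProbabilityMeasure P]
    (μ : Kernel Ω X) [IsMarkovKernel μ] (ν : Kernel Ω Y) [IsMarkovKernel ν]
    (c : Ω × X × Y → ℝ) (hc0 : ∀ z, 0 ≤ c z)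
    (hci : Integrable c (P ⊗ₘ (μ ×ₖ ν))) (N : ℝ) (hN : 0 ≤ N) :
    ∃ (α : Ω × X → ℝ) (β : Ω × Y → ℝ), Measurable α ∧ Measurable β ∧ (∀ s, |α s| ≤ N) ∧
      (∀ s, |β s| ≤ N) ∧
      (∀ᵐ z ∂(P ⊗ₘ (μ ×ₖ ν)), α (z.1, z.2.1) + β (z.1, z.2.2) ≤ c z) ∧
      ∀ ε > 0, ∃ h : Ω × X × Y → ℝ, Measurable h ∧ (∀ z, 0 ≤ h z) ∧ (∃ B, ∀ z, |h z| ≤ B) ∧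
        ∫ z, c z * h z ∂(P ⊗ₘ (μ ×ₖ ν)) +
          N * (∫ z, |1 - mX ν h (z.1, z.2.1)| ∂(P ⊗ₘ (μ ×ₖ ν)) +
            ∫ z, |1 - mY μ h (z.1, z.2.2)| ∂(P ⊗ₘ (μ ×ₖ ν))) ≤
          ∫ z, (α (z.1, z.2.1) + β (z.1, z.2.2)) ∂(P ⊗ₘ (μ ×ₖ ν)) + ε := by
  set m : Measure (Ω × X × Y) := P ⊗ₘ (μ ×ₖ ν) with hm
  let p : Ω × X × Y → (Ω × X) ⊕ (Ω × Y) := fun z => Sum.inl (z.1, z.2.1)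
  let q : Ω × X × Y → (Ω × X) ⊕ (Ω × Y) := fun z => Sum.inr (z.1, z.2.2)
  have hp : Measurable p := measurable_inl.comp (by fun_prop)
  have hq : Measurable q := measurable_inr.comp (by fun_prop)
  let σ : Measure ((Ω × X) ⊕ (Ω × Y)) := m.map p + m.map q
  have hσint : ∀ (u : (Ω × X) ⊕ (Ω × Y) → ℝ) (B : ℝ), Measurable u → (∀ s, |u s| ≤ B) →
      ∫ s, u s ∂σ = ∫ z, u (Sum.inl (z.1, z.2.1)) ∂m + ∫ z, u (Sum.inr (z.1, z.2.2)) ∂m := by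
    intro u B hu hB
    rw [integral_add_measure (bdd_integrable _ hu hB) (bdd_integrable _ hu hB),
      integral_map hp.aemeasurable hu.aestronglyMeasurable,
      integral_map hq.aemeasurable hu.aestronglyMeasurable]
  have hσ : σ ≠ 0 := by
    intro h
    have h1 := hσint (fun _ => 1) 1 measurable_const (by simp)
    rw [h] at h1
    simp at h1
    norm_num at h1
  have mch : ∀ {h : Ω × X × Y → ℝ} {B : ℝ}, Measurable h → (∀ z, |h z| ≤ B) →
      Integrable (fun z => c z * h z) m := fun {h B} h1 h2 =>
    hci.mul_bdd (c := B) h1.aestronglyMeasurable (Eventually.of_forall h2)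
  have iX : ∀ {h : Ω × X × Y → ℝ} {B : ℝ}, Measurable h → (∀ z, |h z| ≤ B) → ∀ s : Ω × X,
      Integrable (fun y => h (s.1, s.2, y)) (ν s.1) := fun h1 h2 s =>
    bdd_integrable _ (h1.comp (by fun_prop)) fun y => h2 _
  have iY : ∀ {h : Ω × X × Y → ℝ} {B : ℝ}, Measurable h → (∀ z, |h z| ≤ B) → ∀ s : Ω × Y,
      Integrable (fun x => h (s.1, x, s.2)) (μ s.1) := fun h1 h2 s =>
    bdd_integrable _ (h1.comp (by fun_prop)) fun y => h2 _
  let C : Set (((Ω × X) ⊕ (Ω × Y) → ℝ) × ℝ) := {a | ∃ h : Ω × X × Y → ℝ, Measurable h ∧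
    (∀ z, 0 ≤ h z) ∧ (∃ B, ∀ z, |h z| ≤ B) ∧ a = (Sum.elim (mX ν h) (mY μ h), ∫ z, c z * h z ∂m)}
  obtain ⟨γ, γm, γb, γ1, γ2⟩ := hb_L2 σ hσ N hN C
    (by
      rintro _ ⟨h, h1, h2, ⟨B, hB⟩, rfl⟩
      refine ⟨(mX_meas ν h1).sumElim (mY_meas μ h1), B, ?_⟩
      rintro (s | s)
      · exact mX_bdd ν hB s
      · exact mY_bdd μ hB s)
    (by
      rintro _ ⟨h, h1, h2, ⟨B, hB⟩, rfl⟩ _ ⟨h', h1', h2', ⟨B', hB'⟩, rfl⟩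
      refine ⟨fun z => h z + h' z, h1.add h1', fun z => add_nonneg (h2 z) (h2' z), ⟨B + B', ?_⟩, ?_⟩
      · intro z; exact (abs_add_le _ _).trans (add_le_add (hB z) (hB' z))
      · refine Prod.ext ?_ ?_
        · funext s
          rcases s with s | s
          · exact (integral_add (iX h1 hB s) (iX h1' hB' s)).symm
          · exact (integral_add (iY h1 hB s) (iY h1' hB' s)).symm
        · simp only [Prod.mk_add_mk, mul_add]
          exact (integral_add (mch h1 hB) (mch h1' hB')).symm)
    (by
      rintro t ht _ ⟨h, h1, h2, ⟨B, hB⟩, rfl⟩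
      refine ⟨fun z => t * h z, h1.const_mul t, fun z => mul_nonneg ht.le (h2 z), ⟨t * B, ?_⟩, ?_⟩
      · intro z
        rw [abs_mul, abs_of_pos ht]
        exact mul_le_mul_of_nonneg_left (hB z) ht.le
      · refine Prod.ext ?_ ?_
        · funext s
          rcases s with s | s
          · exact (integral_const_mul t _).symm
          · exact (integral_const_mul t _).symm
        · simp only [Prod.smul_mk, smul_eq_mul]
          rw [← integral_const_mul]
          congr 1; funext z; ring)
    ⟨fun _ => 0, measurable_const, fun _ => le_rfl, ⟨0, by simp⟩, by
      refine Prod.ext ?_ (by simp)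
      funext s
      rcases s with s | s <;> simp [mX, mY]⟩
    (by
      rintro _ ⟨h, h1, h2, ⟨B, hB⟩, rfl⟩
      exact integral_nonneg fun z => mul_nonneg (hc0 z) (h2 z))
  have αm : Measurable fun s => γ (Sum.inl s) := γm.comp measurable_inl
  have βm : Measurable fun s => γ (Sum.inr s) := γm.comp measurable_inr
  have αm' : Measurable fun z : Ω × X × Y => γ (Sum.inl (z.1, z.2.1)) := γm.comp hp
  have βm' : Measurable fun z : Ω × X × Y => γ (Sum.inr (z.1, z.2.2)) := γm.comp hq
  have iα : Integrable (fun z : Ω × X × Y => γ (Sum.inl (z.1, z.2.1))) m :=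
    bdd_integrable _ αm' fun _ => γb _
  have iβ : Integrable (fun z : Ω × X × Y => γ (Sum.inr (z.1, z.2.2))) m :=
    bdd_integrable _ βm' fun _ => γb _
  refine ⟨fun s => γ (Sum.inl s), fun s => γ (Sum.inr s), αm, βm, fun s => γb _, fun s => γb _,
    ?_, ?_⟩
  · refine ae_le_of_forall_setIntegral_le (iα.add iβ) hci fun A hA _ => ?_
    let h : Ω × X × Y → ℝ := A.indicator fun _ => 1
    have h1 : Measurable h := measurable_const.indicator hA
    have h2 : ∀ z, 0 ≤ h z := fun z => Set.indicator_nonneg (fun _ _ => zero_le_one) z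
    have hB : ∀ z, |h z| ≤ 1 := fun z => by
      by_cases hz : z ∈ A <;> simp [h, hz]
    have := γ1 _ ⟨h, h1, h2, ⟨1, hB⟩, rfl⟩
    rw [hσint (fun s => γ s * Sum.elim (mX ν h) (mY μ h) s) (N * 1) (γm.mul ((mX_meas ν h1).sumElim (mY_meas μ h1))) (by
      intro s
      rw [abs_mul]
      refine mul_le_mul (γb s) ?_ (abs_nonneg _) hN
      rcases s with s | s
      · exact mX_bdd ν hB s
      · exact mY_bdd μ hB s)] at this
    simp only [Sum.elim_inl, Sum.elim_inr] at this
    rw [hm, ← marg_X P μ ν h1 hB αm (fun s => γb _), ← marg_Y P μ ν h1 hB βm (fun s => γb _),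
      ← hm, ← integral_add] at this
    · rw [← integral_indicator hA, ← integral_indicator hA]
      convert this using 2
      · funext z; by_cases hz : z ∈ A <;> simp [h, hz]
      · funext z; by_cases hz : z ∈ A <;> simp [h, hz]
    · exact iα.mul_bdd (c := 1) h1.aestronglyMeasurable (Eventually.of_forall hB)
    · exact iβ.mul_bdd (c := 1) h1.aestronglyMeasurable (Eventually.of_forall hB)
  · intro ε hε
    obtain ⟨_, ⟨h, h1, h2, ⟨B, hB⟩, rfl⟩, ha⟩ := γ2 ε hε
    refine ⟨h, h1, h2, ⟨B, hB⟩, ?_⟩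
    rw [hσint _ N γm γb, hσint _ (1 + B)
      (by exact (measurable_const.sub ((mX_meas ν h1).sumElim (mY_meas μ h1))).norm) (by
      intro s
      rw [abs_abs]
      refine (abs_sub _ _).trans ?_
      rw [abs_one]
      gcongr
      rcases s with s | s
      · exact mX_bdd ν hB s
      · exact mY_bdd μ hB s)] at ha
    rw [integral_add iα iβ]
    simpa using ha


section repair

variable {Ω X Y : Type*} [MeasurableSpace Ω] [MeasurableSpace X] [MeasurableSpace Y]
    (P : Measure Ω) [IsProbabilityMeasure P]
    (μ : Kernel Ω X) [IsMarkovKernel μ] (ν : Kernel Ω Y) [IsMarkovKernel ν]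

theorem density_kernel (c : Ω × X × Y → ℝ) (hcm : Measurable c) (hc0 : ∀ z, 0 ≤ c z)
    (hci : Integrable c (P ⊗ₘ (μ ×ₖ ν)))
    (k : Ω × X × Y → ℝ) (hkm : Measurable k) (hk0 : ∀ z, 0 ≤ k z) {B : ℝ} (hkB : ∀ z, |k z| ≤ B)
    (hkX : ∀ s, mX ν k s = 1) (hkY : ∀ s, mY μ k s = 1) :
    ∃ π : Kernel Ω (X × Y), (IsMarkovKernel π ∧ π.fst = μ ∧ π.snd = ν) ∧
      ∫⁻ ω, ∫⁻ q, ENNReal.ofReal (c (ω, q)) ∂(π ω) ∂P =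
        ENNReal.ofReal (∫ z, c z * k z ∂(P ⊗ₘ (μ ×ₖ ν))) := by
  let D : Ω → X × Y → ℝ≥0∞ := fun ω q => ENNReal.ofReal (k (ω, q))
  have hD : Measurable (Function.uncurry D) := by
    have : Function.uncurry D = fun z => ENNReal.ofReal (k z) := by
      funext z; rfl
    rw [this]; exact hkm.ennreal_ofReal
  let π : Kernel Ω (X × Y) := Kernel.withDensity (μ ×ₖ ν) D
  have hX : ∀ ω x, ∫⁻ y, D ω (x, y) ∂(ν ω) = 1 := by
    intro ω x
    have i : Integrable (fun y => k (ω, x, y)) (ν ω) :=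
      bdd_integrable _ (hkm.comp (by fun_prop)) fun y => hkB _
    simp only [D]
    rw [← ofReal_integral_eq_lintegral_ofReal i (Eventually.of_forall fun y => hk0 _)]
    have := hkX (ω, x)
    simp only [mX] at this
    rw [this, ENNReal.ofReal_one]
  have hY : ∀ ω y, ∫⁻ x, D ω (x, y) ∂(μ ω) = 1 := by
    intro ω y
    have i : Integrable (fun x => k (ω, x, y)) (μ ω) :=
      bdd_integrable _ (hkm.comp (by fun_prop)) fun y => hkB _
    simp only [D]
    rw [← ofReal_integral_eq_lintegral_ofReal i (Eventually.of_forall fun y => hk0 _)]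
    have := hkY (ω, y)
    simp only [mY] at this
    rw [this, ENNReal.ofReal_one]
  have hDω : ∀ ω, Measurable (D ω) := fun ω => hD.comp measurable_prodMk_left
  have hfst : π.fst = μ := by
    ext ω A hA
    rw [Kernel.fst_apply' _ _ hA, Kernel.withDensity_apply' _ hD, Kernel.prod_apply]
    have : {p : X × Y | p.1 ∈ A} = A ×ˢ Set.univ := by ext; simp
    rw [this, ← Measure.prod_restrict, lintegral_prod _ (hDω ω).aemeasurable]
    simp [hX]
  have hsnd : π.snd = ν := by
    ext ω A hA
    rw [Kernel.snd_apply' _ _ hA, Kernel.withDensity_apply' _ hD, Kernel.prod_apply]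
    have : (Prod.snd ⁻¹' A : Set (X × Y)) = Set.univ ×ˢ A := by ext; simp
    rw [this, ← Measure.prod_restrict, lintegral_prod_symm _ (hDω ω).aemeasurable]
    simp [hY]
  have hmk : IsMarkovKernel π := by
    refine ⟨fun ω => ⟨?_⟩⟩
    have h1 : π.fst ω Set.univ = 1 := by rw [hfst]; exact measure_univ
    rwa [Kernel.fst_apply' _ _ MeasurableSet.univ] at h1
  refine ⟨π, ⟨hmk, hfst, hsnd⟩, ?_⟩
  have hck : Integrable (fun z => c z * k z) (P ⊗ₘ (μ ×ₖ ν)) :=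
    hci.mul_bdd (c := B) hkm.aestronglyMeasurable (Eventually.of_forall hkB)
  have hck_m : Measurable fun z => ENNReal.ofReal (c z * k z) := (hcm.mul hkm).ennreal_ofReal
  rw [ofReal_integral_eq_lintegral_ofReal hck
    (Eventually.of_forall fun z => mul_nonneg (hc0 z) (hk0 z)),
    Measure.lintegral_compProd hck_m]
  refine lintegral_congr fun ω => ?_
  have hcω : Measurable fun q => ENNReal.ofReal (c (ω, q)) :=
    (hcm.comp measurable_prodMk_left).ennreal_ofReal
  change ∫⁻ q, ENNReal.ofReal (c (ω, q)) ∂(Kernel.withDensity (μ ×ₖ ν) D ω) = _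
  rw [Kernel.lintegral_withDensity _ hD _ hcω]
  refine lintegral_congr fun q => ?_
  rw [ENNReal.ofReal_mul (hc0 _), mul_comm]

theorem repair (c : Ω × X × Y → ℝ) (hcm : Measurable c) (hc0 : ∀ z, 0 ≤ c z)
    (hci : Integrable c (P ⊗ₘ (μ ×ₖ ν)))
    (h : Ω × X × Y → ℝ) (hm : Measurable h) (h0 : ∀ z, 0 ≤ h z) {B : ℝ} (hB : ∀ z, |h z| ≤ B)
    (hX : ∀ s, mX ν h s ≤ 1) (hY : ∀ s, mY μ h s ≤ 1) (η : ℝ) (hη : 0 < η) (hη1 : η ≤ 1) :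
    ∃ π : Kernel Ω (X × Y), (IsMarkovKernel π ∧ π.fst = μ ∧ π.snd = ν) ∧
      ∫⁻ ω, ∫⁻ q, ENNReal.ofReal (c (ω, q)) ∂(π ω) ∂P ≤
        ENNReal.ofReal (∫ z, c z * h z ∂(P ⊗ₘ (μ ×ₖ ν)) + η * ∫ z, c z ∂(P ⊗ₘ (μ ×ₖ ν)) +
          (1 + 1 / η) * (∫ z, c z * (1 - mX ν h (z.1, z.2.1)) ∂(P ⊗ₘ (μ ×ₖ ν)) +
            ∫ z, c z * (1 - mY μ h (z.1, z.2.2)) ∂(P ⊗ₘ (μ ×ₖ ν)))) := by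
  have hX0 : ∀ s, 0 ≤ mX ν h s := fun s => integral_nonneg fun _ => h0 _
  have hY0 : ∀ s, 0 ≤ mY μ h s := fun s => integral_nonneg fun _ => h0 _
  let M : Ω → ℝ := fun ω => ∫ x, mX ν h (ω, x) ∂(μ ω)
  have hXm := mX_meas ν hm
  have hYm := mY_meas μ hm
  have iX : ∀ ω, Integrable (fun x => mX ν h (ω, x)) (μ ω) := fun ω =>
    bdd_integrable _ (hXm.comp measurable_prodMk_left) fun x => mX_bdd ν hB _
  have iY : ∀ ω, Integrable (fun y => mY μ h (ω, y)) (ν ω) := fun ω =>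
    bdd_integrable _ (hYm.comp measurable_prodMk_left) fun x => mY_bdd μ hB _
  have hMY : ∀ ω, M ω = ∫ y, mY μ h (ω, y) ∂(ν ω) := by
    intro ω
    have i : Integrable (fun q : X × Y => h (ω, q)) ((μ ω).prod (ν ω)) :=
      bdd_integrable _ (hm.comp measurable_prodMk_left) fun q => hB _
    simp only [M, mX, mY]
    exact (integral_prod _ i).symm.trans (integral_prod_symm _ i)
  have hMm : Measurable M := by
    have := (hXm.stronglyMeasurable).integral_kernel_prod_right' (κ := μ)
    exact this.measurable
  have hM1 : ∀ ω, M ω ≤ 1 := fun ω => by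
    have := integral_mono (iX ω) (integrable_const 1) fun x => hX (ω, x)
    simpa using this
  let d : Ω → ℝ := fun ω => 1 - (1 - η) * M ω
  have hd : ∀ ω, η ≤ d ω := fun ω => by
    have := mul_le_mul_of_nonneg_left (hM1 ω) (show 0 ≤ 1 - η by linarith)
    simp only [d]; linarith
  have hdm : Measurable d := measurable_const.sub (hMm.const_mul _)
  let k : Ω × X × Y → ℝ := fun z => (1 - η) * h z +
    (1 - (1 - η) * mX ν h (z.1, z.2.1)) * (1 - (1 - η) * mY μ h (z.1, z.2.2)) / d z.1
  have hkm : Measurable k := by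
    refine (hm.const_mul _).add (Measurable.div (Measurable.mul ?_ ?_) (hdm.comp measurable_fst))
    · exact measurable_const.sub ((hXm.comp (by fun_prop)).const_mul _)
    · exact measurable_const.sub ((hYm.comp (by fun_prop)).const_mul _)
  have ha0 : ∀ t : ℝ, 0 ≤ t → t ≤ 1 → 0 ≤ 1 - (1 - η) * t := fun t h0 h1 => by
    have := mul_le_mul_of_nonneg_left h1 (show 0 ≤ 1 - η by linarith)
    linarith
  have ha1 : ∀ t : ℝ, 0 ≤ t → t ≤ 1 → 1 - (1 - η) * t ≤ η + (1 - t) := fun t h0 h1 => by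
    have := mul_nonneg hη.le (show 0 ≤ 1 - t by linarith)
    linarith
  have hk0 : ∀ z, 0 ≤ k z := fun z => by
    refine add_nonneg (mul_nonneg (by linarith) (h0 z)) (div_nonneg (mul_nonneg ?_ ?_) ?_)
    · exact ha0 _ (hX0 _) (hX _)
    · exact ha0 _ (hY0 _) (hY _)
    · exact hη.le.trans (hd _)
  have hkle : ∀ z, k z ≤ h z + η + (1 + 1 / η) * ((1 - mX ν h (z.1, z.2.1)) +
      (1 - mY μ h (z.1, z.2.2))) := by
    intro z
    have hs0 := hX0 (z.1, z.2.1)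
    have hs1 := hX (z.1, z.2.1)
    have ht0 := hY0 (z.1, z.2.2)
    have ht1 := hY (z.1, z.2.2)
    simp only [k]
    generalize mX ν h (z.1, z.2.1) = s at *
    generalize mY μ h (z.1, z.2.2) = t at *
    have e1 : (1 - (1 - η) * s) * (1 - (1 - η) * t) / d z.1 ≤ (η + (1 - s)) * (η + (1 - t)) / η := by
      refine div_le_div₀ (mul_nonneg (by linarith) (by linarith)) ?_ hη (hd _)
      exact mul_le_mul (ha1 s hs0 hs1) (ha1 t ht0 ht1) (ha0 t ht0 ht1) (by linarith)
    have e2 : (η + (1 - s)) * (η + (1 - t)) / η =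
        η + (1 - s) + (1 - t) + (1 - s) * (1 - t) / η := by field_simp; ring
    have e3 : (1 - s) * (1 - t) / η ≤ ((1 - s) + (1 - t)) / η := by
      gcongr
      nlinarith [mul_nonneg (sub_nonneg.2 hs1) (sub_nonneg.2 ht1)]
    have e4 : (1 + 1 / η) * ((1 - s) + (1 - t)) = (1 - s) + (1 - t) + ((1 - s) + (1 - t)) / η := by
      field_simp
    have e5 : (1 - η) * h z ≤ h z := by nlinarith [h0 z]
    linarith
  have hkB : ∀ z, |k z| ≤ B + η + (1 + 1 / η) * 2 := by
    intro z
    rw [abs_of_nonneg (hk0 z)]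
    refine (hkle z).trans ?_
    have := (abs_le.1 (hB z)).2
    have h1 := hX0 (z.1, z.2.1)
    have h2 := hY0 (z.1, z.2.2)
    gcongr
    linarith
  have hkX : ∀ s, mX ν k s = 1 := by
    rintro ⟨ω, x⟩
    have h1 : mX ν k (ω, x) = (1 - η) * mX ν h (ω, x) +
        (1 - (1 - η) * mX ν h (ω, x)) * (1 - (1 - η) * M ω) / d ω := by
      simp only [mX, k]
      rw [integral_add, integral_const_mul, integral_div, integral_const_mul, integral_sub,
        integral_const_mul, hMY]
      · simp
      · exact integrable_const _
      · exact (iY ω).const_mul _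
      · exact (bdd_integrable _ (hm.comp (by fun_prop : Measurable fun y => (ω, x, y)))
          (fun y => hB _)).const_mul _
      · exact (((integrable_const _).sub ((iY ω).const_mul _)).const_mul _).div_const _
    rw [h1]
    have := hd ω
    have hne : d ω ≠ 0 := by linarith
    change _ + (1 - (1 - η) * mX ν h (ω, x)) * d ω / d ω = 1
    field_simp
    ring
  have hkY : ∀ s, mY μ k s = 1 := by
    rintro ⟨ω, y⟩
    have h1 : mY μ k (ω, y) = (1 - η) * mY μ h (ω, y) +
        (1 - (1 - η) * M ω) * (1 - (1 - η) * mY μ h (ω, y)) / d ω := by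
      simp only [mY, k]
      rw [integral_add, integral_const_mul, integral_div, integral_mul_const, integral_sub,
        integral_const_mul]
      · simp [M]
      · exact integrable_const _
      · exact (iX ω).const_mul _
      · exact (bdd_integrable _ (hm.comp (by fun_prop : Measurable fun x => (ω, x, y)))
          (fun y => hB _)).const_mul _
      · exact (((integrable_const _).sub ((iX ω).const_mul _)).mul_const _).div_const _
    rw [h1]
    have := hd ω
    have hne : d ω ≠ 0 := by linarith
    change _ + d ω * (1 - (1 - η) * mY μ h (ω, y)) / d ω = 1
    field_simp
    ring
  obtain ⟨π, hπ, hcost⟩ := density_kernel P μ ν c hcm hc0 hci k hkm hk0 hkB hkX hkY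
  refine ⟨π, hπ, hcost.le.trans (ENNReal.ofReal_le_ofReal ?_)⟩
  have mch : ∀ {h : Ω × X × Y → ℝ} (B : ℝ), Measurable h → (∀ z, |h z| ≤ B) →
      Integrable (fun z => c z * h z) (P ⊗ₘ (μ ×ₖ ν)) := fun {h} B h1 h2 =>
    hci.mul_bdd (c := B) h1.aestronglyMeasurable (Eventually.of_forall h2)
  have j1 := mch B hm hB
  have j2 : Integrable (fun z => c z * (1 - mX ν h (z.1, z.2.1))) (P ⊗ₘ (μ ×ₖ ν)) :=
    mch 1 (measurable_const.sub (hXm.comp (by fun_prop))) fun z => by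
      rw [abs_of_nonneg (by linarith [hX (z.1, z.2.1)])]; linarith [hX0 (z.1, z.2.1)]
  have j3 : Integrable (fun z => c z * (1 - mY μ h (z.1, z.2.2))) (P ⊗ₘ (μ ×ₖ ν)) :=
    mch 1 (measurable_const.sub (hYm.comp (by fun_prop))) fun z => by
      rw [abs_of_nonneg (by linarith [hY (z.1, z.2.2)])]; linarith [hY0 (z.1, z.2.2)]
  have j12 : Integrable (fun z => c z * h z + η * c z) (P ⊗ₘ (μ ×ₖ ν)) :=
    j1.add (hci.const_mul η)
  have j23 : Integrable (fun z => (1 + 1 / η) * (c z * (1 - mX ν h (z.1, z.2.1)) +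
      c z * (1 - mY μ h (z.1, z.2.2)))) (P ⊗ₘ (μ ×ₖ ν)) := (j2.add j3).const_mul _
  rw [← integral_add j2 j3, ← integral_const_mul, ← integral_const_mul,
    ← integral_add j1 (hci.const_mul η), ← integral_add j12 j23]
  refine integral_mono (mch _ hkm hkB) (j12.add j23) fun z => ?_
  have := mul_le_mul_of_nonneg_left (hkle z) (hc0 z)
  linarith

end repair


section trunc

variable {Ω X Y : Type*} [MeasurableSpace Ω] [MeasurableSpace X] [MeasurableSpace Y]
    (P : Measure Ω) [IsProbabilityMeasure P]
    (μ : Kernel Ω X) [IsMarkovKernel μ] (ν : Kernel Ω Y) [IsMarkovKernel ν]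

theorem trunc (h : Ω × X × Y → ℝ) (hm : Measurable h) (h0 : ∀ z, 0 ≤ h z) {B : ℝ}
    (hB : ∀ z, |h z| ≤ B) (K : Set X) (hK : MeasurableSet K) (K' : Set Y) (hK' : MeasurableSet K')
    (κ κ' : ℝ)
    (hκ : 1 - κ ≤ ∫ z, K.indicator (fun _ => (1 : ℝ)) z.2.1 ∂(P ⊗ₘ (μ ×ₖ ν)))
    (hκ' : 1 - κ' ≤ ∫ z, K'.indicator (fun _ => (1 : ℝ)) z.2.2 ∂(P ⊗ₘ (μ ×ₖ ν))) :
    ∃ g : Ω × X × Y → ℝ, Measurable g ∧ (∀ z, 0 ≤ g z) ∧ (∀ z, g z ≤ h z) ∧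
      (∀ s, mX ν g s ≤ 1) ∧ (∀ s, mY μ g s ≤ 1) ∧
      (∀ z, z.2 ∉ K ×ˢ K' → g z = 0) ∧
      1 - κ - κ' - 2 * ∫ z, |1 - mX ν h (z.1, z.2.1)| ∂(P ⊗ₘ (μ ×ₖ ν)) -
        ∫ z, |1 - mY μ h (z.1, z.2.2)| ∂(P ⊗ₘ (μ ×ₖ ν)) ≤ ∫ z, g z ∂(P ⊗ₘ (μ ×ₖ ν)) := by
  have hX0 : ∀ s, 0 ≤ mX ν h s := fun s => integral_nonneg fun _ => h0 _
  have hY0 : ∀ s, 0 ≤ mY μ h s := fun s => integral_nonneg fun _ => h0 _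
  have hXm := mX_meas ν hm
  have hYm := mY_meas μ hm
  let u : Ω × X → ℝ := fun s => K.indicator (fun _ => (1 : ℝ)) s.2 * (max 1 (mX ν h s))⁻¹
  let v : Ω × Y → ℝ := fun s => K'.indicator (fun _ => (1 : ℝ)) s.2 * (max 1 (mY μ h s))⁻¹
  have hiK : Measurable fun s : Ω × X => K.indicator (fun _ => (1 : ℝ)) s.2 :=
    (measurable_const.indicator hK).comp measurable_snd
  have hiK' : Measurable fun s : Ω × Y => K'.indicator (fun _ => (1 : ℝ)) s.2 :=
    (measurable_const.indicator hK').comp measurable_snd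
  have hum : Measurable u := hiK.mul (measurable_const.max hXm).inv
  have hvm : Measurable v := hiK'.mul (measurable_const.max hYm).inv
  -- scalar facts
  have sc0 : ∀ t : ℝ, 0 ≤ (max 1 t)⁻¹ := fun t => inv_nonneg.2 (zero_le_one.trans (le_max_left _ _))
  have sc1 : ∀ t : ℝ, (max 1 t)⁻¹ ≤ 1 := fun t => inv_le_one_of_one_le₀ (le_max_left _ _)
  have sc2 : ∀ t : ℝ, (max 1 t)⁻¹ * t ≤ 1 := fun t => by
    have : (0 : ℝ) < max 1 t := zero_lt_one.trans_le (le_max_left _ _)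
    rw [inv_mul_le_iff₀ this]; simp
  have sc3 : ∀ t : ℝ, 1 - |1 - t| ≤ (max 1 t)⁻¹ * t := fun t => by
    rcases le_total t 1 with ht | ht
    · rw [max_eq_left ht, abs_of_nonneg (by linarith)]; simp
    · rw [max_eq_right ht, inv_mul_cancel₀ (by linarith)]; linarith [abs_nonneg (1 - t)]
  have ind : ∀ {S : Type _} (A : Set S) (s : S), A.indicator (fun _ => (1 : ℝ)) s = 0 ∧ s ∉ A ∨
      A.indicator (fun _ => (1 : ℝ)) s = 1 ∧ s ∈ A := fun A s => by
    by_cases hs : s ∈ A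
    · right; simp [hs]
    · left; simp [hs]
  have indY : ∀ (A : Set Y) (s : Y), A.indicator (fun _ => (1 : ℝ)) s = 0 ∧ s ∉ A ∨
      A.indicator (fun _ => (1 : ℝ)) s = 1 ∧ s ∈ A := fun A s => by
    by_cases hs : s ∈ A
    · right; simp [hs]
    · left; simp [hs]
  have hu : ∀ s, 0 ≤ u s ∧ u s ≤ 1 ∧ u s * mX ν h s ≤ 1 ∧
      K.indicator (fun _ => (1 : ℝ)) s.2 - |1 - mX ν h s| ≤ u s * mX ν h s ∧ (s.2 ∉ K → u s = 0) := by
    intro s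
    simp only [u]
    have := sc0 (mX ν h s)
    have := sc1 (mX ν h s)
    have := sc2 (mX ν h s)
    have := sc3 (mX ν h s)
    rcases ind K s.2 with ⟨h1, h2⟩ | ⟨h1, h2⟩ <;> rw [h1] <;> simp [*]
  have hv : ∀ s, 0 ≤ v s ∧ v s ≤ 1 ∧ v s * mY μ h s ≤ 1 ∧
      K'.indicator (fun _ => (1 : ℝ)) s.2 - |1 - mY μ h s| ≤ v s * mY μ h s ∧
      (s.2 ∉ K' → v s = 0) := by
    intro s
    simp only [v]
    have := sc0 (mY μ h s)
    have := sc1 (mY μ h s)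
    have := sc2 (mY μ h s)
    have := sc3 (mY μ h s)
    rcases indY K' s.2 with ⟨h1, h2⟩ | ⟨h1, h2⟩ <;> rw [h1] <;> simp [*]
  let U : Ω × X × Y → ℝ := fun z => u (z.1, z.2.1)
  let V : Ω × X × Y → ℝ := fun z => v (z.1, z.2.2)
  have hUm : Measurable U := hum.comp (by fun_prop)
  have hVm : Measurable V := hvm.comp (by fun_prop)
  have hU : ∀ z, 0 ≤ U z ∧ U z ≤ 1 := fun z => ⟨(hu _).1, (hu _).2.1⟩
  have hV : ∀ z, 0 ≤ V z ∧ V z ≤ 1 := fun z => ⟨(hv _).1, (hv _).2.1⟩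
  let g : Ω × X × Y → ℝ := fun z => U z * V z * h z
  have hgm : Measurable g := (hUm.mul hVm).mul hm
  have hg0 : ∀ z, 0 ≤ g z := fun z => mul_nonneg (mul_nonneg (hU z).1 (hV z).1) (h0 z)
  have hgU : ∀ z, g z ≤ U z * h z := fun z =>
    mul_le_mul_of_nonneg_right (mul_le_of_le_one_right (hU z).1 (hV z).2) (h0 z)
  have hgV : ∀ z, g z ≤ V z * h z := fun z =>
    mul_le_mul_of_nonneg_right (mul_le_of_le_one_left (hV z).1 (hU z).2) (h0 z)
  have hgh : ∀ z, g z ≤ h z := fun z =>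
    (hgU z).trans (mul_le_of_le_one_left (h0 z) (hU z).2)
  have hgB : ∀ z, |g z| ≤ B := fun z => by
    rw [abs_of_nonneg (hg0 z)]
    exact (hgh z).trans ((le_abs_self _).trans (hB z))
  refine ⟨g, hgm, hg0, hgh, ?_, ?_, ?_, ?_⟩
  · rintro ⟨ω, x⟩
    have hy : Measurable fun y : Y => (ω, x, y) := by fun_prop
    have : mX ν g (ω, x) ≤ u (ω, x) * mX ν h (ω, x) := by
      simp only [mX]
      rw [← integral_const_mul]
      exact integral_mono (bdd_integrable _ (hgm.comp hy) fun y => hgB _)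
        ((bdd_integrable _ (hm.comp hy) fun y => hB _).const_mul _) fun y => hgU _
    exact this.trans (hu _).2.2.1
  · rintro ⟨ω, y⟩
    have hx : Measurable fun x : X => (ω, x, y) := by fun_prop
    have : mY μ g (ω, y) ≤ v (ω, y) * mY μ h (ω, y) := by
      simp only [mY]
      rw [← integral_const_mul]
      exact integral_mono (bdd_integrable _ (hgm.comp hx) fun y => hgB _)
        ((bdd_integrable _ (hm.comp hx) fun y => hB _).const_mul _) fun y => hgV _
    exact this.trans (hv _).2.2.1
  · rintro ⟨ω, x, y⟩ hz
    simp only [Set.mem_prod, not_and_or] at hz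
    rcases hz with hz | hz
    · have : U (ω, x, y) = 0 := (hu (ω, x)).2.2.2.2 hz
      simp [g, this]
    · have : V (ω, x, y) = 0 := (hv (ω, y)).2.2.2.2 hz
      simp [g, this]
  · have e1 := marg_X P μ ν hm hB hum (N := 1) fun s => by
      rw [abs_of_nonneg (hu s).1]; exact (hu s).2.1
    have e2 := marg_Y P μ ν hm hB hvm (N := 1) fun s => by
      rw [abs_of_nonneg (hv s).1]; exact (hv s).2.1
    have e3 := marg_X P μ ν hm hB (F := fun _ => 1) measurable_const (N := 1) fun s => by simp
    simp only [one_mul] at e3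
    have mulB : ∀ {F : Ω × X × Y → ℝ} {h : Ω × X × Y → ℝ}, Measurable F → Measurable h →
        (∀ z, 0 ≤ F z ∧ F z ≤ 1) → (∀ z, |h z| ≤ B) →
        Integrable (fun z => F z * h z) (P ⊗ₘ (μ ×ₖ ν)) := fun {F h} a b c d =>
      bdd_integrable _ (a.mul b) (B := B) fun z => by
        rw [abs_mul, abs_of_nonneg (c z).1]
        exact (mul_le_of_le_one_left (abs_nonneg _) (c z).2).trans (d z)
    have hXm' : Measurable fun z : Ω × X × Y => mX ν h (z.1, z.2.1) := hXm.comp (by fun_prop)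
    have hYm' : Measurable fun z : Ω × X × Y => mY μ h (z.1, z.2.2) := hYm.comp (by fun_prop)
    have iX : Integrable (fun z : Ω × X × Y => mX ν h (z.1, z.2.1)) (P ⊗ₘ (μ ×ₖ ν)) :=
      bdd_integrable _ hXm' fun z => mX_bdd ν hB _
    have iY : Integrable (fun z : Ω × X × Y => mY μ h (z.1, z.2.2)) (P ⊗ₘ (μ ×ₖ ν)) :=
      bdd_integrable _ hYm' fun z => mY_bdd μ hB _
    have iaX : Integrable (fun z : Ω × X × Y => |1 - mX ν h (z.1, z.2.1)|) (P ⊗ₘ (μ ×ₖ ν)) :=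
      ((integrable_const 1).sub iX).abs
    have iaY : Integrable (fun z : Ω × X × Y => |1 - mY μ h (z.1, z.2.2)|) (P ⊗ₘ (μ ×ₖ ν)) :=
      ((integrable_const 1).sub iY).abs
    have iuh : Integrable (fun z => U z * h z) (P ⊗ₘ (μ ×ₖ ν)) := mulB hUm hm hU hB
    have ivh : Integrable (fun z => V z * h z) (P ⊗ₘ (μ ×ₖ ν)) := mulB hVm hm hV hB
    have ih : Integrable h (P ⊗ₘ (μ ×ₖ ν)) := bdd_integrable _ hm hB
    have ikX : Integrable (fun z : Ω × X × Y => K.indicator (fun _ => (1 : ℝ)) z.2.1)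
        (P ⊗ₘ (μ ×ₖ ν)) :=
      bdd_integrable _ (hiK.comp (by fun_prop : Measurable fun z : Ω × X × Y => (z.1, z.2.1)))
        (B := 1) fun z => by
          rcases ind K z.2.1 with ⟨h1, _⟩ | ⟨h1, _⟩ <;> simp [h1]
    have ikY : Integrable (fun z : Ω × X × Y => K'.indicator (fun _ => (1 : ℝ)) z.2.2)
        (P ⊗ₘ (μ ×ₖ ν)) :=
      bdd_integrable _ (hiK'.comp (by fun_prop : Measurable fun z : Ω × X × Y => (z.1, z.2.2)))
        (B := 1) fun z => by
          rcases indY K' z.2.2 with ⟨h1, _⟩ | ⟨h1, _⟩ <;> simp [h1]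
    have f1 : ∫ z, K.indicator (fun _ => (1 : ℝ)) z.2.1 ∂(P ⊗ₘ (μ ×ₖ ν)) -
        ∫ z, |1 - mX ν h (z.1, z.2.1)| ∂(P ⊗ₘ (μ ×ₖ ν)) ≤ ∫ z, U z * h z ∂(P ⊗ₘ (μ ×ₖ ν)) := by
      rw [show (∫ z, U z * h z ∂(P ⊗ₘ (μ ×ₖ ν))) = _ from e1, ← integral_sub ikX iaX]
      exact integral_mono (ikX.sub iaX) (mulB hUm hXm' hU fun z => mX_bdd ν hB _)
        fun z => (hu (z.1, z.2.1)).2.2.2.1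
    have f2 : ∫ z, K'.indicator (fun _ => (1 : ℝ)) z.2.2 ∂(P ⊗ₘ (μ ×ₖ ν)) -
        ∫ z, |1 - mY μ h (z.1, z.2.2)| ∂(P ⊗ₘ (μ ×ₖ ν)) ≤ ∫ z, V z * h z ∂(P ⊗ₘ (μ ×ₖ ν)) := by
      rw [show (∫ z, V z * h z ∂(P ⊗ₘ (μ ×ₖ ν))) = _ from e2, ← integral_sub ikY iaY]
      exact integral_mono (ikY.sub iaY) (mulB hVm hYm' hV fun z => mY_bdd μ hB _)
        fun z => (hv (z.1, z.2.2)).2.2.2.1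
    have f3 : ∫ z, h z ∂(P ⊗ₘ (μ ×ₖ ν)) ≤ 1 + ∫ z, |1 - mX ν h (z.1, z.2.1)| ∂(P ⊗ₘ (μ ×ₖ ν)) := by
      rw [e3]
      have : ∫ z, mX ν h (z.1, z.2.1) ∂(P ⊗ₘ (μ ×ₖ ν)) ≤
          ∫ z, (1 + |1 - mX ν h (z.1, z.2.1)|) ∂(P ⊗ₘ (μ ×ₖ ν)) :=
        integral_mono iX ((integrable_const 1).add iaX) fun z => by
          change mX ν h (z.1, z.2.1) ≤ 1 + |1 - mX ν h (z.1, z.2.1)|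
          linarith [neg_abs_le (1 - mX ν h (z.1, z.2.1))]
      rw [integral_add (integrable_const 1) iaX] at this
      simpa using this
    have iuv : Integrable (fun z => U z * h z + V z * h z) (P ⊗ₘ (μ ×ₖ ν)) := iuh.add ivh
    have f4 : ∫ z, U z * h z ∂(P ⊗ₘ (μ ×ₖ ν)) + ∫ z, V z * h z ∂(P ⊗ₘ (μ ×ₖ ν)) -
        ∫ z, h z ∂(P ⊗ₘ (μ ×ₖ ν)) ≤ ∫ z, g z ∂(P ⊗ₘ (μ ×ₖ ν)) := by
      rw [← integral_add iuh ivh, ← integral_sub iuv ih]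
      refine integral_mono (iuv.sub ih) (bdd_integrable _ hgm hgB) fun z => ?_
      have := mul_nonneg (mul_nonneg (sub_nonneg.2 (hU z).2) (sub_nonneg.2 (hV z).2)) (h0 z)
      simp only [g]
      linarith
    linarith

theorem unif_int {S : Type*} [MeasurableSpace S] (m : Measure S) [IsFiniteMeasure m] (c : S → ℝ)
    (hcm : Measurable c) (hc0 : ∀ z, 0 ≤ c z) (hci : Integrable c m) (ε : ℝ) (hε : 0 < ε) :
    ∃ δ : ℝ, 0 < δ ∧ ∀ s : S → ℝ, Measurable s → (∀ z, 0 ≤ s z) → (∀ z, s z ≤ 1) →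
      ∫ z, s z ∂m ≤ δ → ∫ z, c z * s z ∂m ≤ ε := by
  have ht : Tendsto (fun n : ℕ => ∫ z, max (c z - n) 0 ∂m) atTop (nhds (∫ _, (0 : ℝ) ∂m)) := by
    refine tendsto_integral_of_dominated_convergence c
      (fun n => ((hcm.sub_const _).max measurable_const).aestronglyMeasurable) hci ?_ ?_
    · refine fun n => Eventually.of_forall fun z => ?_
      rw [Real.norm_of_nonneg (le_max_right _ _)]
      exact max_le (by linarith [(Nat.cast_nonneg n : (0 : ℝ) ≤ n)]) (hc0 z)
    · refine Eventually.of_forall fun z => ?_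
      obtain ⟨n, hn⟩ := exists_nat_ge (c z)
      refine tendsto_const_nhds.congr' ?_
      filter_upwards [eventually_ge_atTop n] with k hk
      have : (n : ℝ) ≤ k := by exact_mod_cast hk
      rw [max_eq_right (by linarith)]
  rw [integral_zero] at ht
  obtain ⟨n, hn⟩ := (ht.eventually (gt_mem_nhds (half_pos hε))).exists
  refine ⟨ε / 2 / (n + 1), by positivity, fun s hsm hs0 hs1 hs => ?_⟩
  have i1 : Integrable (fun z => max (c z - n) 0) m := (hci.sub (integrable_const _)).pos_part
  have i2 : Integrable s m := bdd_integrable _ hsm (B := 1) fun z => by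
    rw [abs_of_nonneg (hs0 z)]; exact hs1 z
  have : ∫ z, c z * s z ∂m ≤ ∫ z, (max (c z - n) 0 + n * s z) ∂m := by
    refine integral_mono (hci.mul_bdd (c := 1) hsm.aestronglyMeasurable
      (Eventually.of_forall fun z => ?_)) (i1.add (i2.const_mul _)) fun z => ?_
    · rw [Real.norm_of_nonneg (hs0 z)]; exact hs1 z
    · change c z * s z ≤ max (c z - n) 0 + n * s z
      have a := mul_le_mul_of_nonneg_right (le_max_left (c z - n) 0) (hs0 z)
      have b := mul_le_of_le_one_right (le_max_right (c z - n) 0) (hs1 z)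
      linarith
  rw [integral_add i1 (i2.const_mul _), integral_const_mul] at this
  have h3 : (n : ℝ) * ∫ z, s z ∂m ≤ ε / 2 := by
    have h4 : (n : ℝ) * ∫ z, s z ∂m ≤ n * (ε / 2 / (n + 1)) := by gcongr
    refine h4.trans ?_
    rw [mul_div_assoc', div_le_iff₀ (by positivity)]
    nlinarith
  linarith

end trunc


section final

theorem ofReal_integral_le {S : Type*} [MeasurableSpace S] (m : Measure S) {f : S → ℝ}
    (hf : Integrable f m) : ENNReal.ofReal (∫ z, f z ∂m) ≤ ∫⁻ z, ENNReal.ofReal (f z) ∂m := by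
  have i : Integrable (fun z => max (f z) 0) m := hf.pos_part
  have h1 : ∫ z, f z ∂m ≤ ∫ z, max (f z) 0 ∂m := integral_mono hf i fun z => le_max_left _ _
  refine (ENNReal.ofReal_le_ofReal h1).trans ?_
  rw [ofReal_integral_eq_lintegral_ofReal i (Eventually.of_forall fun z => le_max_right _ _)]
  refine lintegral_mono fun z => ?_
  simp [ENNReal.ofReal_max]

theorem weak_dual {Ω X Y : Type*} [MeasurableSpace Ω] [MeasurableSpace X] [MeasurableSpace Y]
    (P : Measure Ω) [IsProbabilityMeasure P]
    (μ : Kernel Ω X) [IsMarkovKernel μ] (ν : Kernel Ω Y) [IsMarkovKernel ν]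
    (c : Ω → X → Y → ℝ) (ψ : Ω → X → ℝ) (φ : Ω → Y → ℝ)
    (hψ : Measurable fun q : Ω × X => ψ q.1 q.2) (hφ : Measurable fun q : Ω × Y => φ q.1 q.2)
    {C C' : ℝ} (hC : ∀ ω x, |ψ ω x| ≤ C) (hC' : ∀ ω y, |φ ω y| ≤ C')
    (hle : ∀ ω x y, φ ω y - ψ ω x ≤ c ω x y)
    (π : Kernel Ω (X × Y)) [IsMarkovKernel π] (h1 : π.fst = μ) (h2 : π.snd = ν) :
    ENNReal.ofReal (∫ ω, ((∫ y, φ ω y ∂(ν ω)) - (∫ x, ψ ω x ∂(μ ω))) ∂P) ≤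
      ∫⁻ ω, ∫⁻ q, ENNReal.ofReal (c ω q.1 q.2) ∂(π ω) ∂P := by
  have mψ : ∀ ω, Measurable (ψ ω) := fun ω => hψ.comp measurable_prodMk_left
  have mφ : ∀ ω, Measurable (φ ω) := fun ω => hφ.comp measurable_prodMk_left
  have m1 : Measurable fun ω => ∫ y, φ ω y ∂(ν ω) :=
    ((hφ.stronglyMeasurable).integral_kernel_prod_right' (κ := ν)).measurable
  have m2 : Measurable fun ω => ∫ x, ψ ω x ∂(μ ω) :=
    ((hψ.stronglyMeasurable).integral_kernel_prod_right' (κ := μ)).measurable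
  have iJ : Integrable (fun ω => (∫ y, φ ω y ∂(ν ω)) - (∫ x, ψ ω x ∂(μ ω))) P :=
    (bdd_integrable _ m1 fun ω => abs_integral_le_bdd _ (hC' ω)).sub
      (bdd_integrable _ m2 fun ω => abs_integral_le_bdd _ (hC ω))
  refine (ofReal_integral_le P iJ).trans (lintegral_mono fun ω => ?_)
  have iφ : Integrable (fun q : X × Y => φ ω q.2) (π ω) :=
    bdd_integrable _ ((mφ ω).comp measurable_snd) fun q => hC' _ _
  have iψ : Integrable (fun q : X × Y => ψ ω q.1) (π ω) :=
    bdd_integrable _ ((mψ ω).comp measurable_fst) fun q => hC _ _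
  have e : (∫ y, φ ω y ∂(ν ω)) - (∫ x, ψ ω x ∂(μ ω)) =
      ∫ q, (φ ω q.2 - ψ ω q.1) ∂(π ω) := by
    rw [integral_sub iφ iψ, ← h1, ← h2, Kernel.fst_apply, Kernel.snd_apply,
      integral_map measurable_snd.aemeasurable (mφ ω).aestronglyMeasurable,
      integral_map measurable_fst.aemeasurable (mψ ω).aestronglyMeasurable]
  rw [e]
  refine (ofReal_integral_le _ (iφ.sub iψ)).trans (lintegral_mono fun q => ?_)
  exact ENNReal.ofReal_le_ofReal (hle _ _ _)

theorem tight_ind {S X : Type*} [MeasurableSpace S] (m : Measure S) [IsProbabilityMeasure m]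
    [MetricSpace X] [CompleteSpace X] [SecondCountableTopology X]
    [MeasurableSpace X] [BorelSpace X] (p : S → X) (hp : Measurable p) (κ : ℝ) (hκ : 0 < κ) :
    ∃ K : Set X, IsCompact K ∧ 1 - κ ≤ ∫ z, K.indicator (fun _ => (1 : ℝ)) (p z) ∂m := by
  have := Measure.isProbabilityMeasure_map (μ := m) hp.aemeasurable
  obtain ⟨K, hK, hKm⟩ := exists_isCompact_closure_measure_compl_lt (m.map p) (ENNReal.ofReal κ)
    (ENNReal.ofReal_pos.2 hκ)
  refine ⟨closure K, hK, ?_⟩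
  have hcm : MeasurableSet (closure K) := isClosed_closure.measurableSet
  have h1 : (m.map p).real (closure K)ᶜ ≤ κ := by
    refine ENNReal.toReal_le_of_le_ofReal hκ.le ?_
    exact (measure_mono (Set.compl_subset_compl.2 subset_closure)).trans hKm.le
  rw [probReal_compl_eq_one_sub hcm] at h1
  have h2 : ∫ z, (closure K).indicator (fun _ => (1 : ℝ)) (p z) ∂m = (m.map p).real (closure K) := by
    rw [← integral_map (f := (closure K).indicator fun _ => (1 : ℝ)) hp.aemeasurable
      (measurable_const.indicator hcm).aestronglyMeasurable, integral_indicator hcm]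
    simp
  linarith

theorem core {Ω X Y : Type*} [MeasurableSpace Ω]
    [MetricSpace X] [CompleteSpace X] [SecondCountableTopology X]
    [MeasurableSpace X] [BorelSpace X] [Nonempty X]
    [MetricSpace Y] [CompleteSpace Y] [SecondCountableTopology Y]
    [MeasurableSpace Y] [BorelSpace Y] [Nonempty Y]
    (P : Measure Ω) [IsProbabilityMeasure P]
    (μ : Kernel Ω X) [IsMarkovKernel μ] (ν : Kernel Ω Y) [IsMarkovKernel ν]
    (c : Ω → X × Y → ℝ)
    (hc0 : ∀ ω z, 0 ≤ c ω z) (hcc : ∀ ω, Continuous (c ω)) (hcω : ∀ z, Measurable fun ω => c ω z)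
    (hcm : Measurable fun z : Ω × X × Y => c z.1 z.2)
    (hci : Integrable (fun z : Ω × X × Y => c z.1 z.2) (P ⊗ₘ (μ ×ₖ ν)))
    (D : ℝ) (hD0 : 0 ≤ D)
    (hD : ∀ (ψ : Ω → X → ℝ) (φ : Ω → Y → ℝ), Measurable (fun q : Ω × X => ψ q.1 q.2) →
      Measurable (fun q : Ω × Y => φ q.1 q.2) → (∃ C : ℝ, ∀ ω x, |ψ ω x| ≤ C) →
      (∃ C : ℝ, ∀ ω y, |φ ω y| ≤ C) → (∀ ω, ∃ L : ℝ≥0, LipschitzWith L (ψ ω)) →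
      (∀ ω, ∃ L : ℝ≥0, LipschitzWith L (φ ω)) → (∀ ω x y, φ ω y - ψ ω x ≤ c ω (x, y)) →
      ∫ ω, ((∫ y, φ ω y ∂(ν ω)) - (∫ x, ψ ω x ∂(μ ω))) ∂P ≤ D)
    (ε : ℝ) (hε : 0 < ε) (hε1 : ε ≤ 1) :
    ∃ π : Kernel Ω (X × Y), (IsMarkovKernel π ∧ π.fst = μ ∧ π.snd = ν) ∧
      ∫⁻ ω, ∫⁻ q, ENNReal.ofReal (c ω q) ∂(π ω) ∂P ≤ ENNReal.ofReal (D + 4 * ε) := by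
  set m : Measure (Ω × X × Y) := P ⊗ₘ (μ ×ₖ ν) with hm
  set C : ℝ := ∫ z, c z.1 z.2 ∂m with hC
  have hC0 : 0 ≤ C := integral_nonneg fun z => hc0 _ _
  let η : ℝ := min 1 (ε / (C + 1))
  have hη : 0 < η := lt_min one_pos (by positivity)
  have hη1 : η ≤ 1 := min_le_left _ _
  have hηC : η * C ≤ ε := by
    have : η * C ≤ ε / (C + 1) * C := by
      gcongr
      exact min_le_right _ _
    refine this.trans ?_
    rw [div_mul_eq_mul_div, div_le_iff₀ (by positivity)]
    nlinarith
  obtain ⟨δ, hδ, hUI⟩ := unif_int m (fun z => c z.1 z.2) hcm (fun z => hc0 _ _) hci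
    (ε / (2 * (1 + 1 / η))) (by positivity)
  obtain ⟨K, hK, hKκ⟩ := tight_ind m (fun z => z.2.1) (by fun_prop) (δ / 4) (by positivity)
  obtain ⟨K', hK', hKκ'⟩ := tight_ind m (fun z => z.2.2) (by fun_prop) (δ / 4) (by positivity)
  obtain ⟨c', hcm', hc0', hcle, hcL', hcK⟩ := regularize c hc0 hcc hcω (K ×ˢ K') (hK.prod hK') ε hε
  let N : ℝ := 4 * (D + 1) / δ
  have hN : 0 < N := by positivity
  have hci' : Integrable (fun z : Ω × X × Y => c' z.1 z.2) m := by
    refine hci.mono' hcm'.aestronglyMeasurable (Eventually.of_forall fun z => ?_)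
    rw [Real.norm_of_nonneg (hc0' _ _)]; exact hcle _ _
  obtain ⟨α, β, hαm, hβm, hα, hβ, hae, hopt⟩ :=
    dual_exists P μ ν (fun z => c' z.1 z.2) (fun z => hc0' _ _) hci' N hN.le
  have hae' : ∀ᵐ ω ∂P, ∀ᵐ x ∂(μ ω), ∀ᵐ y ∂(ν ω), α (ω, x) + β (ω, y) ≤ c' ω (x, y) := by
    filter_upwards [Measure.ae_ae_of_ae_compProd hae] with ω hω
    rw [Kernel.prod_apply] at hω
    exact Measure.ae_ae_of_ae_prod hω
  obtain ⟨ψ, φ, hψm, hφm, hψN, hφN, hψL, hφL, hle, hψα, hφβ⟩ :=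
    upgrade P μ ν c' hcm' hc0' hcL' N hN.le α β hβm hα hβ hae'
  have hJ := hD ψ φ hψm hφm ⟨N, hψN⟩ ⟨N, hφN⟩ hψL hφL fun ω x y => (hle ω x y).trans (hcle _ _)
  have hαβ : ∫ z, (α (z.1, z.2.1) + β (z.1, z.2.2)) ∂m ≤ D := by
    refine le_trans ?_ hJ
    have pX : Measurable fun z : Ω × X × Y => (z.1, z.2.1) := by fun_prop
    have pY : Measurable fun z : Ω × X × Y => (z.1, z.2.2) := by fun_prop
    have iα : Integrable (fun z : Ω × X × Y => α (z.1, z.2.1)) m :=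
      bdd_integrable _ (hαm.comp pX) fun z => hα _
    have iβ : Integrable (fun z : Ω × X × Y => β (z.1, z.2.2)) m :=
      bdd_integrable _ (hβm.comp pY) fun z => hβ _
    have mψ' : Measurable fun z : Ω × X × Y => ψ z.1 z.2.1 := hψm.comp pX
    have mφ' : Measurable fun z : Ω × X × Y => φ z.1 z.2.2 := hφm.comp pY
    have iψ : Integrable (fun z : Ω × X × Y => ψ z.1 z.2.1) m :=
      bdd_integrable _ mψ' fun z => hψN _ _
    have iφ : Integrable (fun z : Ω × X × Y => φ z.1 z.2.2) m :=
      bdd_integrable _ mφ' fun z => hφN _ _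
    have iφψ : Integrable (fun z : Ω × X × Y => φ z.1 z.2.2 - ψ z.1 z.2.1) m := iφ.sub iψ
    have e : ∫ z, (φ z.1 z.2.2 - ψ z.1 z.2.1) ∂m =
        ∫ ω, ((∫ y, φ ω y ∂(ν ω)) - (∫ x, ψ ω x ∂(μ ω))) ∂P := by
      rw [hm, Measure.integral_compProd iφψ]
      refine integral_congr_ae (Eventually.of_forall fun ω => ?_)
      simp only [Kernel.prod_apply]
      have j1 : Integrable (fun q : X × Y => φ ω q.2) ((μ ω).prod (ν ω)) :=
        bdd_integrable _ ((hφm.comp measurable_prodMk_left).comp measurable_snd) fun q => hφN _ _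
      have j2 : Integrable (fun q : X × Y => ψ ω q.1) ((μ ω).prod (ν ω)) :=
        bdd_integrable _ ((hψm.comp measurable_prodMk_left).comp measurable_fst) fun q => hψN _ _
      rw [integral_sub j1 j2, integral_prod _ j1, integral_prod _ j2]
      simp
    rw [← e]
    refine integral_mono_ae (iα.add iβ) iφψ ?_
    refine Measure.ae_compProd_of_ae_ae ?_ ?_
    · exact measurableSet_le ((hαm.comp pX).add (hβm.comp pY)) (mφ'.sub mψ')
    · filter_upwards [hψα] with ω hω
      rw [Kernel.prod_apply]
      have a1 : ∀ᵐ q ∂((μ ω).prod (ν ω)), ψ ω q.1 ≤ - α (ω, q.1) :=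
        Measure.quasiMeasurePreserving_fst.ae hω
      have a2 : ∀ᵐ q ∂((μ ω).prod (ν ω)), β (ω, q.2) ≤ φ ω q.2 :=
        Measure.quasiMeasurePreserving_snd.ae (hφβ ω)
      filter_upwards [a1, a2] with q h1 h2
      change α (ω, q.1) + β (ω, q.2) ≤ φ ω q.2 - ψ ω q.1
      linarith
  obtain ⟨h, hhm, hh0, ⟨B, hB⟩, hhopt⟩ := hopt ε hε
  rw [← hm] at hhopt
  obtain ⟨g, hgm, hg0, hgh, hgX, hgY, hgK, hgmass⟩ := trunc P μ ν h hhm hh0 hB K hK.measurableSet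
    K' hK'.measurableSet (δ / 4) (δ / 4) hKκ hKκ'
  rw [← hm] at hgmass
  set dX := ∫ z, |1 - mX ν h (z.1, z.2.1)| ∂m
  set dY := ∫ z, |1 - mY μ h (z.1, z.2.2)| ∂m
  have hdX : 0 ≤ dX := integral_nonneg fun z => abs_nonneg _
  have hdY : 0 ≤ dY := integral_nonneg fun z => abs_nonneg _
  have hch : 0 ≤ ∫ z, c' z.1 z.2 * h z ∂m :=
    integral_nonneg fun z => mul_nonneg (hc0' _ _) (hh0 _)
  have hd : dX + dY ≤ δ / 4 := by
    have h1 : N * (dX + dY) ≤ D + 1 := by linarith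
    have h2 : N * (δ / 4) = D + 1 := by simp only [N]; field_simp
    rw [← h2] at h1
    exact le_of_mul_le_mul_left h1 hN
  have hmass : 1 - ∫ z, g z ∂m ≤ δ := by linarith
  have hgB : ∀ z, |g z| ≤ B := fun z => by
    rw [abs_of_nonneg (hg0 z)]
    exact (hgh z).trans ((le_abs_self _).trans (hB z))
  have hX0 : ∀ s, 0 ≤ mX ν g s := fun s => integral_nonneg fun _ => hg0 _
  have hY0 : ∀ s, 0 ≤ mY μ g s := fun s => integral_nonneg fun _ => hg0 _
  have eX := marg_X P μ ν hgm hgB (F := fun _ => 1) measurable_const (N := 1) fun s => by simp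
  have eY := marg_Y P μ ν hgm hgB (F := fun _ => 1) measurable_const (N := 1) fun s => by simp
  simp only [one_mul, ← hm] at eX eY
  have mgX : Measurable fun z : Ω × X × Y => mX ν g (z.1, z.2.1) :=
    (mX_meas ν hgm).comp (by fun_prop)
  have mgY : Measurable fun z : Ω × X × Y => mY μ g (z.1, z.2.2) :=
    (mY_meas μ hgm).comp (by fun_prop)
  have igX : Integrable (fun z : Ω × X × Y => mX ν g (z.1, z.2.1)) m :=
    bdd_integrable _ mgX fun z => mX_bdd ν hgB _
  have igY : Integrable (fun z : Ω × X × Y => mY μ g (z.1, z.2.2)) m :=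
    bdd_integrable _ mgY fun z => mY_bdd μ hgB _
  have uX := hUI (fun z => 1 - mX ν g (z.1, z.2.1)) (measurable_const.sub mgX)
    (fun z => sub_nonneg.2 (hgX _)) (fun z => by linarith [hX0 (z.1, z.2.1)])
    (by rw [integral_sub (integrable_const _) igX, ← eX]; simpa using hmass)
  have uY := hUI (fun z => 1 - mY μ g (z.1, z.2.2)) (measurable_const.sub mgY)
    (fun z => sub_nonneg.2 (hgY _)) (fun z => by linarith [hY0 (z.1, z.2.2)])
    (by rw [integral_sub (integrable_const _) igY, ← eY]; simpa using hmass)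
  have hg1 : ∫ z, g z ∂m ≤ 1 := by
    rw [eX]
    have := integral_mono igX (integrable_const (1 : ℝ)) fun z => hgX (z.1, z.2.1)
    simpa using this
  have ig : Integrable g m := bdd_integrable _ hgm hgB
  have icg : Integrable (fun z => c z.1 z.2 * g z) m :=
    hci.mul_bdd (c := B) hgm.aestronglyMeasurable (Eventually.of_forall hgB)
  have ich : Integrable (fun z => c' z.1 z.2 * h z) m :=
    hci'.mul_bdd (c := B) hhm.aestronglyMeasurable (Eventually.of_forall hB)
  have hcg : ∫ z, c z.1 z.2 * g z ∂m ≤ ∫ z, c' z.1 z.2 * h z ∂m + ε * ∫ z, g z ∂m := by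
    rw [← integral_const_mul, ← integral_add ich (ig.const_mul ε)]
    refine integral_mono icg (ich.add (ig.const_mul ε)) fun z => ?_
    change c z.1 z.2 * g z ≤ c' z.1 z.2 * h z + ε * g z
    have h3 : c' z.1 z.2 * g z ≤ c' z.1 z.2 * h z :=
      mul_le_mul_of_nonneg_left (hgh z) (hc0' _ _)
    by_cases hz : z.2 ∈ K ×ˢ K'
    · have := mul_le_mul_of_nonneg_right (hcK z.1 z.2 hz) (hg0 z)
      linarith
    · rw [hgK z hz] at h3 ⊢
      simpa using h3
  obtain ⟨π, hπ, hcost⟩ := repair P μ ν (fun z => c z.1 z.2) hcm (fun z => hc0 _ _) hci g hgm hg0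
    hgB hgX hgY η hη hη1
  refine ⟨π, hπ, hcost.trans (ENNReal.ofReal_le_ofReal ?_)⟩
  rw [← hm]
  have hlast : (1 + 1 / η) * (∫ z, c z.1 z.2 * (1 - mX ν g (z.1, z.2.1)) ∂m +
      ∫ z, c z.1 z.2 * (1 - mY μ g (z.1, z.2.2)) ∂m) ≤ ε := by
    have hp : 0 < 1 + 1 / η := by positivity
    have := mul_le_mul_of_nonneg_left (add_le_add uX uY) hp.le
    refine this.trans (le_of_eq ?_)
    field_simp
    ring
  have hN0 : 0 ≤ N * (dX + dY) := by positivity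
  have hεg : ε * ∫ z, g z ∂m ≤ ε := mul_le_of_le_one_right hε.le hg1
  linarith

end final


/-- **Stochastic Kantorovich duality (bounded Lipschitz version).**
`C^stoch(c,μ,ν)` equals the supremum of `E( ∫ φ(ω,y) ν_ω(dy) − ∫ ψ(ω,x) μ_ω(dx) )`
over all pairs `(ψ,φ)` of bounded jointly measurable functions which are Lipschitz in the
space variable for each `ω`, satisfying `φ(ω,y) − ψ(ω,x) ≤ c(ω,x,y)` everywhere. -/
theorem stochastic_kantorovich_duality_lipschitz
    {Ω X Y : Type*} [MeasurableSpace Ω]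
    [MetricSpace X] [CompleteSpace X] [SecondCountableTopology X]
    [MeasurableSpace X] [BorelSpace X]
    [MetricSpace Y] [CompleteSpace Y] [SecondCountableTopology Y]
    [MeasurableSpace Y] [BorelSpace Y]
    (P : Measure Ω) [IsProbabilityMeasure P]
    (μ : Kernel Ω X) [IsMarkovKernel μ] (ν : Kernel Ω Y) [IsMarkovKernel ν]
    (c : Ω → X → Y → ℝ)
    (hc_nonneg : ∀ ω x y, 0 ≤ c ω x y)
    (hc_cont : ∀ ω, Continuous (fun q : X × Y => c ω q.1 q.2))
    (hc_meas : ∀ x y, Measurable (fun ω => c ω x y))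
    (hint : ∫⁻ ω, ∫⁻ q, ENNReal.ofReal (c ω q.1 q.2) ∂((μ ω).prod (ν ω)) ∂P < ⊤) :
    stochCost P c μ ν =
      ⨆ pr : {pr : (Ω → X → ℝ) × (Ω → Y → ℝ) //
          Measurable (fun q : Ω × X => pr.1 q.1 q.2) ∧
          Measurable (fun q : Ω × Y => pr.2 q.1 q.2) ∧
          (∃ C : ℝ, ∀ ω x, |pr.1 ω x| ≤ C) ∧
          (∃ C : ℝ, ∀ ω y, |pr.2 ω y| ≤ C) ∧
          (∀ ω, ∃ K : ℝ≥0, LipschitzWith K (pr.1 ω)) ∧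
          (∀ ω, ∃ K : ℝ≥0, LipschitzWith K (pr.2 ω)) ∧
          ∀ ω x y, pr.2 ω y - pr.1 ω x ≤ c ω x y},
        ENNReal.ofReal
          (∫ ω, ((∫ y, pr.1.2 ω y ∂(ν ω)) - (∫ x, pr.1.1 ω x ∂(μ ω))) ∂P) := by
  have hne : Nonempty Ω := nonempty_of_isProbabilityMeasure P
  obtain ⟨ω₀⟩ := hne
  have : Nonempty X := nonempty_of_isProbabilityMeasure (μ ω₀)
  have : Nonempty Y := nonempty_of_isProbabilityMeasure (ν ω₀)
  have hcm : Measurable fun z : Ω × X × Y => c z.1 z.2.1 z.2.2 := by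
    have := measurable_uncurry_of_continuous_of_measurable
      (u := fun (q : X × Y) (ω : Ω) => c ω q.1 q.2) hc_cont fun q => hc_meas q.1 q.2
    exact this.comp measurable_swap
  have hcm' : Measurable fun z : Ω × X × Y => ENNReal.ofReal (c z.1 z.2.1 z.2.2) :=
    hcm.ennreal_ofReal
  have hci : Integrable (fun z : Ω × X × Y => c z.1 z.2.1 z.2.2) (P ⊗ₘ (μ ×ₖ ν)) := by
    refine ⟨hcm.aestronglyMeasurable, ?_⟩
    rw [hasFiniteIntegral_iff_ofReal (Eventually.of_forall fun z => hc_nonneg _ _ _),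
      Measure.lintegral_compProd hcm']
    simpa only [Kernel.prod_apply] using hint
  set S : ℝ≥0∞ := ⨆ pr : {pr : (Ω → X → ℝ) × (Ω → Y → ℝ) //
          Measurable (fun q : Ω × X => pr.1 q.1 q.2) ∧
          Measurable (fun q : Ω × Y => pr.2 q.1 q.2) ∧
          (∃ C : ℝ, ∀ ω x, |pr.1 ω x| ≤ C) ∧
          (∃ C : ℝ, ∀ ω y, |pr.2 ω y| ≤ C) ∧
          (∀ ω, ∃ K : ℝ≥0, LipschitzWith K (pr.1 ω)) ∧
          (∀ ω, ∃ K : ℝ≥0, LipschitzWith K (pr.2 ω)) ∧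
          ∀ ω x y, pr.2 ω y - pr.1 ω x ≤ c ω x y},
        ENNReal.ofReal
          (∫ ω, ((∫ y, pr.1.2 ω y ∂(ν ω)) - (∫ x, pr.1.1 ω x ∂(μ ω))) ∂P) with hS
  have hweak : S ≤ stochCost P c μ ν := by
    refine iSup_le ?_
    rintro ⟨⟨ψ, φ⟩, h1, h2, ⟨C, hC⟩, ⟨C', hC'⟩, -, -, hle⟩
    refine le_iInf₂ ?_
    rintro π ⟨hπ, hf, hs⟩
    exact weak_dual P μ ν c ψ φ h1 h2 hC hC' hle π hf hs
  have hfin : stochCost P c μ ν < ⊤ := by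
    have h1 : (μ ×ₖ ν).fst = μ := by simp
    have h2 : (μ ×ₖ ν).snd = ν := by simp
    refine lt_of_le_of_lt (iInf₂_le (μ ×ₖ ν) ⟨inferInstance, h1, h2⟩) ?_
    simpa only [Kernel.prod_apply] using hint
  have hStop : S ≠ ⊤ := (hweak.trans_lt hfin).ne
  refine le_antisymm ?_ hweak
  refine ENNReal.le_of_forall_pos_le_add fun ε hε _ => ?_
  have hε' : (0 : ℝ) < ε := hε
  obtain ⟨π, hπ, hcost⟩ := core P μ ν (fun ω q => c ω q.1 q.2) (fun ω q => hc_nonneg _ _ _) hc_cont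
    (fun q => hc_meas q.1 q.2) hcm hci S.toReal ENNReal.toReal_nonneg
    (fun ψ φ h1 h2 h3 h4 h5 h6 h7 => (ENNReal.ofReal_le_iff_le_toReal hStop).1
      (le_iSup_of_le (⟨(ψ, φ), h1, h2, h3, h4, h5, h6, h7⟩ : {pr : (Ω → X → ℝ) × (Ω → Y → ℝ) //
          Measurable (fun q : Ω × X => pr.1 q.1 q.2) ∧
          Measurable (fun q : Ω × Y => pr.2 q.1 q.2) ∧
          (∃ C : ℝ, ∀ ω x, |pr.1 ω x| ≤ C) ∧
          (∃ C : ℝ, ∀ ω y, |pr.2 ω y| ≤ C) ∧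
          (∀ ω, ∃ K : ℝ≥0, LipschitzWith K (pr.1 ω)) ∧
          (∀ ω, ∃ K : ℝ≥0, LipschitzWith K (pr.2 ω)) ∧
          ∀ ω x y, pr.2 ω y - pr.1 ω x ≤ c ω x y}) le_rfl))
    (min 1 (ε / 4)) (lt_min one_pos (by positivity)) (min_le_left _ _)
  refine (iInf₂_le π hπ).trans (hcost.trans ?_)
  have h1 : S.toReal + 4 * min 1 ((ε : ℝ) / 4) ≤ S.toReal + ε := by
    linarith [min_le_right (1 : ℝ) (ε / 4)]
  refine (ENNReal.ofReal_le_ofReal h1).trans ?_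
  rw [ENNReal.ofReal_add ENNReal.toReal_nonneg hε'.le, ENNReal.ofReal_toReal hStop,
    ENNReal.ofReal_coe_nnreal]
end

section
/- Let X and Y be Polish spaces, (Ω,F,P) a probability space, μ a probability kernel from Ω to X, ν a probability kernel from Ω to Y, and c : Ω×X×Y → [0,∞) a function such that for each ω the map (x,y) ↦ c(ω,x,y) is continuous, for each (x,y) the map ω ↦ c(ω,x,y) is F-measurable, and E ∫_{X×Y} c(ω,x,y) μ_ω(dx) ν_ω(dy) < +∞. Suppose π ∈ K(μ,ν) is such that for every ω the support of π_ω is a c(ω,·,·)-cyclically monotone set. Then there exist jointly measurable functions ψ : Ω×X → (−∞,+∞] and φ : Ω×Y → [−∞,+∞) such that φ(ω,y) − ψ(ω,x) ≤ c(ω,x,y) for all (ω,x,y), for each ω the function ψ(ω,·) is c(ω,·,·)-convex, and for each ω the set Γ_ω := {(x,y) : φ(ω,y) − ψ(ω,x) = c(ω,x,y)} is contained in the c(ω)-subdifferential ∂_c ψ(ω) and has π_ω-full measure. -/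
open MeasureTheory ProbabilityTheory Filter ENNReal

/-- A set `Γ ⊆ X × Y` is `c`-cyclically monotone if for any finite family
`(x₁,y₁),…,(x_N,y_N)` of points of `Γ`, `∑ c(xᵢ,yᵢ) ≤ ∑ c(xᵢ,y_{i+1})` (indices mod `N`). -/
def CyclicallyMonotone {X Y : Type*} (c : X → Y → ℝ) (Γ : Set (X × Y)) : Prop :=
  ∀ (N : ℕ) (f : Fin (N + 1) → X × Y), (∀ i, f i ∈ Γ) →
    ∑ i, c (f i).1 (f i).2 ≤ ∑ i, c (f i).1 (f (i + 1)).2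

/-- The topological support of a measure: all points whose every open neighbourhood has
positive measure. -/
def measureSupport {X : Type*} [TopologicalSpace X] [MeasurableSpace X]
    (m : Measure X) : Set X :=
  {x | ∀ U : Set X, IsOpen U → x ∈ U → m U ≠ 0}

/-- A function `ψ : X → (−∞,∞]` is `c`-convex if it is not identically `+∞` and
`ψ(x) = sup_y (ζ(y) − c(x,y))` for some `ζ : Y → [−∞,∞]`. -/
def CConvex {X Y : Type*} (c : X → Y → ℝ) (ψ : X → EReal) : Prop :=
  (∃ x, ψ x ≠ ⊤) ∧ ∃ ζ : Y → EReal, ∀ x, ψ x = ⨆ y, ζ y - (c x y : EReal)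

/-- The `c`-transform `ψ^c(y) := inf_x (ψ(x) + c(x,y))`. -/
noncomputable def cTransform {X Y : Type*} (c : X → Y → ℝ) (ψ : X → EReal) (y : Y) : EReal :=
  ⨅ x, ψ x + (c x y : EReal)

/-- The `c`-subdifferential `∂_c ψ := {(x,y) : ψ^c(y) − ψ(x) = c(x,y)}`. -/
def cSubdiff {X Y : Type*} (c : X → Y → ℝ) (ψ : X → EReal) : Set (X × Y) :=
  {q | cTransform c ψ q.2 - ψ q.1 = (c q.1 q.2 : EReal)}


section Deterministic

variable {X Y : Type*}

/-- Rüschendorf's iterates. -/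
noncomputable def psiSeq (c : X → Y → ℝ) (Γ : Set (X × Y)) (z0 : X × Y) : ℕ → X → EReal
  | 0, x => ((c z0.1 z0.2 - c x z0.2 : ℝ) : EReal)
  | n + 1, x => ⨆ z : Γ, psiSeq c Γ z0 n z.1.1 + ((c z.1.1 z.1.2 - c x z.1.2 : ℝ) : EReal)

/-- Rüschendorf's potential. -/
noncomputable def psiLim (c : X → Y → ℝ) (Γ : Set (X × Y)) (z0 : X × Y) (x : X) : EReal :=
  ⨆ n, psiSeq c Γ z0 n x

variable {c : X → Y → ℝ} {Γ : Set (X × Y)} {z0 : X × Y}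

lemma psiLim_ge_base (x : X) :
    ((c z0.1 z0.2 - c x z0.2 : ℝ) : EReal) ≤ psiLim c Γ z0 x :=
  le_iSup (fun n => psiSeq c Γ z0 n x) 0

lemma psiLim_ne_bot (x : X) : psiLim c Γ z0 x ≠ ⊥ :=
  ne_bot_of_le_ne_bot (EReal.coe_ne_bot _) (psiLim_ge_base x)

lemma psiSeq_step (n : ℕ) {z : X × Y} (hz : z ∈ Γ) (x : X) :
    psiSeq c Γ z0 n z.1 + ((c z.1 z.2 - c x z.2 : ℝ) : EReal) ≤ psiLim c Γ z0 x :=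
  le_trans (le_iSup (fun z : Γ => psiSeq c Γ z0 n z.1.1 +
      ((c z.1.1 z.1.2 - c x z.1.2 : ℝ) : EReal)) ⟨z, hz⟩)
    (le_iSup (fun n => psiSeq c Γ z0 n x) (n + 1))

lemma psiLim_step {z : X × Y} (hz : z ∈ Γ) (x : X) :
    psiLim c Γ z0 z.1 + ((c z.1 z.2 - c x z.2 : ℝ) : EReal) ≤ psiLim c Γ z0 x := by
  rw [← EReal.le_sub_iff_add_le (.inl (EReal.coe_ne_bot _)) (.inl (EReal.coe_ne_top _))]
  refine iSup_le fun n => ?_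
  rw [EReal.le_sub_iff_add_le (.inl (EReal.coe_ne_bot _)) (.inl (EReal.coe_ne_top _))]
  exact psiSeq_step n hz x

lemma cyc_nat (hΓ : CyclicallyMonotone c Γ) (n : ℕ) (f : ℕ → X × Y) (hf : ∀ i, f i ∈ Γ) :
    (∑ i ∈ Finset.range n, (c (f i).1 (f i).2 - c (f (i + 1)).1 (f i).2))
      + (c (f n).1 (f n).2 - c (f 0).1 (f n).2) ≤ 0 := by
  have h := hΓ n (fun i => f (n - i)) (fun i => hf _)
  have h1 : ∑ i : Fin (n + 1), c (f (n - i)).1 (f (n - i)).2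
      = ∑ i ∈ Finset.range (n + 1), c (f i).1 (f i).2 := by
    rw [Fin.sum_univ_eq_sum_range (fun i => c (f (n - i)).1 (f (n - i)).2) (n + 1)]
    have := Finset.sum_range_reflect (fun i => c (f i).1 (f i).2) (n + 1)
    simpa using this
  have h2 : ∑ i : Fin (n + 1), c (f (n - i)).1 (f (n - (i + 1 : Fin (n + 1)))).2
      = ∑ i ∈ Finset.range n, c (f (i + 1)).1 (f i).2 + c (f 0).1 (f n).2 := by
    rw [Fin.sum_univ_castSucc]
    congr 1
    · rw [← Finset.sum_range_reflect, ← Fin.sum_univ_eq_sum_range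
        (fun j => c (f (n - 1 - j + 1)).1 (f (n - 1 - j)).2)]
      refine Finset.sum_congr rfl fun i _ => ?_
      have e1 : n - ((Fin.castSucc i : Fin (n + 1)) : ℕ) = n - 1 - i + 1 := by
        have := i.2
        simp only [Fin.val_castSucc]
        omega
      have e2 : n - ((Fin.castSucc i + 1 : Fin (n + 1)) : ℕ) = n - 1 - i := by
        rw [Fin.coeSucc_eq_succ, Fin.val_succ]
        omega
      rw [e1, e2]
    · simp
  rw [h1, h2, Finset.sum_range_succ] at h
  rw [Finset.sum_sub_distrib]
  linarith

lemma psiSeq_chain (hz0 : z0 ∈ Γ) (n : ℕ) : ∀ (x : X) (a : ℝ), (a : EReal) < psiSeq c Γ z0 n x →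
    ∃ f : ℕ → X × Y, f 0 = z0 ∧ (∀ i, f i ∈ Γ) ∧
      a < (∑ i ∈ Finset.range n, (c (f i).1 (f i).2 - c (f (i + 1)).1 (f i).2))
        + (c (f n).1 (f n).2 - c x (f n).2) := by
  induction n with
  | zero =>
    intro x a ha
    refine ⟨fun _ => z0, rfl, fun _ => hz0, ?_⟩
    simpa [psiSeq, -EReal.coe_sub] using ha
  | succ n ih =>
    intro x a ha
    rw [psiSeq, lt_iSup_iff] at ha
    obtain ⟨⟨z, hz⟩, ha⟩ := ha
    have ha' := EReal.sub_lt_of_lt_add ha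
    rw [← EReal.coe_sub] at ha'
    obtain ⟨f, h0, hf, hlt⟩ := ih _ _ ha'
    refine ⟨fun i => if i ≤ n then f i else z, by simpa using h0, fun i => ?_, ?_⟩
    · dsimp only
      split_ifs
      exacts [hf _, hz]
    · rw [Finset.sum_range_succ]
      have : ∑ i ∈ Finset.range n, (c ((fun i => if i ≤ n then f i else z) i).1
          ((fun i => if i ≤ n then f i else z) i).2 -
          c ((fun i => if i ≤ n then f i else z) (i + 1)).1
          ((fun i => if i ≤ n then f i else z) i).2)
          = ∑ i ∈ Finset.range n, (c (f i).1 (f i).2 - c (f (i + 1)).1 (f i).2) := by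
        refine Finset.sum_congr rfl fun i hi => ?_
        have hi' := Finset.mem_range.1 hi
        have h1 : i ≤ n := hi'.le
        have h2 : i + 1 ≤ n := hi'
        simp only [h1, h2, if_true]
      rw [this]
      simp only [le_refl, if_true, Nat.not_succ_le_self, if_false]
      dsimp only at hlt
      linarith

lemma psiLim_base (hΓ : CyclicallyMonotone c Γ) (hz0 : z0 ∈ Γ) : psiLim c Γ z0 z0.1 ≤ 0 := by
  refine iSup_le fun n => ?_
  by_contra h
  rw [not_le] at h
  obtain ⟨f, h0, hf, hlt⟩ := psiSeq_chain hz0 n z0.1 0 h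
  have := cyc_nat hΓ n f hf
  rw [h0] at this
  linarith

lemma psiLim_ne_top (hΓ : CyclicallyMonotone c Γ) (hz0 : z0 ∈ Γ) {z : X × Y} (hz : z ∈ Γ) :
    psiLim c Γ z0 z.1 ≠ ⊤ := by
  intro h
  have h1 := (psiLim_step (c := c) (z0 := z0) hz z0.1).trans (psiLim_base hΓ hz0)
  rw [h, EReal.top_add_coe] at h1
  simp at h1

lemma le_cTransform_iff (ψ : X → EReal) (a : EReal) (y : Y) :
    a ≤ cTransform c ψ y ↔ ∀ x, a - (c x y : EReal) ≤ ψ x := by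
  rw [cTransform, le_iInf_iff]
  refine forall_congr' fun x => ?_
  rw [EReal.sub_le_iff_le_add (.inl (EReal.coe_ne_bot _)) (.inl (EReal.coe_ne_top _))]

lemma add_sub_real (a : EReal) (r s : ℝ) :
    a + (r : EReal) - (s : EReal) = a + ((r - s : ℝ) : EReal) := by
  rw [sub_eq_add_neg, add_assoc, EReal.coe_sub, sub_eq_add_neg]

lemma cTransform_psiLim {z : X × Y} (hz : z ∈ Γ) :
    cTransform c (psiLim c Γ z0) z.2 = psiLim c Γ z0 z.1 + (c z.1 z.2 : EReal) := by
  refine le_antisymm (iInf_le _ z.1) ?_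
  rw [le_cTransform_iff]
  intro x
  rw [add_sub_real]
  exact psiLim_step hz x

lemma cconvex_psiLim (hΓ : CyclicallyMonotone c Γ) (hz0 : z0 ∈ Γ) :
    CConvex c (psiLim c Γ z0) := by
  refine ⟨⟨z0.1, psiLim_ne_top hΓ hz0 hz0⟩, cTransform c (psiLim c Γ z0), fun x => ?_⟩
  refine le_antisymm (iSup_le fun n => ?_) (iSup_le fun y => (le_cTransform_iff _ _ _).1 le_rfl x)
  cases n with
  | zero =>
    refine le_iSup_of_le z0.2 ?_
    rw [psiSeq, EReal.coe_sub]
    refine EReal.sub_le_sub ?_ le_rfl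
    rw [le_cTransform_iff]
    intro x'
    rw [← EReal.coe_sub]
    exact psiLim_ge_base x'
  | succ n =>
    rw [psiSeq]
    refine iSup_le fun z => le_iSup_of_le z.1.2 ?_
    rw [← add_sub_real]
    refine EReal.sub_le_sub ?_ le_rfl
    rw [le_cTransform_iff]
    intro x'
    rw [add_sub_real]
    exact psiSeq_step n z.2 x'

lemma lsc_add_real {Z : Type*} [TopologicalSpace Z] {f : Z → EReal} {g : Z → ℝ}
    (hf : LowerSemicontinuous f) (hg : Continuous g) :
    LowerSemicontinuous (fun z => f z + (g z : EReal)) :=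
  hf.add' (continuous_coe_real_ereal.comp hg).lowerSemicontinuous fun z =>
    EReal.continuousAt_add (.inr (EReal.coe_ne_bot _)) (.inr (EReal.coe_ne_top _))

lemma lsc_psiSeq [TopologicalSpace X] [TopologicalSpace Y]
    (hc : Continuous (fun q : X × Y => c q.1 q.2)) (n : ℕ) :
    LowerSemicontinuous (psiSeq c Γ z0 n) := by
  have h1 : ∀ y, Continuous (fun x => c x y) := fun y =>
    hc.comp (by fun_prop : Continuous fun x : X => (x, y))
  cases n with
  | zero =>
    have : Continuous (psiSeq c Γ z0 0) :=
      continuous_coe_real_ereal.comp (continuous_const.sub (h1 z0.2))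
    exact this.lowerSemicontinuous
  | succ n =>
    have : psiSeq c Γ z0 (n + 1) = fun x => ⨆ z : Γ, psiSeq c Γ z0 n z.1.1 +
      ((c z.1.1 z.1.2 - c x z.1.2 : ℝ) : EReal) := by
      funext x; rw [psiSeq]
    rw [this]
    exact lowerSemicontinuous_iSup fun z =>
      lsc_add_real lowerSemicontinuous_const (continuous_const.sub (h1 _))

end Deterministic

section Support

variable {Z : Type*} [TopologicalSpace Z] [MeasurableSpace Z]

lemma notMem_support_iff [SecondCountableTopology Z] (m : Measure Z) (z : Z) :
    z ∉ measureSupport m ↔ ∃ U ∈ TopologicalSpace.countableBasis Z, z ∈ U ∧ m U = 0 := by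
  constructor
  · intro h
    simp only [measureSupport, Set.mem_ofPred_eq, not_forall, not_not] at h
    obtain ⟨U, hU, hz, h0⟩ := h
    obtain ⟨V, hV, hzV, hVU⟩ :=
      (TopologicalSpace.isBasis_countableBasis Z).exists_subset_of_mem_open hz hU
    exact ⟨V, hV, hzV, measure_mono_null hVU h0⟩
  · rintro ⟨U, hU, hz, h0⟩ h
    exact h U (TopologicalSpace.isOpen_of_mem_countableBasis hU) hz h0

lemma ae_mem_support [SecondCountableTopology Z] (m : Measure Z) :
    ∀ᵐ z ∂m, z ∈ measureSupport m := by
  rw [ae_iff]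
  have : {z | z ∉ measureSupport m} ⊆
      ⋃ U ∈ {U ∈ TopologicalSpace.countableBasis Z | m U = 0}, U := by
    intro z hz
    obtain ⟨U, hU, hzU, h0⟩ := (notMem_support_iff m z).1 hz
    exact Set.mem_biUnion (show U ∈ {U ∈ _ | _} from ⟨hU, h0⟩) hzU
  refine measure_mono_null this ?_
  rw [measure_biUnion_null_iff]
  · exact fun U hU => hU.2
  · exact (TopologicalSpace.countable_countableBasis Z).mono fun U hU => hU.1

lemma exists_support_iff [SecondCountableTopology Z] (m : Measure Z) {U : Set Z} (hU : IsOpen U) :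
    (∃ z : measureSupport m, z.1 ∈ U) ↔ m U ≠ 0 := by
  constructor
  · rintro ⟨⟨z, hz⟩, hzU⟩
    exact hz U hU hzU
  · intro h
    by_contra hne
    apply h
    refine measure_mono_null ?_ (ae_iff.1 (ae_mem_support m))
    intro z hz hzs
    exact hne ⟨⟨z, hzs⟩, hz⟩

lemma measurableSet_support_graph {Ω : Type*} [MeasurableSpace Ω] [SecondCountableTopology Z]
    [OpensMeasurableSpace Z] (π : Kernel Ω Z) :
    MeasurableSet {p : Ω × Z | p.2 ∈ measureSupport (π p.1)} := by
  rw [← MeasurableSet.compl_iff]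
  have : {p : Ω × Z | p.2 ∈ measureSupport (π p.1)}ᶜ =
      ⋃ U ∈ TopologicalSpace.countableBasis Z, {ω | π ω U = 0} ×ˢ U := by
    ext p
    rw [Set.mem_compl_iff, Set.mem_ofPred_eq, notMem_support_iff]
    simp only [Set.mem_iUnion, Set.mem_prod, Set.mem_ofPred_eq, exists_prop]
    tauto
  rw [this]
  refine MeasurableSet.biUnion (TopologicalSpace.countable_countableBasis Z) fun U hU => ?_
  have hUm := (TopologicalSpace.isOpen_of_mem_countableBasis hU).measurableSet
  exact ((Kernel.measurable_coe π hUm) (measurableSet_singleton 0)).prod hUm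

end Support

section Selection

variable {Ω Z : Type*} [MeasurableSpace Ω] [MetricSpace Z] [SecondCountableTopology Z]
  [MeasurableSpace Z] [BorelSpace Z] [Nonempty Z]

open TopologicalSpace Metric Topology

lemma exists_ball_inter (m : Measure Z) {U : Set Z} (hU : m U ≠ 0) {r : ℝ} (hr : 0 < r) :
    ∃ k : ℕ, m (ball (denseSeq Z k) r ∩ U) ≠ 0 := by
  by_contra! h
  apply hU
  refine measure_mono_null ?_ (measure_iUnion_null h)
  intro z hz
  obtain ⟨k, hk⟩ := Metric.denseRange_iff.1 (denseRange_denseSeq Z) z r hr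
  exact Set.mem_iUnion.2 ⟨k, hk, hz⟩

lemma selection_step (π : Kernel Ω Z) {r s : ℝ} (hs : 0 < s)
    (k : Ω → ℕ) (hk : Measurable k) (hpos : ∀ ω, π ω (ball (denseSeq Z (k ω)) r) ≠ 0) :
    ∃ k' : Ω → ℕ, Measurable k' ∧
      ∀ ω, π ω (ball (denseSeq Z (k' ω)) s ∩ ball (denseSeq Z (k ω)) r) ≠ 0 := by
  classical
  have hex := fun ω => exists_ball_inter (π ω) (hpos ω) hs
  refine ⟨fun ω => Nat.find (hex ω), measurable_find hex fun j => ?_,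
    fun ω => Nat.find_spec (hex ω)⟩
  have : {ω | π ω (ball (denseSeq Z j) s ∩ ball (denseSeq Z (k ω)) r) ≠ 0} =
      ⋃ i : ℕ, k ⁻¹' {i} ∩ {ω | π ω (ball (denseSeq Z j) s ∩ ball (denseSeq Z i) r) ≠ 0} := by
    ext ω
    simp
  rw [this]
  refine MeasurableSet.iUnion fun i => (hk (measurableSet_singleton i)).inter ?_
  exact (Kernel.measurable_coe π (measurableSet_ball.inter measurableSet_ball))
    (measurableSet_singleton 0).compl

lemma exists_selection_metric [CompleteSpace Z] (π : Kernel Ω Z) [IsMarkovKernel π] :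
    ∃ z : Ω → Z, Measurable z ∧ ∀ ω, z ω ∈ measureSupport (π ω) := by
  let r : ℕ → ℝ := fun n => (1 / 2) ^ n
  have hr : ∀ n, 0 < r n := fun n => by positivity
  let S : ℕ → Type _ := fun n => {k : Ω → ℕ // Measurable k ∧
    ∀ ω, π ω (ball (denseSeq Z (k ω)) (r n)) ≠ 0}
  have hstep : ∀ n (k : S n), ∃ k' : S (n + 1),
      ∀ ω, π ω (ball (denseSeq Z (k'.1 ω)) (r (n + 1)) ∩ ball (denseSeq Z (k.1 ω)) (r n)) ≠ 0 := by
    rintro n ⟨k, hk, hpos⟩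
    obtain ⟨k', hk', h⟩ := selection_step π (hr (n + 1)) k hk hpos
    exact ⟨⟨k', hk', fun ω h0 => h ω (measure_mono_null Set.inter_subset_left h0)⟩, h⟩
  choose F hF using hstep
  have h0 : Nonempty (S 0) := by
    classical
    have hex := fun ω => exists_ball_inter (π ω) (U := Set.univ) (by simp) (hr 0)
    refine ⟨fun ω => Nat.find (hex ω), measurable_find hex fun j => ?_, fun ω h0 => ?_⟩
    · exact (Kernel.measurable_coe π (measurableSet_ball.inter MeasurableSet.univ))
        (measurableSet_singleton 0).compl
    · exact Nat.find_spec (hex ω) (measure_mono_null Set.inter_subset_left h0)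
  obtain ⟨k0⟩ := h0
  let K : ∀ n, S n := fun n => Nat.rec k0 (fun n k => F n k) n
  have hK : ∀ n ω, π ω (ball (denseSeq Z ((K (n + 1)).1 ω)) (r (n + 1)) ∩
      ball (denseSeq Z ((K n).1 ω)) (r n)) ≠ 0 := fun n => hF n (K n)
  let d : ℕ → Ω → Z := fun n ω => denseSeq Z ((K n).1 ω)
  have hdm : ∀ n, Measurable (d n) := fun n => measurable_from_nat.comp (K n).2.1
  have hdist : ∀ ω n, dist (d n ω) (d (n + 1) ω) ≤ 2 * (1 / 2) ^ n := by
    intro ω n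
    obtain ⟨w, hw1, hw2⟩ := nonempty_of_measure_ne_zero (hK n ω)
    have h1 : dist w (d (n + 1) ω) < (1 / 2) ^ (n + 1) := hw1
    have h2 : dist w (d n ω) < (1 / 2) ^ n := hw2
    have h3 := dist_triangle_left (d n ω) (d (n + 1) ω) w
    have h4 : (0 : ℝ) < (1 / 2) ^ n := by positivity
    rw [pow_succ] at h1
    linarith
  have hconv : ∀ ω, ∃ z, Tendsto (fun n => d n ω) atTop (𝓝 z) := fun ω =>
    cauchySeq_tendsto_of_complete
      (cauchySeq_of_le_geometric (1 / 2) 2 (by norm_num) (hdist ω))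
  choose z hz using hconv
  refine ⟨z, measurable_of_tendsto_metrizable hdm (tendsto_pi_nhds.2 hz), fun ω U hU hzU h0 => ?_⟩
  obtain ⟨ε, hε, hball⟩ := Metric.isOpen_iff.1 hU _ hzU
  have e1 := (Metric.tendsto_nhds.1 (hz ω)) (ε / 2) (by positivity)
  have e2 : ∀ᶠ n in atTop, (1 / 2 : ℝ) ^ n < ε / 2 :=
    (_root_.tendsto_pow_atTop_nhds_zero_of_lt_one (by norm_num) (by norm_num)).eventually_lt_const
      (by positivity)
  obtain ⟨n, hn1, hn2⟩ := (e1.and e2).exists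
  refine (K n).2.2 ω (measure_mono_null (fun w hw => hball ?_) h0)
  have h2 : dist w (d n ω) < (1 / 2) ^ n := hw
  have := dist_triangle w (d n ω) (z ω)
  rw [mem_ball]
  linarith

end Selection

lemma exists_selection {Ω Z : Type*} [MeasurableSpace Ω] [TopologicalSpace Z] [PolishSpace Z]
    [MeasurableSpace Z] [BorelSpace Z] [Nonempty Z] (π : Kernel Ω Z) [IsMarkovKernel π] :
    ∃ z : Ω → Z, Measurable z ∧ ∀ ω, z ω ∈ measureSupport (π ω) := by
  letI := TopologicalSpace.upgradeIsCompletelyMetrizable Z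
  exact exists_selection_metric π

section Measurability

variable {Ω X Y : Type*} [MeasurableSpace Ω]
    [TopologicalSpace X] [PolishSpace X] [MeasurableSpace X] [BorelSpace X]
    [TopologicalSpace Y] [PolishSpace Y] [MeasurableSpace Y] [BorelSpace Y]

lemma measurable_cost (c : Ω → X → Y → ℝ)
    (hc_cont : ∀ ω, Continuous (fun q : X × Y => c ω q.1 q.2))
    (hc_meas : ∀ x y, Measurable (fun ω => c ω x y)) :
    Measurable (fun p : Ω × (X × Y) => c p.1 p.2.1 p.2.2) := by
  have := measurable_uncurry_of_continuous_of_measurable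
    (u := fun (q : X × Y) (ω : Ω) => c ω q.1 q.2) hc_cont (fun q => hc_meas q.1 q.2)
  exact this.comp measurable_swap

lemma measurable_psiSeq (c : Ω → X → Y → ℝ)
    (hc_cont : ∀ ω, Continuous (fun q : X × Y => c ω q.1 q.2))
    (hcm : Measurable (fun p : Ω × (X × Y) => c p.1 p.2.1 p.2.2))
    (π : Kernel Ω (X × Y)) [IsMarkovKernel π] (z : Ω → X × Y) (hz : Measurable z) (n : ℕ) :
    Measurable (fun q : Ω × X => psiSeq (c q.1) (measureSupport (π q.1)) (z q.1) n q.2) := by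
  induction n with
  | zero =>
    simp only [psiSeq]
    refine Measurable.coe_real_ereal (Measurable.sub ?_ ?_)
    · exact hcm.comp (measurable_fst.prodMk (hz.comp measurable_fst))
    · exact hcm.comp (measurable_fst.prodMk
        (measurable_snd.prodMk (measurable_snd.comp (hz.comp measurable_fst))))
  | succ n ih =>
    refine measurable_of_Ioi fun a => ?_
    let T : Set ((Ω × X) × (X × Y)) := {p | a <
      psiSeq (c p.1.1) (measureSupport (π p.1.1)) (z p.1.1) n p.2.1 +
        ((c p.1.1 p.2.1 p.2.2 - c p.1.1 p.1.2 p.2.2 : ℝ) : EReal)}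
    have hT : MeasurableSet T := by
      refine measurableSet_lt measurable_const (Measurable.add ?_ ?_)
      · exact ih.comp (g := fun q : Ω × X =>
          psiSeq (c q.1) (measureSupport (π q.1)) (z q.1) n q.2)
          (f := fun p : (Ω × X) × (X × Y) => (p.1.1, p.2.1)) (by fun_prop)
      · refine Measurable.coe_real_ereal (Measurable.sub ?_ ?_)
        · exact hcm.comp (f := fun p : (Ω × X) × (X × Y) => (p.1.1, p.2)) (by fun_prop)
        · exact hcm.comp (f := fun p : (Ω × X) × (X × Y) => (p.1.1, (p.1.2, p.2.2)))
            (by fun_prop)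
    have hk := Kernel.measurable_kernel_prodMk_left
      (κ := π.comap (Prod.fst : Ω × X → Ω) measurable_fst) hT
    convert hk (measurableSet_singleton 0).compl using 1
    ext ⟨ω, x⟩
    have hopen : IsOpen (Prod.mk (ω, x) ⁻¹' T) := by
      refine LowerSemicontinuous.isOpen_preimage (f := fun w : X × Y =>
        psiSeq (c ω) (measureSupport (π ω)) (z ω) n w.1 +
        ((c ω w.1 w.2 - c ω x w.2 : ℝ) : EReal)) ?_ a
      refine lsc_add_real ((lsc_psiSeq (hc_cont ω) n).comp continuous_fst) ?_
      exact (hc_cont ω).sub ((hc_cont ω).comp (by fun_prop : Continuous fun w : X × Y => (x, w.2)))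
    have := exists_support_iff (π ω) hopen
    simp only [Set.mem_preimage, Set.mem_Ioi, Set.mem_compl_iff, Set.mem_singleton_iff,
      Kernel.comap_apply, psiSeq, lt_iSup_iff]
    exact this

lemma measurable_psiLim (c : Ω → X → Y → ℝ)
    (hc_cont : ∀ ω, Continuous (fun q : X × Y => c ω q.1 q.2))
    (hcm : Measurable (fun p : Ω × (X × Y) => c p.1 p.2.1 p.2.2))
    (π : Kernel Ω (X × Y)) [IsMarkovKernel π] (z : Ω → X × Y) (hz : Measurable z) :
    Measurable (fun q : Ω × X => psiLim (c q.1) (measureSupport (π q.1)) (z q.1) q.2) :=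
  Measurable.iSup fun n => measurable_psiSeq c hc_cont hcm π z hz n

/-- Disintegration along the second coordinate. -/
lemma exists_disintegration [Nonempty X] (π : Kernel Ω (X × Y)) [IsMarkovKernel π] :
    ∃ κ : Kernel (Ω × Y) X, IsMarkovKernel κ ∧
      ∀ (ω : Ω) (p : X × Y → Prop), (∀ᵐ q ∂(π ω), p q) →
        ∀ᵐ q ∂(π ω), ∀ᵐ x ∂(κ (ω, q.2)), p (x, q.2) := by
  let ρ : Kernel Ω (Y × X) := π.swapRight
  refine ⟨ρ.condKernel, inferInstance, fun ω p hp => ?_⟩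
  have h1 : ∀ᵐ q ∂(ρ ω), p q.swap := by
    have : ρ ω = (π ω).map Prod.swap := Kernel.swapRight_apply _ _
    rw [this]
    have he : (MeasurableEquiv.prodComm : X × Y ≃ᵐ Y × X).toEquiv = Equiv.prodComm X Y := rfl
    exact ((MeasurableEquiv.prodComm : X × Y ≃ᵐ Y × X).measurableEmbedding.ae_map_iff).2 hp
  rw [← ρ.disintegrate ρ.condKernel] at h1
  have h2 := Kernel.ae_ae_of_ae_compProd h1
  have h3 : ρ.fst ω = (π ω).map Prod.snd := by
    rw [Kernel.fst_swapRight, Kernel.snd_apply]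
  rw [h3] at h2
  exact ae_of_ae_map measurable_snd.aemeasurable h2

end Measurability

/-- **From cyclically monotone supports to a dual pair.**
If `π ∈ K(μ,ν)` has `c(ω,·,·)`-cyclically monotone support for every `ω`, then there are
jointly measurable `ψ : Ω × X → (−∞,∞]` and `φ : Ω × Y → [−∞,∞)` with
`φ(ω,y) − ψ(ω,x) ≤ c(ω,x,y)` everywhere, `ψ(ω,·)` is `c(ω)`-convex for each `ω`, and for
each `ω` the contact set `Γ_ω = {(x,y) : φ(ω,y) − ψ(ω,x) = c(ω,x,y)}` is contained in the
`c(ω)`-subdifferential of `ψ(ω,·)` and carries full `π_ω`-measure. -/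
theorem exists_dual_pair_of_cyclically_monotone_support
    {Ω X Y : Type*} [MeasurableSpace Ω]
    [TopologicalSpace X] [PolishSpace X] [MeasurableSpace X] [BorelSpace X]
    [TopologicalSpace Y] [PolishSpace Y] [MeasurableSpace Y] [BorelSpace Y]
    (P : Measure Ω) [IsProbabilityMeasure P]
    (μ : Kernel Ω X) [IsMarkovKernel μ] (ν : Kernel Ω Y) [IsMarkovKernel ν]
    (c : Ω → X → Y → ℝ)
    (hc_nonneg : ∀ ω x y, 0 ≤ c ω x y)
    (hc_cont : ∀ ω, Continuous (fun q : X × Y => c ω q.1 q.2))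
    (hc_meas : ∀ x y, Measurable (fun ω => c ω x y))
    (hint : ∫⁻ ω, ∫⁻ q, ENNReal.ofReal (c ω q.1 q.2) ∂((μ ω).prod (ν ω)) ∂P < ⊤)
    (π : Kernel Ω (X × Y)) [IsMarkovKernel π] (hπfst : π.fst = μ) (hπsnd : π.snd = ν)
    (hmono : ∀ ω, CyclicallyMonotone (c ω) (measureSupport (π ω))) :
    ∃ (ψ : Ω → X → EReal) (φ : Ω → Y → EReal),
      Measurable (fun q : Ω × X => ψ q.1 q.2) ∧
      Measurable (fun q : Ω × Y => φ q.1 q.2) ∧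
      (∀ ω x, ψ ω x ≠ ⊥) ∧ (∀ ω y, φ ω y ≠ ⊤) ∧
      (∀ ω x y, φ ω y - ψ ω x ≤ (c ω x y : EReal)) ∧
      (∀ ω, CConvex (c ω) (ψ ω)) ∧
      (∀ ω, {q : X × Y | φ ω q.2 - ψ ω q.1 = (c ω q.1 q.2 : EReal)} ⊆
        cSubdiff (c ω) (ψ ω)) ∧
      (∀ ω, π ω {q : X × Y | φ ω q.2 - ψ ω q.1 = (c ω q.1 q.2 : EReal)} = 1) := by
  classical
  obtain ⟨ω₀⟩ : Nonempty Ω := P.nonempty_of_neZero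
  haveI : Nonempty (X × Y) := (π ω₀).nonempty_of_neZero
  haveI : Nonempty X := ⟨(Classical.arbitrary (X × Y)).1⟩
  obtain ⟨z, hz, hzs⟩ := exists_selection π
  obtain ⟨κ, hκ, hdis⟩ := exists_disintegration π
  have hcm := measurable_cost c hc_cont hc_meas
  let ψ : Ω → X → EReal := fun ω x => psiLim (c ω) (measureSupport (π ω)) (z ω) x
  have hψ : Measurable (fun q : Ω × X => ψ q.1 q.2) := measurable_psiLim c hc_cont hcm π z hz
  have hbot : ∀ ω x, ψ ω x ≠ ⊥ := fun ω x => psiLim_ne_bot x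
  let B : Set ((Ω × Y) × X) := {p | (p.2, p.1.2) ∈ measureSupport (π p.1.1)}
  have hB : MeasurableSet B := (by fun_prop : Measurable fun p : (Ω × Y) × X =>
    (p.1.1, (p.2, p.1.2))) (measurableSet_support_graph π)
  let G : Set (Ω × Y) := {p | κ p (Prod.mk p ⁻¹' Bᶜ) = 0}
  have hG : MeasurableSet G :=
    Kernel.measurable_kernel_prodMk_left hB.compl (measurableSet_singleton 0)
  let h : Ω × Y → X → ℝ := fun p x => (ψ p.1 x + (c p.1 x p.2 : EReal)).toReal
  have hh : Measurable (Function.uncurry h) := by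
    refine Measurable.ereal_toReal (Measurable.add ?_ ?_)
    · exact hψ.comp (f := fun p : (Ω × Y) × X => (p.1.1, p.2)) (by fun_prop)
    · exact (hcm.comp (f := fun p : (Ω × Y) × X => (p.1.1, (p.2, p.1.2)))
        (by fun_prop)).coe_real_ereal
  let I : Ω × Y → ℝ := fun p => ∫ x, h p x ∂(κ p)
  have hI : Measurable I :=
    (StronglyMeasurable.integral_kernel_prod_right hh.stronglyMeasurable).measurable
  let φ : Ω → Y → EReal := fun ω y => if (ω, y) ∈ G then (I (ω, y) : EReal) else ⊥
  have hφ : Measurable (fun q : Ω × Y => φ q.1 q.2) :=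
    Measurable.ite hG hI.coe_real_ereal measurable_const
  -- on the good set, `φ` is the `c`-transform
  have key : ∀ ω (q : X × Y), q ∈ measureSupport (π ω) →
      ((h (ω, q.2) q.1 : ℝ) : EReal) = cTransform (c ω) (ψ ω) q.2 := by
    intro ω q hq
    have h1 : cTransform (c ω) (ψ ω) q.2 = ψ ω q.1 + (c ω q.1 q.2 : EReal) := cTransform_psiLim hq
    rw [h1]
    have ht : ψ ω q.1 ≠ ⊤ := psiLim_ne_top (hmono ω) (hzs ω) hq
    refine EReal.coe_toReal (EReal.add_ne_top ht (EReal.coe_ne_top _)) ?_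
    rw [Ne, EReal.add_eq_bot_iff]
    simp [hbot]
  have hφG : ∀ ω y, (ω, y) ∈ G → φ ω y = cTransform (c ω) (ψ ω) y := by
    intro ω y hy
    have hae : ∀ᵐ x ∂(κ (ω, y)), (x, y) ∈ measureSupport (π ω) := by
      rw [ae_iff]; exact hy
    have hae' : ∀ᵐ x ∂(κ (ω, y)), h (ω, y) x = (cTransform (c ω) (ψ ω) y).toReal := by
      filter_upwards [hae] with x hx
      rw [← key ω (x, y) hx, EReal.toReal_coe]
    obtain ⟨x, hx⟩ := hae.exists
    have hIv : I (ω, y) = (cTransform (c ω) (ψ ω) y).toReal := by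
      change ∫ x, h (ω, y) x ∂(κ (ω, y)) = _
      rw [integral_congr_ae hae']
      simp
    have : φ ω y = (I (ω, y) : EReal) := if_pos hy
    rw [this, hIv, ← key ω (x, y) hx, EReal.toReal_coe]
  have hφle : ∀ ω y, φ ω y ≤ cTransform (c ω) (ψ ω) y := by
    intro ω y
    by_cases hy : (ω, y) ∈ G
    · exact (hφG ω y hy).le
    · have : φ ω y = ⊥ := if_neg hy
      rw [this]; exact bot_le
  have hφtop : ∀ ω y, φ ω y ≠ ⊤ := by
    intro ω y
    change (if (ω, y) ∈ G then (I (ω, y) : EReal) else ⊥) ≠ ⊤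
    split_ifs <;> simp
  refine ⟨ψ, φ, hψ, hφ, hbot, hφtop, ?_, fun ω => cconvex_psiLim (hmono ω) (hzs ω), ?_, ?_⟩
  · intro ω x y
    refine EReal.sub_le_of_le_add' ?_
    exact (hφle ω y).trans (iInf_le _ x)
  · intro ω q hq
    have hq' : φ ω q.2 - ψ ω q.1 = (c ω q.1 q.2 : EReal) := hq
    change cTransform (c ω) (ψ ω) q.2 - ψ ω q.1 = (c ω q.1 q.2 : EReal)
    refine le_antisymm (EReal.sub_le_of_le_add' (iInf_le _ q.1)) ?_
    rw [← hq']
    exact EReal.sub_le_sub (hφle ω q.2) le_rfl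
  · intro ω
    have hae := hdis ω _ (ae_mem_support (π ω))
    rw [← measure_univ (μ := π ω)]
    refine measure_congr ?_
    rw [Filter.eventuallyEq_set]
    filter_upwards [hae, ae_mem_support (π ω)] with q hq1 hq2
    simp only [Set.mem_univ, iff_true]
    have hqG : (ω, q.2) ∈ G := by
      rw [ae_iff] at hq1; exact hq1
    change φ ω q.2 - ψ ω q.1 = (c ω q.1 q.2 : EReal)
    have h1 : cTransform (c ω) (ψ ω) q.2 = ψ ω q.1 + (c ω q.1 q.2 : EReal) := cTransform_psiLim hq2
    rw [hφG ω _ hqG, h1]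
    have ht : ψ ω q.1 ≠ ⊤ := psiLim_ne_top (hmono ω) (hzs ω) hq2
    lift ψ ω q.1 to ℝ using ⟨ht, hbot ω q.1⟩ with r
    rw [← EReal.coe_add, ← EReal.coe_sub]
    congr 1
    ring
end

section
/- Let X and Y be Polish spaces with fixed base points x_0 ∈ X, y_0 ∈ Y. Let c_n, c : X×Y → [0,∞) be continuous cost functions with c_n → c uniformly on each product of closed balls B^m_X(x_0) × B^m_Y(y_0), let μ_n, μ ∈ P(X) with μ_n → μ weakly, and ν_n, ν ∈ P(Y) with ν_n → ν weakly, and assume ∫ c_n dμ_n dν_n < ∞ for each n and ∫ c dμ dν < ∞. Let π_n ∈ Π(μ_n,ν_n) be an optimal transference plan for the Monge–Kantorovich problem with data (c_n, μ_n, ν_n). Then there is a subsequence of (π_n) that converges weakly to some π ∈ Π(μ,ν), and any such weak limit π is an optimal transference plan for the Monge–Kantorovich problem with data (c, μ, ν). -/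
open MeasureTheory ProbabilityTheory Filter Topology ENNReal

/-- The deterministic Monge–Kantorovich cost `C^deter(c,μ,ν)`: the infimum over all
couplings `π ∈ Π(μ,ν)` of `∫ c dπ`. -/
noncomputable def deterCost {X Y : Type*} [MeasurableSpace X] [MeasurableSpace Y]
    (c : X → Y → ℝ) (μ : Measure X) (ν : Measure Y) : ℝ≥0∞ :=
  ⨅ π ∈ {π : Measure (X × Y) | IsProbabilityMeasure π ∧ π.fst = μ ∧ π.snd = ν},
    ∫⁻ q, ENNReal.ofReal (c q.1 q.2) ∂π


lemma otp_ae_fst {X Y : Type*} [MeasurableSpace X] [MeasurableSpace Y] (π : Measure (X × Y))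
    {S : Set X} (hS : MeasurableSet S) : (∀ᵐ x ∂π.fst, x ∈ S) ↔ ∀ᵐ q ∂π, q.1 ∈ S :=
  ae_map_iff (p := fun x => x ∈ S) measurable_fst.aemeasurable hS

lemma otp_ae_snd {X Y : Type*} [MeasurableSpace X] [MeasurableSpace Y] (π : Measure (X × Y))
    {S : Set Y} (hS : MeasurableSet S) : (∀ᵐ x ∂π.snd, x ∈ S) ↔ ∀ᵐ q ∂π, q.2 ∈ S :=
  ae_map_iff (p := fun x => x ∈ S) measurable_snd.aemeasurable hS


lemma otp_swap {X Y ι : Type*} [MeasurableSpace X] [MeasurableSpace Y] [Fintype ι] [Nonempty ι]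
    (σ : Equiv.Perm ι) (f : X × Y → ℝ≥0∞)
    (π : Measure (X × Y)) [IsProbabilityMeasure π] (hfin : ∫⁻ q, f q ∂π ≠ ⊤)
    (hopt : ∀ π' : Measure (X × Y), IsProbabilityMeasure π' → π'.fst = π.fst → π'.snd = π.snd →
      ∫⁻ q, f q ∂π ≤ ∫⁻ q, f q ∂π')
    (A : ι → Set X) (B : ι → Set Y) (hA : ∀ i, MeasurableSet (A i)) (hB : ∀ i, MeasurableSet (B i))
    (hpos : ∀ i, π (A i ×ˢ B i) ≠ 0) (a b : ι → ℝ≥0∞)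
    (ha : ∀ i, ∀ x ∈ A i, ∀ y ∈ B i, a i ≤ f (x, y))
    (hb : ∀ i, ∀ x ∈ A (σ i), ∀ y ∈ B i, f (x, y) ≤ b i) :
    ∑ i, a i ≤ ∑ i, b i := by
  classical
  have hbox : ∀ i, MeasurableSet (A i ×ˢ B i) := fun i => (hA i).prod (hB i)
  let P : ι → Measure (X × Y) := fun i => ProbabilityTheory.cond π (A i ×ˢ B i)
  have hP : ∀ i, IsProbabilityMeasure (P i) := fun i => cond_isProbabilityMeasure (hpos i)
  let Q : ι → Measure (X × Y) := fun i => ((P (σ i)).fst).prod ((P i).snd)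
  have hQ : ∀ i, IsProbabilityMeasure (Q i) := fun i => inferInstance
  have hPmem : ∀ i, ∀ᵐ q ∂(P i), q ∈ A i ×ˢ B i := fun i => ae_cond_mem (hbox i)
  -- epsilon
  obtain ⟨i₀, hi₀⟩ := Finite.exists_min (fun i => π (A i ×ˢ B i))
  let ε : ℝ≥0∞ := π (A i₀ ×ˢ B i₀) / (Fintype.card ι)
  have hε0 : ε ≠ 0 := ENNReal.div_ne_zero.2 ⟨hpos i₀, by simp⟩
  have hεt : ε ≠ ⊤ := (ENNReal.div_lt_top (measure_ne_top _ _) (by simp)).ne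
  let ρ : Measure (X × Y) := ε • ∑ i, P i
  let ρ' : Measure (X × Y) := ε • ∑ i, Q i
  have hρfin : IsFiniteMeasure ρ := by
    constructor
    simp only [ρ, Measure.smul_apply, Measure.finsetSum_apply, measure_univ, smul_eq_mul]
    exact ENNReal.mul_lt_top hεt.lt_top (by simp)
  have hle : ρ ≤ π := by
    refine Measure.le_intro fun s hs _ => ?_
    simp only [ρ, Measure.smul_apply, Measure.finsetSum_apply, smul_eq_mul, Finset.mul_sum]
    calc ∑ i, ε * P i s ≤ ∑ i : ι, (Fintype.card ι : ℝ≥0∞)⁻¹ * π s := by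
          refine Finset.sum_le_sum fun i _ => ?_
          simp only [P, cond_apply (hbox i), ε, div_eq_mul_inv]
          calc _ ≤ π (A i ×ˢ B i) * (Fintype.card ι : ℝ≥0∞)⁻¹ * ((π (A i ×ˢ B i))⁻¹ * π s) := by
                exact mul_le_mul' (mul_le_mul' (hi₀ i) le_rfl)
                  (mul_le_mul' le_rfl (measure_mono Set.inter_subset_right))
            _ = (π (A i ×ˢ B i) * (π (A i ×ˢ B i))⁻¹) * ((Fintype.card ι : ℝ≥0∞)⁻¹ * π s) := by ring
            _ = _ := by rw [ENNReal.mul_inv_cancel (hpos i) (measure_ne_top _ _), one_mul]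
      _ = π s := by
          rw [Finset.sum_const, Finset.card_univ, nsmul_eq_mul, ← mul_assoc,
            ENNReal.mul_inv_cancel (by simp) (by simp), one_mul]
  have hsub : π - ρ + ρ = π := Measure.sub_add_cancel_of_le hle
  have hfst : ρ'.fst = ρ.fst := by
    ext s hs
    rw [Measure.fst_apply hs, Measure.fst_apply hs]
    simp only [ρ, ρ', Measure.smul_apply, Measure.finsetSum_apply]
    congr 1
    have : ∀ i, Q i (Prod.fst ⁻¹' s) = P (σ i) (Prod.fst ⁻¹' s) := fun i => by
      rw [← Measure.fst_apply hs, ← Measure.fst_apply hs, Measure.fst_prod]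
    simp only [this]
    exact Equiv.sum_comp σ (fun i => P i (Prod.fst ⁻¹' s))
  have hsnd : ρ'.snd = ρ.snd := by
    ext s hs
    rw [Measure.snd_apply hs, Measure.snd_apply hs]
    simp only [ρ, ρ', Measure.smul_apply, Measure.finsetSum_apply]
    congr 1
    refine Finset.sum_congr rfl fun i _ => ?_
    rw [← Measure.snd_apply hs, ← Measure.snd_apply hs, Measure.snd_prod]
  have hfst' : (π - ρ + ρ').fst = π.fst := by
    conv_rhs => rw [← hsub]
    rw [Measure.fst_add, Measure.fst_add, hfst]
  have hsnd' : (π - ρ + ρ').snd = π.snd := by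
    conv_rhs => rw [← hsub]
    rw [Measure.snd_add, Measure.snd_add, hsnd]
  have hprob : IsProbabilityMeasure (π - ρ + ρ') := by
    constructor
    rw [← Measure.fst_univ, hfst', Measure.fst_univ, measure_univ]
  have key := hopt _ hprob hfst' hsnd'
  have h1 : ∫⁻ q, f q ∂π = ∫⁻ q, f q ∂(π - ρ) + ∫⁻ q, f q ∂ρ := by
    conv_lhs => rw [← hsub]
    rw [lintegral_add_measure]
  rw [lintegral_add_measure, h1] at key
  have hfin' : ∫⁻ q, f q ∂(π - ρ) ≠ ⊤ := by
    intro h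
    rw [h1, h] at hfin
    simp at hfin
  have key2 := (ENNReal.add_le_add_iff_left hfin').1 key
  simp only [ρ, ρ', lintegral_smul_measure, lintegral_finsetSum_measure, smul_eq_mul] at key2
  have key3 := (ENNReal.mul_le_mul_iff_right hε0 hεt).1 key2
  calc ∑ i, a i ≤ ∑ i, ∫⁻ q, f q ∂(P i) := by
        refine Finset.sum_le_sum fun i _ => ?_
        calc a i = ∫⁻ _, a i ∂(P i) := by simp
          _ ≤ _ := lintegral_mono_ae ((hPmem i).mono fun q hq => ha i q.1 hq.1 q.2 hq.2)
    _ ≤ _ := key3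
    _ ≤ ∑ i, b i := by
        refine Finset.sum_le_sum fun i _ => ?_
        have m1 : ∀ᵐ x ∂(P (σ i)).fst, x ∈ A (σ i) := by
          rw [otp_ae_fst _ (hA _)]
          exact (hPmem _).mono fun q hq => hq.1
        have m2 : ∀ᵐ y ∂(P i).snd, y ∈ B i := by
          rw [otp_ae_snd _ (hB _)]
          exact (hPmem _).mono fun q hq => hq.2
        have m1' : ∀ᵐ q ∂(Q i), q.1 ∈ A (σ i) := Measure.quasiMeasurePreserving_fst.ae m1
        have m2' : ∀ᵐ q ∂(Q i), q.2 ∈ B i := Measure.quasiMeasurePreserving_snd.ae m2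
        calc ∫⁻ q, f q ∂(Q i) ≤ ∫⁻ _, b i ∂(Q i) := by
              refine lintegral_mono_ae ?_
              filter_upwards [m1', m2'] with q h1 h2
              exact hb i q.1 h1 q.2 h2
          _ = b i := by simp


lemma otp_potential {X Y : Type*} [TopologicalSpace X] [TopologicalSpace Y]
    [MeasurableSpace X] [BorelSpace X] [MeasurableSpace Y] [BorelSpace Y]
    (c : X → Y → ℝ) (hc : Continuous (fun q : X × Y => c q.1 q.2))
    (Γ : Set (X × Y)) (hne : Γ.Nonempty)
    (hcm : ∀ (n : ℕ) (p : ℕ → X × Y), (∀ i, p i ∈ Γ) →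
      ∑ i ∈ Finset.range (n + 1), c (p i).1 (p i).2 ≤
        ∑ i ∈ Finset.range n, c (p (i + 1)).1 (p i).2 + c (p 0).1 (p n).2) :
    ∃ (φ : X → ℝ) (ψ : Y → ℝ) (S : Set X) (T : Set Y), Measurable φ ∧ Measurable ψ ∧
      MeasurableSet S ∧ MeasurableSet T ∧ Γ ⊆ S ×ˢ T ∧
      (∀ x ∈ S, ∀ y ∈ T, φ x + ψ y ≤ c x y) ∧ ∀ q ∈ Γ, φ q.1 + ψ q.2 = c q.1 q.2 := by
  obtain ⟨p₀, hp₀⟩ := hne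
  let F : ℕ → (ℕ → X × Y) → X → ℝ := fun n p x =>
    c x (p n).2 - c (p n).1 (p n).2 +
      ∑ i ∈ Finset.range n, (c (p (i + 1)).1 (p i).2 - c (p i).1 (p i).2)
  let I := ℕ × {p : ℕ → X × Y // p 0 = p₀ ∧ ∀ i, p i ∈ Γ}
  let φE : X → EReal := fun x => ⨅ j : I, ((F j.1 j.2.1 x : ℝ) : EReal)
  have hφle : ∀ (n : ℕ) (p : ℕ → X × Y), p 0 = p₀ → (∀ i, p i ∈ Γ) → ∀ x,
      φE x ≤ ((F n p x : ℝ) : EReal) := fun n p h0 hp x =>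
    iInf_le (fun j : I => ((F j.1 j.2.1 x : ℝ) : EReal)) (n, ⟨p, h0, hp⟩)
  have hφtop : ∀ x, φE x ≠ ⊤ := fun x =>
    ne_top_of_le_ne_top (EReal.coe_ne_top _) (hφle 0 (fun _ => p₀) rfl (fun _ => hp₀) x)
  have hφ0 : 0 ≤ φE p₀.1 := by
    refine le_iInf fun j => ?_
    obtain ⟨n, p, h0, hp⟩ := j
    have := hcm n p hp
    rw [Finset.sum_range_succ] at this
    have h2 : 0 ≤ F n p p₀.1 := by
      simp only [F, Finset.sum_sub_distrib]
      rw [h0] at this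
      linarith
    exact_mod_cast h2
  have hstep : ∀ q ∈ Γ, ∀ x', φE x' ≤ φE q.1 + ((c x' q.2 - c q.1 q.2 : ℝ) : EReal) := by
    intro q hq x'
    have : φE x' - ((c x' q.2 - c q.1 q.2 : ℝ) : EReal) ≤ φE q.1 := by
      refine le_iInf fun j => ?_
      obtain ⟨n, p, h0, hp⟩ := j
      rw [EReal.sub_le_iff_le_add (Or.inl (EReal.coe_ne_bot _)) (Or.inl (EReal.coe_ne_top _))]
      have h := hφle (n + 1) (Function.update p (n + 1) q) (by simp [h0]) (by
        intro i
        by_cases hi : i = n + 1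
        · subst hi; simpa using hq
        · simpa [Function.update_of_ne hi] using hp i) x'
      refine h.trans (le_of_eq ?_)
      rw [← EReal.coe_add]
      congr 1
      have e : ∀ i, i ≤ n → Function.update p (n + 1) q i = p i := fun i hi =>
        Function.update_of_ne (by omega) _ _
      simp only [F, Function.update_self, Finset.sum_range_succ, e n le_rfl]
      have e2 : ∑ i ∈ Finset.range n, (c (Function.update p (n + 1) q (i + 1)).1
            (Function.update p (n + 1) q i).2 - c (Function.update p (n + 1) q i).1
            (Function.update p (n + 1) q i).2) =
          ∑ i ∈ Finset.range n, (c (p (i + 1)).1 (p i).2 - c (p i).1 (p i).2) := by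
        refine Finset.sum_congr rfl fun i hi => ?_
        have := Finset.mem_range.1 hi
        rw [e i (by omega), e (i + 1) (by omega)]
      rw [e2]
      ring
    rwa [EReal.sub_le_iff_le_add (Or.inl (EReal.coe_ne_bot _)) (Or.inl (EReal.coe_ne_top _))]
      at this
  have hφbot : ∀ q ∈ Γ, φE q.1 ≠ ⊥ := by
    intro q hq hb
    have := hφ0.trans (hstep q hq p₀.1)
    rw [hb, EReal.bot_add] at this
    simp at this
  have hφm : Measurable φE := by
    apply UpperSemicontinuous.measurable
    refine upperSemicontinuous_iInf fun j => Continuous.upperSemicontinuous ?_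
    refine continuous_coe_real_ereal.comp ?_
    have : Continuous fun x => c x (j.2.1 j.1).2 :=
      hc.comp (continuous_id.prodMk continuous_const)
    exact (this.sub continuous_const).add continuous_const
  let φ : X → ℝ := fun x => (φE x).toReal
  let S : Set X := {x | φE x ≠ ⊥}
  have hφE : ∀ x ∈ S, φE x = ((φ x : ℝ) : EReal) := fun x hx =>
    (EReal.coe_toReal (hφtop x) hx).symm
  let ψE : Y → EReal := fun y => ⨅ x : S, ((c x y - φ x : ℝ) : EReal)
  have hψle : ∀ x ∈ S, ∀ y, ψE y ≤ ((c x y - φ x : ℝ) : EReal) := fun x hx y =>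
    iInf_le (fun x : S => ((c x y - φ x : ℝ) : EReal)) ⟨x, hx⟩
  have hψtop : ∀ y, ψE y ≠ ⊤ := fun y =>
    ne_top_of_le_ne_top (EReal.coe_ne_top _) (hψle p₀.1 (hφbot p₀ hp₀) y)
  have hψm : Measurable ψE := by
    apply UpperSemicontinuous.measurable
    refine upperSemicontinuous_iInf fun j => Continuous.upperSemicontinuous ?_
    refine continuous_coe_real_ereal.comp ?_
    have : Continuous fun y => c j.1 y :=
      hc.comp (continuous_const.prodMk continuous_id)
    exact this.sub continuous_const
  have hψΓ : ∀ q ∈ Γ, ψE q.2 = ((c q.1 q.2 - φ q.1 : ℝ) : EReal) := by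
    intro q hq
    refine le_antisymm (hψle q.1 (hφbot q hq) q.2) (le_iInf fun x => ?_)
    have := hstep q hq x.1
    rw [hφE _ x.2, hφE _ (hφbot q hq), ← EReal.coe_add, EReal.coe_le_coe_iff] at this
    rw [EReal.coe_le_coe_iff]
    linarith
  refine ⟨φ, fun y => (ψE y).toReal, S, {y | ψE y ≠ ⊥}, hφm.ereal_toReal, hψm.ereal_toReal,
    (hφm (measurableSet_singleton ⊥)).compl, (hψm (measurableSet_singleton ⊥)).compl, ?_, ?_, ?_⟩
  · intro q hq
    refine ⟨hφbot q hq, ?_⟩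
    change ψE q.2 ≠ ⊥
    rw [hψΓ q hq]
    exact EReal.coe_ne_bot _
  · intro x hx y hy
    have := hψle x hx y
    rw [← EReal.coe_toReal (hψtop y) hy, EReal.coe_le_coe_iff] at this
    linarith
  · intro q hq
    change φ q.1 + (ψE q.2).toReal = _
    rw [hψΓ q hq, EReal.toReal_coe]
    ring

lemma otp_clamp1 (u v c k : ℝ) (hk : 0 ≤ k) (hc : 0 ≤ c) (h : u + v ≤ c) :
    max (-k) (min u k) + max (-k) (min v k) ≤ c := by
  grind
lemma otp_clamp2 (u v k : ℝ) (hk : 0 ≤ k) (h : 0 ≤ u + v) :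
    0 ≤ max (-k) (min u k) + max (-k) (min v k) := by
  grind

lemma otp_cm_opt {X Y : Type*} [TopologicalSpace X] [TopologicalSpace Y]
    [MeasurableSpace X] [BorelSpace X] [MeasurableSpace Y] [BorelSpace Y]
    (c : X → Y → ℝ) (hc : Continuous (fun q : X × Y => c q.1 q.2)) (hc0 : ∀ x y, 0 ≤ c x y)
    (π π' : Measure (X × Y)) [IsProbabilityMeasure π] [IsProbabilityMeasure π']
    (hfst : π'.fst = π.fst) (hsnd : π'.snd = π.snd)
    (Γ : Set (X × Y)) (hne : Γ.Nonempty) (hΓ : ∀ᵐ q ∂π, q ∈ Γ)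
    (hcm : ∀ (n : ℕ) (p : ℕ → X × Y), (∀ i, p i ∈ Γ) →
      ∑ i ∈ Finset.range (n + 1), c (p i).1 (p i).2 ≤
        ∑ i ∈ Finset.range n, c (p (i + 1)).1 (p i).2 + c (p 0).1 (p n).2) :
    ∫⁻ q, ENNReal.ofReal (c q.1 q.2) ∂π ≤ ∫⁻ q, ENNReal.ofReal (c q.1 q.2) ∂π' := by
  obtain ⟨φ, ψ, S, T, hφ, hψ, hS, hT, hΓST, hle, heq⟩ := otp_potential c hc Γ hne hcm
  let cl : ℝ → ℝ → ℝ := fun k u => max (-k) (min u k)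
  have hclm : ∀ k, Measurable (cl k) := fun k => by fun_prop
  have hclb : ∀ k u, 0 ≤ k → ‖cl k u‖ ≤ k := fun k u hk => by
    rw [Real.norm_eq_abs, abs_le]; simp only [cl]; grind
  let ξ : ℕ → X × Y → ℝ := fun k q => cl k (φ q.1) + cl k (ψ q.2)
  have hξm : ∀ k, Measurable (ξ k) := fun k =>
    ((hclm k).comp (hφ.comp measurable_fst)).add ((hclm k).comp (hψ.comp measurable_snd))
  have hint1 : ∀ (P : Measure (X × Y)) [IsProbabilityMeasure P] (k : ℕ),
      Integrable (fun q => cl k (φ q.1)) P := fun P _ k =>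
    Integrable.of_bound ((hclm k).comp (hφ.comp measurable_fst)).aestronglyMeasurable (k : ℝ)
      (Eventually.of_forall fun q => hclb k _ (Nat.cast_nonneg k))
  have hint2 : ∀ (P : Measure (X × Y)) [IsProbabilityMeasure P] (k : ℕ),
      Integrable (fun q => cl k (ψ q.2)) P := fun P _ k =>
    Integrable.of_bound ((hclm k).comp (hψ.comp measurable_snd)).aestronglyMeasurable (k : ℝ)
      (Eventually.of_forall fun q => hclb k _ (Nat.cast_nonneg k))
  have hI : ∀ (P : Measure (X × Y)) [IsProbabilityMeasure P] (k : ℕ),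
      ∫ q, ξ k q ∂P = ∫ x, cl k (φ x) ∂P.fst + ∫ y, cl k (ψ y) ∂P.snd := by
    intro P _ k
    rw [Measure.fst, Measure.snd, integral_map measurable_fst.aemeasurable
      (f := fun x => cl k (φ x)) ((hclm k).comp hφ).aestronglyMeasurable, integral_map measurable_snd.aemeasurable
      (f := fun x => cl k (ψ x)) ((hclm k).comp hψ).aestronglyMeasurable]
    exact integral_add (hint1 P k) (hint2 P k)
  have hS' : ∀ᵐ q ∂π', q.1 ∈ S := by
    have : ∀ᵐ x ∂π'.fst, x ∈ S := by
      rw [hfst, otp_ae_fst _ hS]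
      exact hΓ.mono fun q hq => (hΓST hq).1
    rwa [otp_ae_fst _ hS] at this
  have hT' : ∀ᵐ q ∂π', q.2 ∈ T := by
    have : ∀ᵐ x ∂π'.snd, x ∈ T := by
      rw [hsnd, otp_ae_snd _ hT]
      exact hΓ.mono fun q hq => (hΓST hq).2
    rwa [otp_ae_snd _ hT] at this
  have hbound : ∀ k, ∫⁻ q, ENNReal.ofReal (ξ k q) ∂π ≤
      ∫⁻ q, ENNReal.ofReal (c q.1 q.2) ∂π' := by
    intro k
    have hi' : Integrable (ξ k) π' := (hint1 π' k).add (hint2 π' k)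
    have hi : Integrable (ξ k) π := (hint1 π k).add (hint2 π k)
    rw [← ofReal_integral_eq_lintegral_ofReal hi]
    · rw [show ∫ q, ξ k q ∂π = ∫ q, ξ k q ∂π' by
        rw [hI π' k, hfst, hsnd, ← hI π k]]
      calc ENNReal.ofReal (∫ q, ξ k q ∂π') ≤ ENNReal.ofReal (∫ q, max (ξ k q) 0 ∂π') := by
            refine ENNReal.ofReal_le_ofReal (integral_mono hi' hi'.pos_part fun q => le_max_left _ _)
        _ = ∫⁻ q, ENNReal.ofReal (max (ξ k q) 0) ∂π' :=
            ofReal_integral_eq_lintegral_ofReal hi'.pos_part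
              (Eventually.of_forall fun q => le_max_right _ _)
        _ ≤ _ := by
            refine lintegral_mono_ae ?_
            filter_upwards [hS', hT'] with q h1 h2
            refine ENNReal.ofReal_le_ofReal (max_le ?_ (hc0 _ _))
            exact otp_clamp1 _ _ _ _ (Nat.cast_nonneg k) (hc0 _ _) (hle _ h1 _ h2)
    · filter_upwards [hΓ] with q hq
      exact otp_clamp2 _ _ _ (Nat.cast_nonneg k) (by rw [heq q hq]; exact hc0 _ _)
  calc ∫⁻ q, ENNReal.ofReal (c q.1 q.2) ∂π
      ≤ ∫⁻ q, liminf (fun k => ENNReal.ofReal (ξ k q)) atTop ∂π := by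
        refine lintegral_mono_ae ?_
        filter_upwards [hΓ] with q hq
        refine le_of_eq (Tendsto.liminf_eq ?_).symm
        refine tendsto_const_nhds.congr' ?_
        obtain ⟨N, hN⟩ := exists_nat_ge (max |φ q.1| |ψ q.2|)
        filter_upwards [eventually_ge_atTop N] with k hk
        have hk' : (N : ℝ) ≤ k := by exact_mod_cast hk
        have h1 := (max_le_iff.1 (hN.trans hk')).1
        have h2 := (max_le_iff.1 (hN.trans hk')).2
        rw [abs_le] at h1 h2
        rw [← heq q hq]
        simp only [ξ, cl]
        rw [min_eq_left h1.2, min_eq_left h2.2, max_eq_right h1.1, max_eq_right h2.1]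
    _ ≤ liminf (fun k => ∫⁻ q, ENNReal.ofReal (ξ k q) ∂π) atTop :=
        lintegral_liminf_le fun k => (hξm k).ennreal_ofReal
    _ ≤ liminf (fun _ : ℕ => ∫⁻ q, ENNReal.ofReal (c q.1 q.2) ∂π') atTop :=
        liminf_le_liminf (Eventually.of_forall hbound)
    _ = _ := by simp

lemma otp_limit_cm {X Y : Type*}
    [MetricSpace X] [SecondCountableTopology X] [MeasurableSpace X] [BorelSpace X]
    [MetricSpace Y] [SecondCountableTopology Y] [MeasurableSpace Y] [BorelSpace Y]
    (x₀ : X) (y₀ : Y)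
    (cn : ℕ → X → Y → ℝ) (c : X → Y → ℝ)
    (hc_cont : Continuous (fun q : X × Y => c q.1 q.2))
    (hc_nonneg : ∀ x y, 0 ≤ c x y)
    (hcconv : ∀ m : ℕ, TendstoUniformlyOn (fun (n : ℕ) (q : X × Y) => cn n q.1 q.2)
        (fun q : X × Y => c q.1 q.2) atTop
        ((Metric.closedBall x₀ (m : ℝ)) ×ˢ (Metric.closedBall y₀ (m : ℝ))))
    (πn : ℕ → ProbabilityMeasure (X × Y)) (π : ProbabilityMeasure (X × Y))
    (hlim : Tendsto πn atTop (𝓝 π))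
    (hfin : ∀ n, ∫⁻ q, ENNReal.ofReal (cn n q.1 q.2) ∂(πn n : Measure (X × Y)) ≠ ⊤)
    (hopt : ∀ n, ∀ π' : Measure (X × Y), IsProbabilityMeasure π' →
      π'.fst = (πn n : Measure (X × Y)).fst → π'.snd = (πn n : Measure (X × Y)).snd →
      ∫⁻ q, ENNReal.ofReal (cn n q.1 q.2) ∂(πn n : Measure (X × Y)) ≤
        ∫⁻ q, ENNReal.ofReal (cn n q.1 q.2) ∂π')
    (n : ℕ) (p : ℕ → X × Y) (hp : ∀ i, p i ∈ (π : Measure (X × Y)).support) :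
      ∑ i ∈ Finset.range (n + 1), c (p i).1 (p i).2 ≤
        ∑ i ∈ Finset.range n, c (p (i + 1)).1 (p i).2 + c (p 0).1 (p n).2 := by
  let P : Fin (n + 1) → X × Y := fun i => p i
  let σ := finRotate (n + 1)
  have hR : ∑ i, c (P (σ i)).1 (P i).2 =
      ∑ i ∈ Finset.range n, c (p (i + 1)).1 (p i).2 + c (p 0).1 (p n).2 := by
    rw [Fin.sum_univ_castSucc, Finset.sum_range]
    congr 1
    · refine Finset.sum_congr rfl fun i _ => ?_
      have : σ i.castSucc = ⟨i + 1, Nat.succ_lt_succ i.2⟩ := finRotate_of_lt i.2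
      rw [this]
      rfl
    · have : σ (Fin.last n) = 0 := finRotate_last
      rw [this]
      simp [P]
  rw [← hR, Finset.sum_range]
  change ∑ i, c (P i).1 (P i).2 ≤ _
  -- approximate
  have main : ∀ δ > 0, ∑ i, (c (P i).1 (P i).2 - δ) ≤ ∑ i, (c (P (σ i)).1 (P i).2 + δ) := by
    intro δ hδ
    have hr : ∀ i j, ∀ᶠ r in 𝓝[>] (0 : ℝ), ∀ x ∈ Metric.ball (P j).1 r,
        ∀ y ∈ Metric.ball (P i).2 r, |c x y - c (P j).1 (P i).2| < δ / 2 := by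
      intro i j
      obtain ⟨r₀, hr₀, h⟩ := Metric.continuous_iff.1 hc_cont ((P j).1, (P i).2) (δ / 2) (by linarith)
      filter_upwards [Ioo_mem_nhdsGT hr₀] with r hr x hx y hy
      refine h (x, y) ?_
      rw [Prod.dist_eq]
      exact max_lt ((Metric.mem_ball.1 hx).trans hr.2) ((Metric.mem_ball.1 hy).trans hr.2)
    have hr' := eventually_all.2 fun i => eventually_all.2 fun j => hr i j
    obtain ⟨r, hrc, hr0⟩ := (hr'.and self_mem_nhdsWithin).exists
    have hr0 : 0 < r := hr0
    have hm : ∀ i, ∀ᶠ m : ℕ in atTop, dist (P i).1 x₀ + r ≤ m ∧ dist (P i).2 y₀ + r ≤ m :=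
      fun i => (tendsto_natCast_atTop_atTop.eventually_ge_atTop _).and
        (tendsto_natCast_atTop_atTop.eventually_ge_atTop _)
    obtain ⟨m, hm⟩ := (eventually_all.2 hm).exists
    have hopen : ∀ i, IsOpen (Metric.ball (P i).1 r ×ˢ Metric.ball (P i).2 r) := fun i =>
      Metric.isOpen_ball.prod Metric.isOpen_ball
    have hpos : ∀ i, ∀ᶠ k in atTop,
        (πn k : Measure (X × Y)) (Metric.ball (P i).1 r ×ˢ Metric.ball (P i).2 r) ≠ 0 := by
      intro i
      have h1 : 0 < (π : Measure (X × Y)) (Metric.ball (P i).1 r ×ˢ Metric.ball (P i).2 r) :=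
        (Measure.mem_support_iff_forall _).1 (hp i) _ ((hopen i).mem_nhds
          ⟨Metric.mem_ball_self hr0, Metric.mem_ball_self hr0⟩)
      have h2 := h1.trans_le
        (ProbabilityMeasure.le_liminf_measure_open_of_tendsto hlim (hopen i))
      exact (eventually_lt_of_lt_liminf h2).mono fun k hk => hk.ne'
    obtain ⟨k, hkpos, hkc⟩ := ((eventually_all.2 hpos).and
      (Metric.tendstoUniformlyOn_iff.1 (hcconv m) (δ / 2) (by linarith))).exists
    have hclose : ∀ i j, ∀ x ∈ Metric.ball (P j).1 r, ∀ y ∈ Metric.ball (P i).2 r,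
        |cn k x y - c (P j).1 (P i).2| < δ := by
      intro i j x hx y hy
      have h1 := hrc i j x hx y hy
      have h2 := hkc (x, y) ⟨by
        rw [Metric.mem_closedBall]
        have := dist_triangle x (P j).1 x₀
        have := (hm j).1
        rw [Metric.mem_ball] at hx
        linarith, by
        rw [Metric.mem_closedBall]
        have := dist_triangle y (P i).2 y₀
        have := (hm i).2
        rw [Metric.mem_ball] at hy
        linarith⟩
      rw [Real.dist_eq] at h2
      rw [abs_lt] at h1 h2 ⊢
      simp only at h2
      constructor <;> linarith
    have key := otp_swap σ (fun q : X × Y => ENNReal.ofReal (cn k q.1 q.2)) (πn k : Measure (X × Y))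
      (hfin k) (hopt k) (fun i => Metric.ball (P i).1 r) (fun i => Metric.ball (P i).2 r)
      (fun i => Metric.isOpen_ball.measurableSet) (fun i => Metric.isOpen_ball.measurableSet)
      hkpos (fun i => ENNReal.ofReal (c (P i).1 (P i).2 - δ))
      (fun i => ENNReal.ofReal (c (P (σ i)).1 (P i).2 + δ))
      (fun i x hx y hy => ENNReal.ofReal_le_ofReal
        (by have := (abs_lt.1 (hclose i i x hx y hy)).1; simp only; linarith))
      (fun i x hx y hy => ENNReal.ofReal_le_ofReal
        (by have := (abs_lt.1 (hclose i (σ i) x hx y hy)).2; simp only; linarith))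
    have hb0 : ∀ i, 0 ≤ c (P (σ i)).1 (P i).2 + δ := fun i => by
      have := hc_nonneg (P (σ i)).1 (P i).2
      linarith
    rw [← ENNReal.ofReal_sum_of_nonneg (fun i _ => hb0 i)] at key
    calc ∑ i, (c (P i).1 (P i).2 - δ) ≤ ∑ i, max (c (P i).1 (P i).2 - δ) 0 :=
          Finset.sum_le_sum fun i _ => le_max_left _ _
      _ ≤ _ := by
          rw [← ENNReal.ofReal_le_ofReal_iff (Finset.sum_nonneg fun i _ => hb0 i),
            ENNReal.ofReal_sum_of_nonneg (fun i _ => le_max_right _ _)]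
          refine le_trans (Finset.sum_le_sum fun i _ => le_of_eq ?_) key
          rcases le_total (c (P i).1 (P i).2 - δ) 0 with h | h
          · rw [max_eq_right h, ENNReal.ofReal_of_nonpos h, ENNReal.ofReal_zero]
          · rw [max_eq_left h]
  refine le_of_forall_pos_le_add fun η hη => ?_
  have hN : (0 : ℝ) < n + 1 := by positivity
  have := main (η / (2 * (n + 1))) (by positivity)
  simp only [Finset.sum_sub_distrib, Finset.sum_add_distrib, Finset.sum_const, Finset.card_univ,
    Fintype.card_fin, nsmul_eq_mul, Nat.cast_add, Nat.cast_one] at this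
  have e : ((n : ℝ) + 1) * (η / (2 * (n + 1))) = η / 2 := by field_simp
  rw [e] at this
  linarith

lemma otp_tight {X : Type*} [MetricSpace X] [CompleteSpace X] [SecondCountableTopology X]
    [MeasurableSpace X] [BorelSpace X] (μn : ℕ → ProbabilityMeasure X) (μ : ProbabilityMeasure X)
    (hμ : Tendsto μn atTop (𝓝 μ)) :
    IsTightMeasureSet {((ν : ProbabilityMeasure X) : Measure X) | ν ∈ Set.range μn} := by
  have hc : IsCompact (insert μ (Set.range μn)) := hμ.isCompact_insert_range
  exact isTightMeasureSet_of_isCompact_closure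
    (hc.of_isClosed_subset isClosed_closure
      (closure_minimal (Set.subset_insert _ _) hc.isClosed))

/-- **Stability of optimal transference plans.** If `(c_n, μ_n, ν_n) → (c, μ, ν)` (uniform
convergence of the costs on products of closed balls, weak convergence of the marginals),
all integrals `∫ c_n dμ_n dν_n` and `∫ c dμ dν` are finite, and `π_n` is an optimal
transference plan for `(c_n, μ_n, ν_n)`, then some subsequence of `(π_n)` converges weakly
to an element of `Π(μ,ν)`, and every weak subsequential limit of `(π_n)` is an optimal
transference plan for `(c, μ, ν)`. -/
theorem optimal_plans_stability
    {X Y : Type*}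
    [MetricSpace X] [CompleteSpace X] [SecondCountableTopology X]
    [MeasurableSpace X] [BorelSpace X]
    [MetricSpace Y] [CompleteSpace Y] [SecondCountableTopology Y]
    [MeasurableSpace Y] [BorelSpace Y]
    (x₀ : X) (y₀ : Y)
    (cn : ℕ → X → Y → ℝ) (c : X → Y → ℝ)
    (hcn_cont : ∀ n, Continuous (fun q : X × Y => cn n q.1 q.2))
    (hcn_nonneg : ∀ n x y, 0 ≤ cn n x y)
    (hc_cont : Continuous (fun q : X × Y => c q.1 q.2))
    (hc_nonneg : ∀ x y, 0 ≤ c x y)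
    (μn : ℕ → ProbabilityMeasure X) (μ : ProbabilityMeasure X)
    (νn : ℕ → ProbabilityMeasure Y) (ν : ProbabilityMeasure Y)
    (hintn : ∀ n, ∫⁻ q, ENNReal.ofReal (cn n q.1 q.2)
        ∂((μn n : Measure X).prod (νn n : Measure Y)) < ⊤)
    (hint : ∫⁻ q, ENNReal.ofReal (c q.1 q.2)
        ∂((μ : Measure X).prod (ν : Measure Y)) < ⊤)
    (hcconv : ∀ m : ℕ, TendstoUniformlyOn (fun (n : ℕ) (q : X × Y) => cn n q.1 q.2)
        (fun q : X × Y => c q.1 q.2) atTop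
        ((Metric.closedBall x₀ (m : ℝ)) ×ˢ (Metric.closedBall y₀ (m : ℝ))))
    (hμ : Tendsto μn atTop (𝓝 μ)) (hν : Tendsto νn atTop (𝓝 ν))
    (πn : ℕ → ProbabilityMeasure (X × Y))
    (hπn_fst : ∀ n, (πn n : Measure (X × Y)).fst = (μn n : Measure X))
    (hπn_snd : ∀ n, (πn n : Measure (X × Y)).snd = (νn n : Measure Y))
    (hπn_opt : ∀ n, ∫⁻ q, ENNReal.ofReal (cn n q.1 q.2) ∂(πn n : Measure (X × Y)) =
        deterCost (cn n) (μn n : Measure X) (νn n : Measure Y)) :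
    (∃ (s : ℕ → ℕ), StrictMono s ∧ ∃ π : ProbabilityMeasure (X × Y),
        (π : Measure (X × Y)).fst = (μ : Measure X) ∧
        (π : Measure (X × Y)).snd = (ν : Measure Y) ∧
        Tendsto (fun k => πn (s k)) atTop (𝓝 π)) ∧
    (∀ (s : ℕ → ℕ), StrictMono s → ∀ π : ProbabilityMeasure (X × Y),
        Tendsto (fun k => πn (s k)) atTop (𝓝 π) →
        (π : Measure (X × Y)).fst = (μ : Measure X) ∧
        (π : Measure (X × Y)).snd = (ν : Measure Y) ∧
        ∫⁻ q, ENNReal.ofReal (c q.1 q.2) ∂(π : Measure (X × Y)) =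
          deterCost c (μ : Measure X) (ν : Measure Y)) := by
  have marg : ∀ (s : ℕ → ℕ), StrictMono s → ∀ π : ProbabilityMeasure (X × Y),
      Tendsto (fun k => πn (s k)) atTop (𝓝 π) →
      (π : Measure (X × Y)).fst = (μ : Measure X) ∧
      (π : Measure (X × Y)).snd = (ν : Measure Y) := by
    intro s hs π hπ
    have h1 := ProbabilityMeasure.tendsto_map_of_tendsto_of_continuous _ _ hπ continuous_fst
    have h2 := ProbabilityMeasure.tendsto_map_of_tendsto_of_continuous _ _ hπ continuous_snd
    have e1 : ∀ k, (πn (s k)).map continuous_fst.measurable.aemeasurable = μn (s k) := fun k =>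
      Subtype.ext (hπn_fst (s k))
    have e2 : ∀ k, (πn (s k)).map continuous_snd.measurable.aemeasurable = νn (s k) := fun k =>
      Subtype.ext (hπn_snd (s k))
    simp only [e1] at h1
    simp only [e2] at h2
    have u1 := tendsto_nhds_unique h1 (hμ.comp hs.tendsto_atTop)
    have u2 := tendsto_nhds_unique h2 (hν.comp hs.tendsto_atTop)
    exact ⟨congrArg (fun m : ProbabilityMeasure X => (m : Measure X)) u1,
      congrArg (fun m : ProbabilityMeasure Y => (m : Measure Y)) u2⟩
  refine ⟨?_, ?_⟩
  · have ht : IsTightMeasureSet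
        {((π : ProbabilityMeasure (X × Y)) : Measure (X × Y)) | π ∈ Set.range πn} := by
      refine IsTightMeasureSet.prodMk ((otp_tight μn μ hμ).subset ?_)
        ((otp_tight νn ν hν).subset ?_)
      · rintro _ ⟨_, ⟨_, ⟨n, rfl⟩, rfl⟩, rfl⟩
        exact ⟨μn n, ⟨n, rfl⟩, (hπn_fst n).symm⟩
      · rintro _ ⟨_, ⟨_, ⟨n, rfl⟩, rfl⟩, rfl⟩
        exact ⟨νn n, ⟨n, rfl⟩, (hπn_snd n).symm⟩
    obtain ⟨π, -, s, hs, hπ⟩ := (isCompact_closure_of_isTightMeasureSet ht).isSeqCompact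
      (fun n => subset_closure (Set.mem_range_self n) : ∀ n, πn n ∈ closure (Set.range πn))
    exact ⟨s, hs, π, (marg s hs π hπ).1, (marg s hs π hπ).2, hπ⟩
  · intro s hs π hπ
    obtain ⟨hf, hsn⟩ := marg s hs π hπ
    refine ⟨hf, hsn, le_antisymm ?_ ?_⟩
    · refine le_iInf₂ fun π' hπ' => ?_
      obtain ⟨hprob, hf', hsn'⟩ := hπ'
      have hopt : ∀ n, ∀ ρ : Measure (X × Y), IsProbabilityMeasure ρ →
          ρ.fst = (πn n : Measure (X × Y)).fst → ρ.snd = (πn n : Measure (X × Y)).snd →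
          ∫⁻ q, ENNReal.ofReal (cn n q.1 q.2) ∂(πn n : Measure (X × Y)) ≤
            ∫⁻ q, ENNReal.ofReal (cn n q.1 q.2) ∂ρ := by
        intro n ρ h1 h2 h3
        rw [hπn_opt n]
        exact iInf₂_le ρ ⟨h1, h2.trans (hπn_fst n), h3.trans (hπn_snd n)⟩
      have hfin : ∀ n, ∫⁻ q, ENNReal.ofReal (cn n q.1 q.2) ∂(πn n : Measure (X × Y)) ≠ ⊤ := by
        intro n
        refine ((hopt n _ inferInstance ?_ ?_).trans_lt (hintn n)).ne
        · rw [Measure.fst_prod, hπn_fst n]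
        · rw [Measure.snd_prod, hπn_snd n]
      refine otp_cm_opt c hc_cont hc_nonneg (π : Measure (X × Y)) π' (hf'.trans hf.symm)
        (hsn'.trans hsn.symm) (π : Measure (X × Y)).support
        (Measure.nonempty_support (IsProbabilityMeasure.ne_zero _)) Measure.support_mem_ae ?_
      refine otp_limit_cm x₀ y₀ (fun k => cn (s k)) c hc_cont hc_nonneg ?_
        (fun k => πn (s k)) π hπ (fun k => hfin (s k)) (fun k => hopt (s k))
      intro m
      rw [Metric.tendstoUniformlyOn_iff]
      intro ε hε
      exact hs.tendsto_atTop.eventually (Metric.tendstoUniformlyOn_iff.1 (hcconv m) ε hε)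
    · exact iInf₂_le (π : Measure (X × Y)) ⟨inferInstance, hf, hsn⟩
end

section
/- Let X and Y be Polish spaces, let c : X×Y → [0,∞] be a function, and let c_n : X×Y → ℝ be a nondecreasing sequence of bounded continuous functions with c_n(x,y) ↑ c(x,y) pointwise. Then for any μ ∈ P(X) and ν ∈ P(Y), C^deter(c,μ,ν) ≤ liminf_{n→∞} C^deter(c_n,μ,ν). -/
open MeasureTheory ProbabilityTheory Filter ENNReal

/-- The deterministic Monge–Kantorovich cost `C^deter(c,μ,ν)` for an `ℝ≥0∞`-valued cost:
the infimum over all couplings `π ∈ Π(μ,ν)` of `∫ c dπ`. -/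
noncomputable def deterCostE {X Y : Type*} [MeasurableSpace X] [MeasurableSpace Y]
    (c : X → Y → ℝ≥0∞) (μ : Measure X) (ν : Measure Y) : ℝ≥0∞ :=
  ⨅ π ∈ {π : Measure (X × Y) | IsProbabilityMeasure π ∧ π.fst = μ ∧ π.snd = ν},
    ∫⁻ q, c q.1 q.2 ∂π

/-- **Lower semicontinuity of the optimal cost along monotone approximation.**
If `c_n` is a nondecreasing sequence of bounded continuous cost functions increasing
pointwise to `c : X × Y → [0,∞]`, then
`C^deter(c,μ,ν) ≤ liminf_n C^deter(c_n,μ,ν)`. -/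
theorem deterCost_le_liminf_of_monotone_approx
    {X Y : Type*}
    [TopologicalSpace X] [PolishSpace X] [MeasurableSpace X] [BorelSpace X]
    [TopologicalSpace Y] [PolishSpace Y] [MeasurableSpace Y] [BorelSpace Y]
    (c : X → Y → ℝ≥0∞) (cn : ℕ → X → Y → ℝ)
    (hcn_cont : ∀ n, Continuous (fun q : X × Y => cn n q.1 q.2))
    (hcn_bdd : ∀ n, ∃ B : ℝ, ∀ x y, |cn n x y| ≤ B)
    (hcn_mono : ∀ x y, Monotone (fun n => cn n x y))
    (hcn_tendsto : ∀ x y, (⨆ n, ENNReal.ofReal (cn n x y)) = c x y)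
    (μ : Measure X) [IsProbabilityMeasure μ] (ν : Measure Y) [IsProbabilityMeasure ν] :
    deterCostE c μ ν ≤
      atTop.liminf (fun n => deterCostE (fun x y => ENNReal.ofReal (cn n x y)) μ ν) := by
  classical
  -- the set of couplings is compact
  let S : Set (ProbabilityMeasure (X × Y)) :=
    {π | (π : Measure (X × Y)).fst = μ ∧ (π : Measure (X × Y)).snd = ν}
  have hSclosed : IsClosed S := by
    let μ' : ProbabilityMeasure X := ⟨μ, inferInstance⟩
    let ν' : ProbabilityMeasure Y := ⟨ν, inferInstance⟩
    have hS : S = (fun π : ProbabilityMeasure (X × Y) =>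
          π.map (continuous_fst (X := X) (Y := Y)).measurable.aemeasurable) ⁻¹' {μ'} ∩
        (fun π : ProbabilityMeasure (X × Y) =>
          π.map (continuous_snd (X := X) (Y := Y)).measurable.aemeasurable) ⁻¹' {ν'} := by
      ext π
      constructor
      · rintro ⟨h1, h2⟩
        exact ⟨Subtype.ext h1, Subtype.ext h2⟩
      · rintro ⟨h1, h2⟩
        exact ⟨congrArg Subtype.val h1, congrArg Subtype.val h2⟩
    rw [hS]
    exact (isClosed_singleton.preimage (ProbabilityMeasure.continuous_map continuous_fst)).inter
      (isClosed_singleton.preimage (ProbabilityMeasure.continuous_map continuous_snd))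
  have hScomp : IsCompact S := by
    rw [← hSclosed.closure_eq]
    apply isCompact_closure_of_isTightMeasureSet
    apply IsTightMeasureSet.prodMk
    · refine (isTightMeasureSet_singleton (μ := μ)).subset ?_
      rintro _ ⟨_, ⟨π, hπ, rfl⟩, rfl⟩
      exact hπ.1
    · refine (isTightMeasureSet_singleton (μ := ν)).subset ?_
      rintro _ ⟨_, ⟨π, hπ, rfl⟩, rfl⟩
      exact hπ.2
  have hmono : ∀ m n, m ≤ n → ∀ π : Measure (X × Y),
      ∫⁻ q, ENNReal.ofReal (cn m q.1 q.2) ∂π ≤ ∫⁻ q, ENNReal.ofReal (cn n q.1 q.2) ∂π :=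
    fun m n h π => lintegral_mono fun q => ENNReal.ofReal_le_ofReal (hcn_mono q.1 q.2 h)
  have hcont : ∀ n, Continuous (fun π : ProbabilityMeasure (X × Y) =>
      ∫⁻ q, ENNReal.ofReal (cn n q.1 q.2) ∂(π : Measure (X × Y))) := by
    intro n
    obtain ⟨B, hB⟩ := hcn_bdd n
    let f : BoundedContinuousFunction (X × Y) NNReal :=
      BoundedContinuousFunction.mkOfBound
        ⟨fun q => (cn n q.1 q.2).toNNReal, continuous_real_toNNReal.comp (hcn_cont n)⟩ (B + B) (by
          intro p q
          rw [NNReal.dist_eq]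
          simp only [ContinuousMap.coe_mk, Real.coe_toNNReal']
          have h1 := abs_le.1 (hB p.1 p.2)
          have h2 := abs_le.1 (hB q.1 q.2)
          rw [abs_le]
          grind)
    rw [continuous_iff_continuousAt]
    intro π
    exact ProbabilityMeasure.tendsto_iff_forall_lintegral_tendsto.1 tendsto_id f
  refine le_of_forall_gt_imp_ge_of_dense fun b hb => ?_
  have hlt : ∀ m, deterCostE (fun x y => ENNReal.ofReal (cn m x y)) μ ν < b := by
    intro m
    refine lt_of_le_of_lt (le_liminf_of_le (by isBoundedDefault) ?_) hb
    filter_upwards [eventually_ge_atTop m] with n hn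
    exact iInf₂_mono fun π _ => hmono m n hn π
  let A : ℕ → Set (ProbabilityMeasure (X × Y)) := fun n =>
    S ∩ {π | ∫⁻ q, ENNReal.ofReal (cn n q.1 q.2) ∂(π : Measure (X × Y)) ≤ b}
  have hAcl : ∀ n, IsClosed (A n) := fun n =>
    hSclosed.inter (isClosed_le (hcont n) continuous_const)
  have hne : (⋂ n, A n).Nonempty := by
    apply IsCompact.nonempty_iInter_of_sequence_nonempty_isCompact_isClosed
    · rintro n π ⟨h1, h2⟩
      exact ⟨h1, (hmono n (n + 1) n.le_succ π).trans h2⟩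
    · intro n
      have h := hlt n
      simp only [deterCostE, iInf_lt_iff] at h
      obtain ⟨π, ⟨hp, h1, h2⟩, h3⟩ := h
      exact ⟨⟨π, hp⟩, ⟨h1, h2⟩, h3.le⟩
    · exact hScomp.of_isClosed_subset (hAcl 0) Set.inter_subset_left
    · exact hAcl
  obtain ⟨π, hπ⟩ := hne
  rw [Set.mem_iInter] at hπ
  refine (iInf₂_le (π : Measure (X × Y)) ⟨inferInstance, (hπ 0).1.1, (hπ 0).1.2⟩).trans ?_
  simp only [← hcn_tendsto]
  rw [lintegral_iSup (fun n => (hcn_cont n).measurable.ennreal_ofReal)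
    (fun m n h q => ENNReal.ofReal_le_ofReal (hcn_mono q.1 q.2 h))]
  exact iSup_le fun n => (hπ n).2
end
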